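/- Let q be a prime power. For every real number u with |u| < 1/q, the series ∑_{n=0}^∞ U_n u^n / |GU(n,q)| converges, the family of factors (1 - (-1)^l u^i q^{1-l})^{-1} indexed by pairs (i,l) with i ≥ 1 and l ≥ 0 is multipliable in ℝ, and ∑_{n=0}^∞ U_n u^n / |GU(n,q)| = ∏_{i ≥ 1} ∏_{l ≥ 0} (1 - (-1)^l u^i q^{1-l})^{-1}. -/

import Mathlib

open Matrix

/-- `|GU(n,q)| = q^{n(n-1)/2} ∏_{i=1}^n (q^i - (-1)^i)`, as a real number. -/
noncomputable def guOrder (q n : ℕ) : ℝ :=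
  (q : ℝ) ^ (n * (n - 1) / 2) *
    ∏ i ∈ Finset.range n, ((q : ℝ) ^ (i + 1) - (-1 : ℝ) ^ (i + 1))

/-- `U_n`: the number of ordered pairs of commuting elements of the Lie algebra
`gu(n,q) = {A : A* = -A}` of skew-Hermitian `n × n` matrices over the field `K` with `q²`
elements, where `A*` is the conjugate-transpose `(A.map (·^q))ᵀ`. -/
noncomputable def guCommPairs (q : ℕ) (K : Type) [Field K] [Fintype K] (n : ℕ) : ℕ :=
  Nat.card {P : Matrix (Fin n) (Fin n) K × Matrix (Fin n) (Fin n) K //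
    (P.1.map (fun a => a ^ q))ᵀ = -P.1 ∧ (P.2.map (fun a => a ^ q))ᵀ = -P.2 ∧
    P.1 * P.2 = P.2 * P.1}

set_option linter.all false


namespace FFU

/-! ### Counting helpers -/

theorem card_fibers {α β : Type*} [Finite α] [Finite β] (f : α → β) (c : ℕ)
    (h : ∀ b, Nat.card {a // f a = b} = c) : Nat.card α = Nat.card β * c := by
  classical
  have := Fintype.ofFinite β
  rw [← Nat.card_congr (Equiv.sigmaFiberEquiv f), Nat.card_sigma]
  simp [h, Nat.card_eq_fintype_card]

theorem card_sum_fibers {α β : Type*} [Finite α] [Fintype β] (f : α → β) :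
    Nat.card α = ∑ b, Nat.card {a // f a = b} := by
  classical
  rw [← Nat.card_congr (Equiv.sigmaFiberEquiv f), Nat.card_sigma]

/-! ### Finite fields with an involution -/
section field
variable {E : Type*} [Field E] [Finite E] {σ : E →+* E} (hσ : ∀ x, σ (σ x) = x)
  (hne : ∃ x, σ x ≠ x)
include hσ hne

omit [Finite E] in
theorem exists_trace_one : ∃ t : E, t + σ t = 1 := by
  obtain ⟨w, hw⟩ := hne
  have hd : w - σ w ≠ 0 := fun h => hw (sub_eq_zero.mp h).symm
  have hd' : σ w - w ≠ 0 := sub_ne_zero.mpr hw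
  refine ⟨w / (w - σ w), ?_⟩
  rw [map_div₀, map_sub, hσ]
  rw [div_add_div _ _ hd hd', div_eq_one_iff_eq (mul_ne_zero hd hd')]
  ring

omit [Finite E] in
theorem card_eq_fix_sq : Nat.card E = Nat.card {x : E // σ x = x} ^ 2 := by
  obtain ⟨w, hw⟩ := hne
  have hd : w - σ w ≠ 0 := fun h => hw (sub_eq_zero.mp h).symm
  rw [pow_two, ← Nat.card_prod]
  symm
  refine Nat.card_congr (Equiv.ofBijective (fun p => p.1.1 + p.2.1 * w) ⟨?_, ?_⟩)
  · rintro ⟨⟨a, ha⟩, ⟨b, hb⟩⟩ ⟨⟨c, hc⟩, ⟨d, hd'⟩⟩ h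
    simp only at h
    have h2 := congrArg σ h
    simp only [map_add, map_mul, ha, hb, hc, hd'] at h2
    have h3 : (b - d) * (w - σ w) = 0 := by linear_combination h - h2
    have h4 : b = d := by
      rcases mul_eq_zero.mp h3 with h | h
      · exact sub_eq_zero.mp h
      · exact absurd h hd
    subst h4
    have h5 : a = c := by linear_combination h
    subst h5; rfl
  · intro x
    have hs : σ (w - σ w) = -(w - σ w) := by rw [map_sub, hσ]; ring
    refine ⟨(⟨x - (x - σ x) / (w - σ w) * w, ?_⟩, ⟨(x - σ x) / (w - σ w), ?_⟩), ?_⟩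
    · rw [map_sub, map_mul, map_div₀, hs, map_sub, hσ]
      have : σ x - x = -(x - σ x) := by ring
      rw [this, neg_div_neg_eq]
      field_simp
      ring
    · rw [map_div₀, hs, map_sub, hσ]
      have : σ x - x = -(x - σ x) := by ring
      rw [this, neg_div_neg_eq]
    · simp

theorem card_norm_fiber {c : E} (hc : σ c = c) (hc0 : c ≠ 0) :
    Nat.card {x : E // σ x * x = c} = Nat.card {x : E // σ x = x} + 1 := by
  classical
  have := Fintype.ofFinite E
  set Q := Nat.card {x : E // σ x = x} with hQ
  have hE := card_eq_fix_sq hσ hne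
  let s : Eˣ →* Eˣ := Units.map σ.toMonoidHom
  let N : Eˣ →* Eˣ := s * MonoidHom.id _
  let g : Eˣ →* Eˣ := MonoidHom.id _ / s
  have hNa : ∀ x : Eˣ, ((N x : Eˣ) : E) = σ x * x := fun x => rfl
  have hga : ∀ x : Eˣ, g x = x / s x := fun x => rfl
  have hsa : ∀ x : Eˣ, ((s x : Eˣ) : E) = σ x := fun x => rfl
  have hfixE : ∀ P : E → Prop, True := fun _ => trivial
  have hQ1 : 0 < Q := by
    rw [hQ]; have : Nonempty {x : E // σ x = x} := ⟨⟨0, map_zero _⟩⟩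
    exact Nat.card_pos
  -- units fixed by σ
  have hfixu : Nat.card {x : Eˣ // s x = x} + 1 = Q := by
    have e : Option {x : Eˣ // s x = x} ≃ {x : E // σ x = x} :=
      { toFun := fun o => match o with
          | none => ⟨0, map_zero _⟩
          | some x => ⟨x.1, by rw [← hsa, x.2]⟩
        invFun := fun x => if h : x.1 = 0 then none else
          some ⟨Units.mk0 x.1 h, Units.ext (by rw [hsa]; simpa using x.2)⟩
        left_inv := by
          rintro (_ | x)
          · simp
          · simp
        right_inv := by
          rintro ⟨x, hx⟩
          by_cases h : x = 0
          · simp [h]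
          · simp [h] }
    rw [hQ, ← Nat.card_congr e, Finite.card_option]
  have hkerg : Nat.card g.ker + 1 = Q := by
    rw [← hfixu]; congr 1
    refine Nat.card_congr (Equiv.subtypeEquivRight ?_)
    intro x
    rw [MonoidHom.mem_ker, hga, div_eq_one]
    exact eq_comm
  have hrg : g.range = N.ker := by
    ext x
    rw [MonoidHom.mem_ker]
    constructor
    · rintro ⟨y, rfl⟩
      apply Units.ext
      rw [hNa, hga]
      simp only [Units.val_div_eq_div_val, hsa, map_div₀, hσ, Units.val_one]
      have : (y : E) ≠ 0 := y.ne_zero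
      have : σ (y : E) ≠ 0 := (map_ne_zero σ).mpr this
      field_simp
    · intro hx
      have hx' : σ x * (x : E) = 1 := by rw [← hNa, hx]; rfl
      have key : ∃ θ : E, θ + x * σ θ ≠ 0 := by
        by_cases h : (1 : E) + x = 0
        · obtain ⟨w, hw⟩ := hne
          refine ⟨w, fun h' => hw ?_⟩
          have : (x : E) = -1 := by linear_combination h
          rw [this] at h'
          linear_combination -h'
        · exact ⟨1, by simpa using h⟩
      obtain ⟨θ, hθ⟩ := key
      refine ⟨Units.mk0 _ hθ, ?_⟩
      rw [hga, div_eq_iff_eq_mul]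
      apply Units.ext
      simp only [Units.val_mk0, Units.val_mul, hsa, map_add, map_mul, hσ]
      linear_combination (-θ) * hx'
  have hEu : Nat.card Eˣ + 1 = Q ^ 2 := by
    rw [← hE, Nat.card_units]
    have : 0 < Nat.card E := Nat.card_pos
    omega
  have h1 : Nat.card g.ker * Nat.card g.range = Nat.card Eˣ := by
    rw [← Subgroup.index_ker, Subgroup.card_mul_index]
  have h2 : Nat.card N.ker * Nat.card N.range = Nat.card Eˣ := by
    rw [← Subgroup.index_ker, Subgroup.card_mul_index]
  rw [hrg] at h1
  have hkp : 0 < Nat.card g.ker := Nat.card_pos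
  have hk : Nat.card N.ker = Q + 1 := by
    have : Nat.card g.ker * Nat.card N.ker = Nat.card g.ker * (Q + 1) := by
      rw [h1]
      have : Nat.card g.ker * (Q + 1) + 1 = Q ^ 2 := by
        rw [← hkerg]; ring
      omega
    exact Nat.eq_of_mul_eq_mul_left hkp this
  have hr : Nat.card N.range + 1 = Q := by
    rw [← hkerg]; congr 1
    rw [hk] at h2
    rw [hk] at h1
    have : (Q+1) * Nat.card N.range = (Q+1) * Nat.card g.ker := by rw [h2, ← h1, mul_comm]
    exact Nat.eq_of_mul_eq_mul_left (by omega) this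
  -- c is a norm
  have hsub : (N.range : Set Eˣ) = {x : Eˣ | s x = x} := by
    apply Set.eq_of_subset_of_ncard_le
    · rintro _ ⟨y, rfl⟩
      apply Units.ext
      rw [hsa, hNa, map_mul, hσ, mul_comm]
    · have a1 : ({x : Eˣ | s x = x} : Set Eˣ).ncard = Nat.card {x : Eˣ // s x = x} := rfl
      have a2 : (N.range : Set Eˣ).ncard = Nat.card N.range := rfl
      omega
    · exact Set.toFinite _
  have hcm : Units.mk0 c hc0 ∈ (N.range : Set Eˣ) := by
    rw [hsub]; apply Units.ext; rw [hsa]; simpa using hc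
  obtain ⟨y, hy⟩ := hcm
  have hy' : σ y * (y : E) = c := by rw [← hNa, hy]; rfl
  rw [← hk]
  refine (Nat.card_congr (Equiv.ofBijective (fun x : N.ker => (⟨(x.1 * y : Eˣ), ?_⟩ :
    {x : E // σ x * x = c})) ⟨?_, ?_⟩)).symm
  · have : σ (x.1 : E) * ((x.1 : Eˣ) : E) = 1 := by
      rw [← hNa, (MonoidHom.mem_ker).mp x.2]; rfl
    rw [Units.val_mul, map_mul, ← hy']
    linear_combination (σ y * (y : E)) * this
  · intro a b h
    have : ((a.1 * y : Eˣ) : E) = ((b.1 * y : Eˣ) : E) := congrArg Subtype.val h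
    exact Subtype.ext (mul_right_cancel (Units.ext this))
  · rintro ⟨x, hx⟩
    have hx0 : x ≠ 0 := by rintro rfl; simp at hx; exact hc0 hx.symm
    refine ⟨⟨Units.mk0 x hx0 / y, ?_⟩, ?_⟩
    · rw [MonoidHom.mem_ker, map_div, hy, div_eq_one]
      apply Units.ext
      rw [hNa]; simpa using hx
    · apply Subtype.ext; simp

theorem card_norm_fiber' {c : E} (hc : σ c = c) [Decidable (c = 0)] :
    (Nat.card {x : E // σ x * x = c} : ℤ) =
      Nat.card {x : E // σ x = x} + 1 - (Nat.card {x : E // σ x = x} : ℤ) * (if c = 0 then 1 else 0) := by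
  by_cases h : c = 0
  · subst h
    simp only [if_true]
    have : Nat.card {x : E // σ x * x = 0} = 1 := by
      rw [Nat.card_eq_one_iff_unique]
      refine ⟨⟨?_⟩, ⟨⟨0, by simp⟩⟩⟩
      rintro ⟨a, ha⟩ ⟨b, hb⟩
      simp only [mul_eq_zero, map_eq_zero, or_self] at ha hb
      simp [ha, hb]
    rw [this]; push_cast; ring
  · simp only [h, if_false]
    rw [card_norm_fiber hσ hne hc h]; push_cast; ring

theorem exists_norm {c : E} (hc : σ c = c) (hc0 : c ≠ 0) : ∃ x : E, σ x * x = c := by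
  have := card_norm_fiber hσ hne hc hc0
  have h : 0 < Nat.card {x : E // σ x * x = c} := by omega
  obtain ⟨⟨x, hx⟩⟩ := (Nat.card_pos_iff.mp h).1
  exact ⟨x, hx⟩

theorem card_sphere (m : ℕ) : ∀ {c : E} (_ : σ c = c) [Decidable (c = 0)],
    (Nat.card {x : E // σ x = x} : ℤ) * Nat.card {v : Fin m → E // ∑ i, σ (v i) * v i = c} =
      (Nat.card {x : E // σ x = x} : ℤ) ^ (2 * m) + (-1) ^ m *
      (Nat.card {x : E // σ x = x} : ℤ) ^ m *
      ((Nat.card {x : E // σ x = x} : ℤ) * (if c = 0 then 1 else 0) - 1) := by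
  classical
  have := Fintype.ofFinite E
  set Q : ℤ := (Nat.card {x : E // σ x = x} : ℤ) with hQ
  induction m with
  | zero =>
    intro c hc _
    by_cases h : c = 0
    · subst h; simp
    · have : IsEmpty {v : Fin 0 → E // ∑ i, σ (v i) * v i = c} := ⟨fun v => h (by simpa using v.2.symm)⟩
      rw [Nat.card_of_isEmpty]; simp [h]
  | succ m ih =>
    intro c hc _
    let F : {v : Fin (m+1) → E // ∑ i, σ (v i) * v i = c} → E := fun v => v.1 0
    have hF : ∀ b : E, Nat.card {a // F a = b} =
        Nat.card {v : Fin m → E // ∑ i, σ (v i) * v i = c - σ b * b} := by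
      intro b
      refine Nat.card_congr
        { toFun := fun v => ⟨Fin.tail v.1.1, ?_⟩
          invFun := fun v => ⟨⟨Fin.cons b v.1, ?_⟩, ?_⟩
          left_inv := ?_
          right_inv := ?_ }
      · have h1 := v.1.2
        have h2 : v.1.1 0 = b := v.2
        rw [Fin.sum_univ_succ, h2] at h1
        exact eq_sub_iff_add_eq'.mpr h1
      · rw [Fin.sum_univ_succ]; simp [v.2]
      · rfl
      · rintro ⟨⟨v, hv⟩, hb⟩
        have h2 : v 0 = b := hb
        subst h2
        simp
      · rintro ⟨v, hv⟩; simp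
    rw [card_sum_fibers F, Finset.sum_congr rfl (fun b _ => hF b)]
    push_cast
    rw [Finset.mul_sum, Finset.sum_congr rfl (fun b _ => ih (c := c - σ b * b)
      (by rw [map_sub, hc, map_mul, hσ, mul_comm]))]
    rw [Finset.sum_add_distrib, ← Finset.mul_sum, Finset.sum_sub_distrib, ← Finset.mul_sum]
    have e1 : ∑ b : E, (if c - σ b * b = 0 then (1:ℤ) else 0) =
        Q + 1 - Q * (if c = 0 then 1 else 0) := by
      rw [hQ, ← card_norm_fiber' hσ hne hc, Finset.sum_boole, Nat.card_eq_fintype_card,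
        Fintype.card_subtype]
      congr 2
      ext b
      simp only [Finset.mem_filter, Finset.mem_univ, true_and]
      rw [sub_eq_zero, eq_comm]
    have e2 : (Fintype.card E : ℤ) = Q ^ 2 := by
      rw [← Nat.card_eq_fintype_card, card_eq_fix_sq hσ hne]; simp [hQ]
    rw [e1]
    simp only [Finset.sum_const, Finset.card_univ, nsmul_eq_mul, e2]
    by_cases h : c = 0
    · simp only [h, if_true]; ring
    · simp only [h, if_false]; ring

end field
end FFU


namespace FFU

/-- conjugate transpose relative to a ring hom -/
def ct {R : Type*} [Semiring R] (σ : R →+* R) {m n : Type*} (X : Matrix m n R) : Matrix n m R :=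
  (X.map σ)ᵀ

section ct
variable {R : Type*} [CommRing R] {σ : R →+* R} {l m n : Type*}

theorem ct_apply (X : Matrix m n R) (i j) : ct σ X i j = σ (X j i) := rfl

theorem ct_mul [Fintype m] (X : Matrix l m R) (Y : Matrix m n R) :
    ct σ (X * Y) = ct σ Y * ct σ X := by
  unfold ct; rw [Matrix.map_mul, transpose_mul]

theorem ct_add (X Y : Matrix m n R) : ct σ (X + Y) = ct σ X + ct σ Y := by
  ext i j; simp [ct]

theorem ct_neg (X : Matrix m n R) : ct σ (-X) = -ct σ X := by
  ext i j; simp [ct]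

theorem ct_smul (c : R) (X : Matrix m n R) : ct σ (c • X) = σ c • ct σ X := by
  ext i j; simp [ct]

theorem ct_one [DecidableEq n] : ct σ (1 : Matrix n n R) = 1 := by
  unfold ct; rw [Matrix.map_one _ (map_zero _) (map_one _), transpose_one]

theorem ct_ct (hσ : ∀ x, σ (σ x) = x) (X : Matrix m n R) : ct σ (ct σ X) = X := by
  ext i j; simp [ct, hσ]

theorem ct_zero : ct σ (0 : Matrix m n R) = 0 := by
  ext i j; simp [ct]

theorem ct_isUnit [Fintype n] [DecidableEq n] {X : Matrix n n R} (h : IsUnit X) :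
    IsUnit (ct σ X) := by
  obtain ⟨u, rfl⟩ := h
  exact ⟨⟨ct σ u.1, ct σ u.2, by rw [← ct_mul, u.4, ct_one], by rw [← ct_mul, u.3, ct_one]⟩, rfl⟩

theorem ct_fromBlocks {l m n o : Type*} (A : Matrix n l R) (B : Matrix n m R) (C : Matrix o l R)
    (D : Matrix o m R) : ct σ (fromBlocks A B C D) = fromBlocks (ct σ A) (ct σ C) (ct σ B) (ct σ D) := by
  unfold ct; rw [fromBlocks_map, fromBlocks_transpose]

theorem ct_reindex {m' n' : Type*} (e : m ≃ m') (f : n ≃ n') (X : Matrix m n R) :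
    ct σ (reindex e f X) = reindex f e (ct σ X) := rfl

end ct

/-- invertible Hermitian matrices -/
abbrev HU {R : Type*} [CommRing R] (σ : R →+* R) (n : Type*) [Fintype n] [DecidableEq n] : Type _ :=
  {h : Matrix n n R // ct σ h = h ∧ IsUnit h}

/-- Hermitian matrices -/
abbrev HM {R : Type*} [CommRing R] (σ : R →+* R) (n : Type*) : Type _ :=
  {h : Matrix n n R // ct σ h = h}

theorem card_HU_congr {R : Type*} [CommRing R] (σ : R →+* R) {n n' : Type*} [Fintype n]
    [DecidableEq n] [Fintype n'] [DecidableEq n'] (e : n ≃ n') :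
    Nat.card (HU σ n) = Nat.card (HU σ n') := by
  refine Nat.card_congr (Equiv.subtypeEquiv (reindexRingEquiv R e).toEquiv ?_)
  intro h
  have h1 : ct σ ((reindexRingEquiv R e) h) = (reindexRingEquiv R e) (ct σ h) := rfl
  have h2 : IsUnit ((reindexRingEquiv R e) h) ↔ IsUnit h := by
    constructor
    · intro H
      have := H.map (reindexRingEquiv R e).symm
      rwa [RingEquiv.symm_apply_apply] at this
    · intro H; exact H.map _
  show _ ↔ ct σ ((reindexRingEquiv R e) h) = _ ∧ IsUnit ((reindexRingEquiv R e) h)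
  rw [h1, h2]
  exact and_congr_left' (by
    constructor
    · intro H; rw [H]; rfl
    · intro H; exact (reindexRingEquiv R e).injective H)

/-- polarization -/
theorem aniso {E V : Type*} [Field E] [AddCommGroup V] [Module E V] {σ : E →+* E}
    (hne : ∃ x, σ x ≠ x) (B : V → V → E) (hadd : ∀ x y z, B x (y + z) = B x y + B x z)
    (hsmul : ∀ c x y, B x (c • y) = c * B x y) (hherm : ∀ x y, B y x = σ (B x y))
    (h0 : ∀ x, B x x = 0) (x y : V) : B x y = 0 := by
  have key : ∀ x y, σ (B x y) = - B x y := by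
    intro x y
    have h1 := h0 (x + y)
    rw [hadd, hherm x (x+y), hherm y (x+y), hadd, hadd] at h1
    simp only [map_add, h0, map_zero, zero_add, add_zero, ← hherm] at h1
    have h2 := hherm y x
    rw [← h2] at *
    rw [← hherm x y]; linear_combination h1
  obtain ⟨t, ht⟩ := hne
  have h1 := key x (t • y)
  rw [hsmul, map_mul, key] at h1
  have h2 : (t - σ t) * B x y = 0 := by linear_combination h1
  rcases mul_eq_zero.mp h2 with h | h
  · exact absurd (sub_eq_zero.mp h).symm ht
  · exact h

theorem exists_col {E : Type*} [Field E] {n : Type*} [Fintype n] [DecidableEq n] (i0 : n)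
    {v : n → E} (hv : v ≠ 0) : ∃ g : Matrix n n E, IsUnit g ∧ g *ᵥ (Pi.single i0 1) = v := by
  obtain ⟨i, hi⟩ := Function.ne_iff.mp hv
  refine ⟨(((1 : Matrix n n E).updateCol i v)).submatrix id (Equiv.swap i i0), ?_, ?_⟩
  · rw [Matrix.isUnit_iff_isUnit_det, Matrix.det_permute', ← cramer_apply, cramer_one]
    simp only [Module.End.one_apply]
    refine IsUnit.mul ?_ (isUnit_iff_ne_zero.mpr hi)
    rcases Int.units_eq_one_or (Equiv.Perm.sign (Equiv.swap i i0)) with h | h <;> simp [h]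
  · ext j
    simp

section herm
variable {E : Type*} [Field E] [Finite E] {σ : E →+* E} (hσ : ∀ x, σ (σ x) = x)
  (hne : ∃ x, σ x ≠ x)

theorem quad_eq {n : Type*} [Fintype n] [DecidableEq n] (g h : Matrix n n E) (v w : n → E) :
    (σ ∘ (g *ᵥ v)) ⬝ᵥ (h *ᵥ (g *ᵥ w)) = (σ ∘ v) ⬝ᵥ ((ct σ g * h * g) *ᵥ w) := by
  rw [← mulVec_mulVec, ← mulVec_mulVec, dotProduct_mulVec (σ ∘ v)]
  congr 1
  ext i
  simp [vecMul, mulVec, dotProduct, ct, map_sum, mul_comm]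

include hσ hne in
theorem exists_unit_vec {n : Type*} [Fintype n] [DecidableEq n] [Nonempty n] {h : Matrix n n E}
    (hh : ct σ h = h) (hu : IsUnit h) : ∃ v : n → E, (σ ∘ v) ⬝ᵥ (h *ᵥ v) = 1 := by
  have hherm : ∀ x y : n → E, (σ ∘ y) ⬝ᵥ (h *ᵥ x) = σ ((σ ∘ x) ⬝ᵥ (h *ᵥ y)) := by
    intro x y
    conv_lhs => rw [← hh]
    simp only [dotProduct, mulVec, map_sum, map_mul, Finset.mul_sum, Function.comp, hσ, ct_apply]
    rw [Finset.sum_comm]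
    refine Finset.sum_congr rfl fun i _ => Finset.sum_congr rfl fun j _ => by ring
  have h1 : ∃ v : n → E, (σ ∘ v) ⬝ᵥ (h *ᵥ v) ≠ 0 := by
    by_contra hcon
    push Not at hcon
    have := aniso hne (fun x y : n → E => (σ ∘ x) ⬝ᵥ (h *ᵥ y))
      (by intro x y z; simp only [mulVec_add, dotProduct_add])
      (by intro c x y; simp only [mulVec_smul, dotProduct_smul, smul_eq_mul]) hherm hcon
    obtain ⟨i0⟩ := ‹Nonempty n›
    have h2 : h = 0 := by
      ext i j
      have := this (Pi.single i 1) (Pi.single j 1)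
      have e : (σ ∘ (Pi.single i 1 : n → E)) = Pi.single i 1 := by
        ext k; by_cases hk : k = i <;> simp [Pi.single_apply, hk]
      simpa [e] using this
    rw [h2] at hu
    have : Nontrivial (Matrix n n E) := inferInstance
    exact not_isUnit_zero hu
  obtain ⟨v, hv⟩ := h1
  set c := (σ ∘ v) ⬝ᵥ (h *ᵥ v) with hc
  have hcf : σ c = c := (hherm v v).symm
  obtain ⟨x, hx⟩ := exists_norm hσ hne (c := c⁻¹) (by rw [map_inv₀, hcf]) (inv_ne_zero hv)
  refine ⟨x • v, ?_⟩
  have e : (σ ∘ (x • v)) = σ x • (σ ∘ v) := by ext i; simp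
  rw [e, mulVec_smul, smul_dotProduct, dotProduct_smul, ← hc, smul_eq_mul, smul_eq_mul, ← mul_assoc, hx,
    inv_mul_cancel₀ hv]

theorem single_quad {n : Type*} [Fintype n] [DecidableEq n] (h : Matrix n n E) (i : n) :
    (σ ∘ (Pi.single i 1 : n → E)) ⬝ᵥ (h *ᵥ (Pi.single i 1)) = h i i := by
  have e : (σ ∘ (Pi.single i 1 : n → E)) = Pi.single i 1 := by
    ext k; by_cases hk : k = i <;> simp [Pi.single_apply, hk]
  simp [e]

/-- Schur complement form -/
theorem schur_form {n : Type*} [Fintype n] [DecidableEq n] {h : Matrix (Unit ⊕ n) (Unit ⊕ n) E}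
    (hh : ct σ h = h) (h1 : h (Sum.inl ()) (Sum.inl ()) = 1) :
    h = fromBlocks 1 (ct σ h.toBlocks₂₁) h.toBlocks₂₁ h.toBlocks₂₂ := by
  conv_lhs => rw [← fromBlocks_toBlocks h]
  congr 1
  · ext i j; simp [toBlocks₁₁, h1]
  · ext i j
    rw [ct_apply]
    conv_lhs => rw [← hh]
    rfl

theorem schur_unit {n : Type*} [Fintype n] [DecidableEq n] (C : Matrix n Unit E) (D : Matrix n n E) :
    IsUnit (fromBlocks 1 (ct σ C) C D) ↔ IsUnit (D - C * ct σ C) := by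
  letI : Invertible (1 : Matrix Unit Unit E) := invertibleOne
  rw [Matrix.isUnit_fromBlocks_iff_of_invertible₁₁]
  simp

include hσ in
theorem card_HU_one (n : Type*) [Fintype n] [DecidableEq n] :
    Nat.card {h : HU σ (Unit ⊕ n) // h.1 (Sum.inl ()) (Sum.inl ()) = 1} =
      Nat.card E ^ (Fintype.card n) * Nat.card (HU σ n) := by
  have e0 : Nat.card (Matrix n Unit E) = Nat.card E ^ (Fintype.card n) := by
    rw [show Matrix n Unit E = (n → Unit → E) from rfl, Nat.card_fun, Nat.card_fun]
    simp
  rw [← e0, ← Nat.card_prod]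
  have hCC : ∀ C : Matrix n Unit E, ct σ (C * ct σ C) = C * ct σ C := by
    intro C; rw [ct_mul, ct_ct hσ]
  refine Nat.card_congr
    { toFun := fun h => (h.1.1.toBlocks₂₁, ⟨h.1.1.toBlocks₂₂ - h.1.1.toBlocks₂₁ * ct σ h.1.1.toBlocks₂₁, ?_, ?_⟩)
      invFun := fun p => ⟨⟨fromBlocks 1 (ct σ p.1) p.1 (p.2.1 + p.1 * ct σ p.1), ?_, ?_⟩, ?_⟩
      left_inv := ?_
      right_inv := ?_ }
  · have := schur_form h.1.2.1 h.2
    rw [sub_eq_add_neg, ct_add, ct_neg, hCC]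
    congr 1
    have h2 := h.1.2.1
    conv_lhs at h2 => rw [this]
    rw [ct_fromBlocks] at h2
    have := congrArg toBlocks₂₂ h2
    simpa using this
  · have := schur_form h.1.2.1 h.2
    have h2 := h.1.2.2
    rw [this, schur_unit] at h2
    exact h2
  · rw [ct_fromBlocks, ct_one, ct_ct hσ, ct_add, hCC, p.2.2.1]
  · rw [schur_unit, add_sub_cancel_right]; exact p.2.2.2
  · rfl
  · intro h
    apply Subtype.ext; apply Subtype.ext
    simp only [sub_add_cancel]
    exact (schur_form h.1.2.1 h.2).symm
  · intro p
    simp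

include hσ hne in
theorem herm_transitive (n : Type) [Fintype n] [DecidableEq n] (h : Matrix n n E)
    (hh : ct σ h = h) (hu : IsUnit h) :
    ∃ g : Matrix n n E, IsUnit g ∧ h = ct σ g * g := by
  suffices H : ∀ (m : ℕ) (n : Type) [Fintype n] [DecidableEq n] (_ : Fintype.card n = m)
      (h : Matrix n n E) (_ : ct σ h = h) (_ : IsUnit h),
      ∃ g : Matrix n n E, IsUnit g ∧ h = ct σ g * g from H _ n rfl h hh hu
  clear hh hu h
  intro m
  induction m with
  | zero =>
    intro n _ _ hn h _ _
    have : IsEmpty n := Fintype.card_eq_zero_iff.mp hn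
    exact ⟨1, isUnit_one, Subsingleton.elim _ _⟩
  | succ m ih =>
    intro n _ _ hn
    have e : n ≃ Unit ⊕ Fin m := Fintype.equivOfCardEq (by simp [hn, add_comm])
    suffices H : ∀ (h : Matrix (Unit ⊕ Fin m) (Unit ⊕ Fin m) E) (_ : ct σ h = h) (_ : IsUnit h),
      ∃ g : Matrix (Unit ⊕ Fin m) (Unit ⊕ Fin m) E, IsUnit g ∧ h = ct σ g * g by
      intro h hh hu
      obtain ⟨g, hg, hg2⟩ := H (reindexRingEquiv E e h) (by
        show reindexRingEquiv E e (ct σ h) = _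
        rw [hh]) (hu.map _)
      refine ⟨(reindexRingEquiv E e).symm g, hg.map _, ?_⟩
      apply (reindexRingEquiv E e).injective
      rw [hg2, map_mul, RingEquiv.apply_symm_apply]
      congr 1
      have : reindexRingEquiv E e (ct σ ((reindexRingEquiv E e).symm g)) =
        ct σ (reindexRingEquiv E e ((reindexRingEquiv E e).symm g)) := rfl
      rw [this, RingEquiv.apply_symm_apply]
    intro h hh hu
    obtain ⟨v, hv⟩ := exists_unit_vec hσ hne hh hu
    have hv0 : v ≠ 0 := by rintro rfl; simp at hv
    obtain ⟨g1, hg1, hgv⟩ := exists_col (Sum.inl ()) hv0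
    set h1 := ct σ g1 * h * g1 with hh1
    have hh1h : ct σ h1 = h1 := by
      rw [hh1, ct_mul, ct_mul, hh, ct_ct hσ, mul_assoc]
    have hh1u : IsUnit h1 := ((ct_isUnit hg1).mul hu).mul hg1
    have h11 : h1 (Sum.inl ()) (Sum.inl ()) = 1 := by
      rw [← single_quad (σ := σ) h1, hh1, ← quad_eq, hgv, hv]
    have hs := schur_form hh1h h11
    set C := h1.toBlocks₂₁
    set D := h1.toBlocks₂₂
    have hDu : IsUnit (D - C * ct σ C) := by
      rw [hs, schur_unit] at hh1u; exact hh1u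
    have hDh : ct σ (D - C * ct σ C) = D - C * ct σ C := by
      have h2 := hh1h
      conv_lhs at h2 => rw [hs]
      rw [ct_fromBlocks] at h2
      have := congrArg toBlocks₂₂ h2
      rw [sub_eq_add_neg, ct_add, ct_neg, ct_mul, ct_ct hσ]
      congr 1
    obtain ⟨g', hg', hg'2⟩ := ih (Fin m) (by simp) _ hDh hDu
    have hL : IsUnit (fromBlocks (1 : Matrix Unit Unit E) (ct σ C) 0 g') := by
      rw [Matrix.isUnit_fromBlocks_zero₂₁]
      exact ⟨isUnit_one, hg'⟩
    have hfin : h1 = ct σ (fromBlocks (1 : Matrix Unit Unit E) (ct σ C) 0 g') *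
        fromBlocks (1 : Matrix Unit Unit E) (ct σ C) 0 g' := by
      rw [ct_fromBlocks, fromBlocks_multiply, ct_one, ct_ct hσ, ct_zero, ← hg'2]
      simp only [Matrix.mul_zero, Matrix.mul_one, Matrix.one_mul, Matrix.zero_mul, add_zero, add_sub_cancel]
      exact hs
    obtain ⟨u, hu1⟩ := hg1
    have hui : ct σ ((u⁻¹ : (Matrix (Unit ⊕ Fin m) (Unit ⊕ Fin m) E)ˣ) : Matrix (Unit ⊕ Fin m) (Unit ⊕ Fin m) E) * ct σ u.1 = 1 := by
      rw [← ct_mul, Units.mul_inv, ct_one]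
    refine ⟨fromBlocks (1 : Matrix Unit Unit E) (ct σ C) 0 g' * (u⁻¹ : _ˣ), hL.mul (Units.isUnit _), ?_⟩
    rw [ct_mul]
    calc h = (ct σ ((u⁻¹ : (Matrix (Unit ⊕ Fin m) (Unit ⊕ Fin m) E)ˣ) : Matrix (Unit ⊕ Fin m) (Unit ⊕ Fin m) E) * ct σ u.1) * h *
        (u.1 * (u⁻¹ : (Matrix (Unit ⊕ Fin m) (Unit ⊕ Fin m) E)ˣ)) := by
          rw [hui, Units.mul_inv, one_mul, mul_one]
      _ = ct σ ((u⁻¹ : (Matrix (Unit ⊕ Fin m) (Unit ⊕ Fin m) E)ˣ) : Matrix (Unit ⊕ Fin m) (Unit ⊕ Fin m) E) * h1 *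
        (u⁻¹ : (Matrix (Unit ⊕ Fin m) (Unit ⊕ Fin m) E)ˣ) := by
          rw [hh1, hu1]; noncomm_ring
      _ = _ := by rw [hfin]; noncomm_ring

end herm
end FFU


namespace FFU
section
variable {E : Type*} [Field E] [Finite E] {σ : E →+* E} (hσ : ∀ x, σ (σ x) = x)
  (hne : ∃ x, σ x ≠ x)

theorem card_swap {α β : Type*} [Finite α] [Finite β] (P : α → β → Prop) (a b : ℕ)
    (ha : ∀ x, Nat.card {y // P x y} = a) (T : β → Prop) (hT : ∀ x y, P x y → T y)
    (hb : ∀ y, T y → Nat.card {x // P x y} = b) :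
    Nat.card α * a = Nat.card {y // T y} * b := by
  classical
  let S := {p : α × β // P p.1 p.2}
  have h1 : Nat.card S = Nat.card α * a := by
    refine card_fibers (fun s : S => s.1.1) a ?_
    intro x
    rw [← ha x]
    exact Nat.card_congr
      { toFun := fun s => ⟨s.1.1.2, by have := s.1.2; have h2 := s.2; rwa [h2] at this⟩
        invFun := fun y => ⟨⟨(x, y.1), y.2⟩, rfl⟩
        left_inv := by rintro ⟨⟨⟨x', y⟩, h⟩, h'⟩; simp only at h'; subst h'; rfl
        right_inv := by intro y; rfl }
  have h2 : Nat.card S = Nat.card {y // T y} * b := by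
    refine card_fibers (fun s : S => (⟨s.1.2, hT _ _ s.2⟩ : {y // T y})) b ?_
    rintro ⟨y, hy⟩
    rw [← hb y hy]
    exact Nat.card_congr
      { toFun := fun s => ⟨s.1.1.1, by
          have := s.1.2; have h2 := congrArg Subtype.val s.2; simp only at h2; rwa [h2] at this⟩
        invFun := fun x => ⟨⟨(x.1, y), x.2⟩, rfl⟩
        left_inv := by
          rintro ⟨⟨⟨x', y'⟩, h⟩, h'⟩
          have h2 := congrArg Subtype.val h'
          simp only at h2; subst h2; rfl
        right_inv := by intro y; rfl }
  rw [← h1, h2]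

include hσ hne in
theorem card_HU_rec (m : ℕ) :
    Nat.card (HU σ (Fin (m+1))) * Nat.card {v : Fin (m+1) → E // ∑ i, σ (v i) * v i = 1} =
      (Nat.card E ^ (m+1) - 1) * (Nat.card E ^ m * Nat.card (HU σ (Fin m))) := by
  classical
  have := Fintype.ofFinite E
  let n := Unit ⊕ Fin m
  have e : Fin (m+1) ≃ n := Fintype.equivOfCardEq (by simp [n, add_comm])
  rw [card_HU_congr σ e]
  have h1 : Nat.card {v : Fin (m+1) → E // ∑ i, σ (v i) * v i = 1} =
      Nat.card {v : n → E // ∑ i, σ (v i) * v i = 1} := by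
    refine Nat.card_congr (Equiv.subtypeEquiv (Equiv.arrowCongr e (Equiv.refl E)) ?_)
    intro v
    have : ∑ i, σ (v i) * v i = ∑ i, σ ((Equiv.arrowCongr e (Equiv.refl E)) v i) *
        ((Equiv.arrowCongr e (Equiv.refl E)) v i) := by
      rw [← Equiv.sum_comp e]; simp
    rw [this]
  rw [h1]
  have h2 : Nat.card {v : n → E // v ≠ 0} = Nat.card E ^ (m+1) - 1 := by
    rw [Nat.card_eq_fintype_card, Fintype.card_subtype_compl, Fintype.card_fun,
      Fintype.card_subtype_eq]
    simp [n, add_comm]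
  rw [← h2]
  refine card_swap (fun (h : HU σ n) (v : n → E) => (σ ∘ v) ⬝ᵥ (h.1 *ᵥ v) = 1) _ _ ?_ (fun v => v ≠ 0) ?_ ?_
  · rintro ⟨h, hh, hu⟩
    obtain ⟨g, hg, rfl⟩ := herm_transitive hσ hne n h hh hu
    obtain ⟨u, rfl⟩ := hg
    refine Nat.card_congr
      { toFun := fun v => ⟨u.1 *ᵥ v.1, ?_⟩
        invFun := fun w => ⟨u.2 *ᵥ w.1, ?_⟩
        left_inv := ?_
        right_inv := ?_ }
    · have := v.2
      simp only at this
      have h3 := quad_eq (σ := σ) u.1 1 v.1 v.1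
      rw [mul_one, this, one_mulVec] at h3
      exact h3
    · have h3 := quad_eq (σ := σ) u.1 1 (u.2 *ᵥ w.1) (u.2 *ᵥ w.1)
      simp only [mulVec_mulVec, u.3, one_mulVec, mul_one] at h3
      simp only [mulVec_mulVec]
      rw [← h3]
      exact w.2
    · intro v; apply Subtype.ext; simp only [mulVec_mulVec, u.4, one_mulVec]
    · intro v; apply Subtype.ext; simp only [mulVec_mulVec, u.3, one_mulVec]
  · rintro x y h rfl
    simp at h
  · intro v hv
    have h5 := card_HU_one (E := E) hσ (Fin m)
    rw [Fintype.card_fin] at h5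
    rw [← h5]
    obtain ⟨g, ⟨u, rfl⟩, hgv⟩ := exists_col (Sum.inl () : n) hv
    have hc1 : ct σ u.2 * ct σ u.1 = 1 := by rw [← ct_mul, u.3, ct_one]
    have hc2 : ct σ u.1 * ct σ u.2 = 1 := by rw [← ct_mul, u.4, ct_one]
    refine Nat.card_congr
      { toFun := fun h => ⟨⟨ct σ u.1 * h.1.1 * u.1, ?_, ?_⟩, ?_⟩
        invFun := fun h => ⟨⟨ct σ u.2 * h.1.1 * u.2, ?_, ?_⟩, ?_⟩
        left_inv := ?_
        right_inv := ?_ }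
    · rw [ct_mul, ct_mul, h.1.2.1, ct_ct hσ, mul_assoc]
    · exact ((ct_isUnit u.isUnit).mul h.1.2.2).mul u.isUnit
    · have := h.2
      have h6 := single_quad (σ := σ) (ct σ u.1 * h.1.1 * u.1) (Sum.inl ())
      rw [← quad_eq, hgv] at h6
      exact h6.symm.trans this
    · rw [ct_mul, ct_mul, h.1.2.1, ct_ct hσ, mul_assoc]
    · exact ((ct_isUnit u⁻¹.isUnit).mul h.1.2.2).mul u⁻¹.isUnit
    · simp only
      have := h.2
      rw [← hgv, quad_eq]
      have h6 := single_quad (σ := σ) h.1.1 (Sum.inl ())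
      refine Eq.trans ?_ (h6.trans this)
      congr 2
      calc ct σ u.1 * (ct σ u.2 * h.1.1 * u.2) * u.1 = (ct σ u.1 * ct σ u.2) * h.1.1 * (u.2 * u.1) := by
            noncomm_ring
        _ = _ := by rw [hc2, u.4, one_mul, mul_one]
    · intro h
      apply Subtype.ext; apply Subtype.ext
      calc ct σ u.2 * (ct σ u.1 * h.1.1 * u.1) * u.2 = (ct σ u.2 * ct σ u.1) * h.1.1 * (u.1 * u.2) := by
            noncomm_ring
        _ = _ := by rw [hc1, u.3, one_mul, mul_one]
    · intro h
      apply Subtype.ext; apply Subtype.ext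
      calc ct σ u.1 * (ct σ u.2 * h.1.1 * u.2) * u.1 = (ct σ u.1 * ct σ u.2) * h.1.1 * (u.2 * u.1) := by
            noncomm_ring
        _ = _ := by rw [hc2, u.4, one_mul, mul_one]

include hσ hne in
theorem fix_card_gt : 1 < Nat.card {x : E // σ x = x} := by
  have : Nontrivial {x : E // σ x = x} := ⟨⟨⟨0, map_zero _⟩, ⟨1, map_one _⟩, by simp⟩⟩
  exact Finite.one_lt_card

include hσ hne in
/-- count of invertible Hermitian matrices -/
theorem card_HU (m : ℕ) {Q : ℝ} (hQ : Q = Nat.card {x : E // σ x = x}) :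
    (Nat.card (HU σ (Fin m)) : ℝ) = Q ^ (m * (m-1) / 2) * ∏ i ∈ Finset.range m, (Q ^ (i+1) + (-1)^(i+1)) := by
  classical
  have hQ1 : 1 < Q := by rw [hQ]; exact_mod_cast fix_card_gt hσ hne
  have hQ0 : 0 < Q := by linarith
  induction m with
  | zero =>
    have : Nat.card (HU σ (Fin 0)) = 1 := by
      rw [Nat.card_eq_one_iff_unique]
      refine ⟨⟨fun a b => Subtype.ext (Subsingleton.elim _ _)⟩, ⟨⟨1, ct_one, isUnit_one⟩⟩⟩
    simp [this]
  | succ m ih =>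
    have h1 := card_HU_rec hσ hne m
    have h2 := card_sphere hσ hne (m+1) (c := 1) (map_one _)
    have hE := card_eq_fix_sq hσ hne
    have hE1 : 1 ≤ Nat.card E ^ (m+1) := Nat.one_le_pow _ _ Nat.card_pos
    have h1' : (Nat.card (HU σ (Fin (m+1))) : ℝ) * Nat.card {v : Fin (m+1) → E // ∑ i, σ (v i) * v i = 1} =
      (Q ^ (2 * (m+1)) - 1) * (Q ^ (2*m) * Nat.card (HU σ (Fin m))) := by
      have := congrArg (fun x : ℕ => (x : ℝ)) h1
      simp only [Nat.cast_mul, Nat.cast_sub hE1] at this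
      rw [this, hE]; push_cast; rw [← hQ]; ring
    have h2' : Q * (Nat.card {v : Fin (m+1) → E // ∑ i, σ (v i) * v i = 1} : ℝ) =
        Q ^ (2 * (m+1)) - (-1)^(m+1) * Q ^ (m+1) := by
      have := congrArg (fun x : ℤ => (x : ℝ)) h2
      simp only [one_ne_zero, if_false] at this
      push_cast at this
      rw [← hQ] at this
      rw [this]; ring
    set N := (Nat.card {v : Fin (m+1) → E // ∑ i, σ (v i) * v i = 1} : ℝ)
    have hd : Q ^ (m+1) - (-1)^(m+1) ≠ 0 := by
      have : 1 < Q ^ (m+1) := one_lt_pow₀ hQ1 (by omega)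
      rcases neg_one_pow_eq_or ℝ (m+1) with h | h <;> rw [h] <;> linarith
    have hN : N * Q = Q ^ (m+1) * (Q ^ (m+1) - (-1)^(m+1)) := by
      rw [mul_comm, h2']; ring
    have hsq : ((-1 : ℝ)^(m+1))^2 = 1 := by rw [← pow_mul, mul_comm, pow_mul]; simp
    have hexp : (m+1) * (m+1-1) / 2 = m * (m-1)/2 + m := by
      rw [← Finset.sum_range_id, ← Finset.sum_range_id, Finset.sum_range_succ]
    rw [hexp, Finset.prod_range_succ]
    have h3 : (Nat.card (HU σ (Fin (m+1))) : ℝ) * (Q ^ (m+1) * (Q ^ (m+1) - (-1)^(m+1))) =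
       ((Q ^ (m+1) - (-1)^(m+1)) * (Q ^ (m+1) + (-1)^(m+1)) * (Q ^ (2*m) * Nat.card (HU σ (Fin m)))) * Q := by
      rw [← hN, ← mul_assoc, h1']
      linear_combination (Q ^ (2*m) * Nat.card (HU σ (Fin m)) * Q) * hsq
    apply mul_right_cancel₀ (mul_ne_zero (pow_ne_zero (m+1) hQ0.ne') hd)
    rw [h3, ih]
    ring

end
end FFU


namespace FFU

theorem card_GL_real (F : Type*) [Field F] [Finite F] (m : ℕ) {c : ℝ} (hc : c = Nat.card F) :
    (Nat.card (GL (Fin m) F) : ℝ) = c ^ (m*m) * ∏ i ∈ Finset.range m, (1 - (1/c)^(i+1)) := by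
  classical
  have := Fintype.ofFinite F
  have hc0 : c ≠ 0 := by rw [hc]; exact_mod_cast Nat.card_pos.ne'
  rw [Matrix.card_GL_field, ← Nat.card_eq_fintype_card]
  rw [← Finset.prod_range (fun i => Nat.card F ^ m - Nat.card F ^ i)]
  have hp : c ^ (m*m) = ∏ _i ∈ Finset.range m, c ^ m := by
    rw [Finset.prod_const, Finset.card_range, pow_mul]
  rw [← Finset.prod_range_reflect, hp, ← Finset.prod_mul_distrib]
  push_cast
  refine Finset.prod_congr rfl ?_
  intro i hi
  have hi := Finset.mem_range.mp hi
  rw [Nat.cast_sub (Nat.pow_le_pow_right Nat.card_pos (by omega))]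
  push_cast
  rw [← hc, mul_sub, mul_one]
  congr 1
  have : c ^ m = c ^ (m - 1 - i) * c ^ (i+1) := by rw [← pow_add]; congr 1; omega
  rw [this, mul_assoc, ← mul_pow, mul_one_div_cancel hc0, one_pow, mul_one]

section
variable {E : Type*} [Field E] [Finite E] {σ : E →+* E} (hσ : ∀ x, σ (σ x) = x)
  (hne : ∃ x, σ x ≠ x)

include hσ hne in
theorem card_HU_real (m : ℕ) {Q : ℝ} (hQ : Q = Nat.card {x : E // σ x = x}) :
    (Nat.card (HU σ (Fin m)) : ℝ) = Q ^ (m * m) * ∏ i ∈ Finset.range m, (1 + (-1/Q)^(i+1)) := by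
  have hQ1 : 1 < Q := by rw [hQ]; exact_mod_cast fix_card_gt hσ hne
  have hQ0 : Q ≠ 0 := by linarith
  rw [card_HU hσ hne m hQ]
  have h1 : m * m = m*(m-1)/2 + ∑ i ∈ Finset.range m, (i+1) := by
    rw [Finset.sum_add_distrib, Finset.sum_range_id]
    simp
    have : 2 * (m*(m-1)/2) = m*(m-1) := Nat.mul_div_cancel' (Nat.even_mul_pred_self m).two_dvd
    cases m with
    | zero => simp
    | succ k =>
      simp only [Nat.add_sub_cancel] at *
      nlinarith
  rw [h1, pow_add, ← Finset.prod_pow_eq_pow_sum, mul_assoc, ← Finset.prod_mul_distrib]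
  congr 1
  refine Finset.prod_congr rfl fun i _ => ?_
  rw [div_pow]
  field_simp

include hσ hne in
theorem card_GL_eq (m : ℕ) {Q : ℝ} (hQ : Q = Nat.card {x : E // σ x = x}) :
    (Nat.card (GL (Fin m) E) : ℝ) = Nat.card (HU σ (Fin m)) *
      (Q ^ (m * (m-1) / 2) * ∏ i ∈ Finset.range m, (Q ^ (i+1) - (-1)^(i+1))) := by
  classical
  have := Fintype.ofFinite E
  have hQ1 : 1 < Q := by rw [hQ]; exact_mod_cast fix_card_gt hσ hne
  have hQ0 : Q ≠ 0 := by linarith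
  have hE := card_eq_fix_sq hσ hne
  rw [card_HU hσ hne m hQ, Matrix.card_GL_field, ← Nat.card_eq_fintype_card]
  rw [← Finset.prod_range (fun i => Nat.card E ^ m - Nat.card E ^ i)]
  have h0 : ∀ a P P' : ℝ, a * P * (a * P') = a ^ 2 * (P * P') := by intros; ring
  rw [h0, ← Finset.prod_mul_distrib]
  rw [← pow_mul, mul_comm (m*(m-1)/2) 2, pow_mul, ← Finset.sum_range_id, ← Finset.prod_pow_eq_pow_sum,
    ← Finset.prod_range_reflect (fun i => (Q ^ (i+1) + (-1)^(i+1)) * (Q ^ (i+1) - (-1)^(i+1))),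
    ← Finset.prod_mul_distrib]
  push_cast
  refine Finset.prod_congr rfl ?_
  intro i hi
  have hi := Finset.mem_range.mp hi
  rw [Nat.cast_sub (Nat.pow_le_pow_right Nat.card_pos (by omega)), hE]
  push_cast
  rw [← hQ]
  have hsq : ((-1 : ℝ)^(m-1-i+1))^2 = 1 := by rw [← pow_mul, mul_comm, pow_mul]; simp
  have : (Q ^ 2) ^ m = (Q^2) ^ i * (Q ^ (m - 1 - i + 1))^2 := by
    rw [← pow_mul, ← pow_mul, ← pow_mul, ← pow_add]; congr 1; omega
  rw [this]
  linear_combination (Q^2)^i * hsq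

/-- number of compatible Hermitian forms -/
noncomputable def Fct (σ : E →+* E) {n : ℕ} (A : Matrix (Fin n) (Fin n) E) : ℕ :=
  Nat.card {h : HM σ (Fin n) // h.1 * A = ct σ A * h.1}

/-- number of compatible nondegenerate Hermitian forms -/
noncomputable def Hct (σ : E →+* E) {n : ℕ} (A : Matrix (Fin n) (Fin n) E) : ℕ :=
  Nat.card {h : HU σ (Fin n) // h.1 * A = ct σ A * h.1}

/-- Hermitian commuting pairs -/
abbrev HP (σ : E →+* E) (n : ℕ) : Type _ :=
  {P : Matrix (Fin n) (Fin n) E × Matrix (Fin n) (Fin n) E //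
    ct σ P.1 = P.1 ∧ ct σ P.2 = P.2 ∧ P.1 * P.2 = P.2 * P.1}

include hσ hne in
theorem card_HP_eq_skew (n : ℕ) :
    Nat.card {P : Matrix (Fin n) (Fin n) E × Matrix (Fin n) (Fin n) E //
      ct σ P.1 = -P.1 ∧ ct σ P.2 = -P.2 ∧ P.1 * P.2 = P.2 * P.1} = Nat.card (HP σ n) := by
  obtain ⟨w, hw⟩ := hne
  have hc0 : w - σ w ≠ 0 := fun h => hw (sub_eq_zero.mp h).symm
  have hc : σ (w - σ w) = -(w - σ w) := by rw [map_sub, hσ]; ring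
  set c := w - σ w
  have hci : σ c⁻¹ = -c⁻¹ := by rw [map_inv₀, hc, inv_neg]
  refine Nat.card_congr
    { toFun := fun P => ⟨(c • P.1.1, c • P.1.2), ?_⟩
      invFun := fun P => ⟨(c⁻¹ • P.1.1, c⁻¹ • P.1.2), ?_⟩
      left_inv := ?_
      right_inv := ?_ }
  · obtain ⟨P, h1, h2, h3⟩ := P
    refine ⟨?_, ?_, ?_⟩
    · simp only [ct_smul, hc, h1, neg_smul, smul_neg, neg_neg]
    · simp only [ct_smul, hc, h2, neg_smul, smul_neg, neg_neg]
    · simp only [smul_mul_smul_comm, h3]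
  · obtain ⟨P, h1, h2, h3⟩ := P
    refine ⟨?_, ?_, ?_⟩
    · simp only [ct_smul, hci, h1, neg_smul]
    · simp only [ct_smul, hci, h2, neg_smul]
    · simp only [smul_mul_smul_comm, h3]
  · intro P; apply Subtype.ext; simp [smul_smul, hc0]
  · intro P; apply Subtype.ext; simp [smul_smul, hc0]

include hσ hne in
theorem HP_mul_HU [Fintype E] (n : ℕ) :
    Nat.card (HU σ (Fin n)) * Nat.card (HP σ n) =
      ∑ A : Matrix (Fin n) (Fin n) E, Hct σ A * Fct σ A := by
  classical
  let S := {p : HU σ (Fin n) × HM σ (Fin n) × Matrix (Fin n) (Fin n) E //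
    p.1.1 * p.2.2 = ct σ p.2.2 * p.1.1 ∧ p.2.1.1 * p.2.2 = ct σ p.2.2 * p.2.1.1}
  have h1 : Nat.card S = Nat.card (HU σ (Fin n)) * Nat.card (HP σ n) := by
    refine card_fibers (fun s : S => s.1.1) _ ?_
    rintro ⟨h, hh, hu⟩
    obtain ⟨g, hg, hgg⟩ := herm_transitive hσ hne _ h hh hu
    obtain ⟨u, rfl⟩ := hg
    have hc1 : ct σ u.2 * ct σ u.1 = 1 := by rw [← ct_mul, u.3, ct_one]
    have hc2 : ct σ u.1 * ct σ u.2 = 1 := by rw [← ct_mul, u.4, ct_one]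
    have k1 := u.3
    have k2 := u.4
    refine Nat.card_congr
      { toFun := fun s => ⟨(u.1 * s.1.1.2.2 * u.2, ct σ u.2 * s.1.1.2.1.1 * u.2), ?_, ?_, ?_⟩
        invFun := fun P => ⟨⟨(⟨h, hh, hu⟩, ⟨ct σ u.1 * P.1.2 * u.1, ?_⟩, u.2 * P.1.1 * u.1), ?_, ?_⟩, rfl⟩
        left_inv := ?_
        right_inv := ?_ }
    · obtain ⟨⟨⟨⟨h', hh', hu'⟩, ⟨k, hk⟩, A⟩, e1, e2⟩, e3⟩ := s
      simp only [Subtype.mk.injEq] at e3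
      subst e3
      simp only at e1 e2 ⊢
      rw [hgg] at e1
      rw [ct_mul, ct_mul]
      calc ct σ u.2 * (ct σ A * ct σ u.1) = ct σ u.2 * (ct σ A * (ct σ u.1 * u.1)) * u.2 := by
            rw [mul_assoc, mul_assoc, mul_assoc, k1, mul_one]
        _ = (ct σ u.2 * ct σ u.1) * (u.1 * A * u.2) := by rw [← e1]; noncomm_ring
        _ = _ := by rw [hc1, one_mul]
    · simp only
      rw [ct_mul, ct_mul, ct_ct hσ, s.1.1.2.1.2, ← mul_assoc]
    · obtain ⟨⟨⟨⟨h', hh', hu'⟩, ⟨k, hk⟩, A⟩, e1, e2⟩, e3⟩ := s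
      simp only [Subtype.mk.injEq] at e3
      subst e3
      simp only at e1 e2 ⊢
      rw [hgg] at e1
      have e4 : u.1 * A * u.2 = ct σ u.2 * (ct σ A * ct σ u.1) := by
        symm
        calc ct σ u.2 * (ct σ A * ct σ u.1) = ct σ u.2 * (ct σ A * (ct σ u.1 * u.1)) * u.2 := by
              rw [mul_assoc, mul_assoc, mul_assoc, k1, mul_one]
          _ = (ct σ u.2 * ct σ u.1) * (u.1 * A * u.2) := by rw [← e1]; noncomm_ring
          _ = _ := by rw [hc1, one_mul]
      calc u.1 * A * u.2 * (ct σ u.2 * k * u.2)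
          = ct σ u.2 * ct σ A * (ct σ u.1 * ct σ u.2) * k * u.2 := by rw [e4]; noncomm_ring
        _ = ct σ u.2 * (ct σ A * k) * u.2 := by rw [hc2, mul_one]; noncomm_ring
        _ = ct σ u.2 * k * (u.2 * u.1) * A * u.2 := by rw [← e2, k2, mul_one]; noncomm_ring
        _ = _ := by noncomm_ring
    · rw [ct_mul, ct_mul, ct_ct hσ, P.2.2.1, mul_assoc]
    · simp only
      rw [ct_mul, ct_mul, P.2.1, hgg]
      calc ct σ u.1 * u.1 * (u.2 * P.1.1 * u.1) = ct σ u.1 * (u.1 * u.2) * P.1.1 * u.1 := by noncomm_ring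
        _ = ct σ u.1 * P.1.1 * u.1 := by rw [k1, mul_one]
        _ = ct σ u.1 * P.1.1 * (ct σ u.2 * ct σ u.1) * u.1 := by rw [hc1, mul_one]
        _ = _ := by noncomm_ring
    · simp only
      rw [ct_mul, ct_mul, P.2.1]
      calc ct σ u.1 * P.1.2 * u.1 * (u.2 * P.1.1 * u.1) = ct σ u.1 * P.1.2 * (u.1 * u.2) * P.1.1 * u.1 := by noncomm_ring
        _ = ct σ u.1 * (P.1.2 * P.1.1) * u.1 := by rw [k1, mul_one]; noncomm_ring
        _ = ct σ u.1 * P.1.1 * (ct σ u.2 * ct σ u.1) * P.1.2 * u.1 := by rw [← P.2.2.2, hc1, mul_one]; noncomm_ring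
        _ = _ := by noncomm_ring
    · rintro ⟨⟨⟨⟨h', hh', hu'⟩, ⟨k, hk⟩, A⟩, e1, e2⟩, e3⟩
      simp only [Subtype.mk.injEq] at e3
      subst e3
      apply Subtype.ext; apply Subtype.ext
      simp only [Subtype.mk.injEq, Prod.mk.injEq, true_and]
      constructor
      · calc ct σ u.1 * (ct σ u.2 * k * u.2) * u.1 = (ct σ u.1 * ct σ u.2) * k * (u.2 * u.1) := by noncomm_ring
          _ = k := by rw [hc2, k2, mul_one, one_mul]
      · calc u.2 * (u.1 * A * u.2) * u.1 = (u.2 * u.1) * A * (u.2 * u.1) := by noncomm_ring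
          _ = A := by rw [k2, mul_one, one_mul]
    · rintro ⟨⟨A, B⟩, h1, h2, h3⟩
      simp only [Subtype.mk.injEq, Prod.mk.injEq]
      constructor
      · calc u.1 * (u.2 * A * u.1) * u.2 = (u.1 * u.2) * A * (u.1 * u.2) := by noncomm_ring
          _ = A := by rw [k1, mul_one, one_mul]
      · calc ct σ u.2 * (ct σ u.1 * B * u.1) * u.2 = (ct σ u.2 * ct σ u.1) * B * (u.1 * u.2) := by noncomm_ring
          _ = B := by rw [hc1, k1, mul_one, one_mul]
  rw [← h1, card_sum_fibers (fun s : S => s.1.2.2)]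
  refine Finset.sum_congr rfl fun A _ => ?_
  rw [Hct, Fct, ← Nat.card_prod]
  exact Nat.card_congr
    { toFun := fun s => (⟨s.1.1.1, by have := s.1.2.1; rw [s.2] at this; exact this⟩,
        ⟨s.1.1.2.1, by have := s.1.2.2; rw [s.2] at this; exact this⟩)
      invFun := fun p => ⟨⟨(p.1.1, p.2.1, A), p.1.2, p.2.2⟩, rfl⟩
      left_inv := by
        rintro ⟨⟨⟨h, k, A'⟩, e1, e2⟩, e3⟩
        simp only at e3; subst e3; rfl
      right_inv := by intro p; rfl }

end
end FFU


namespace FFU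

section dvd
variable {D : Type*} [CommRing D] [IsDomain D]

theorem dvd_key {f g : D} (hf : f ≠ 0) {m n : ℕ} (hm : 1 ≤ m) (hn : 1 ≤ n)
    (h : IsCoprime f g ∨ (f = g ∧ m ≠ n)) {x y : D} (hx : f ^ m ∣ g ^ n * x)
    (hy : g ^ n ∣ f ^ m * y) : f ∣ y * x := by
  rcases h with h | ⟨rfl, hmn⟩
  · have h1 : IsCoprime (f ^ m) (g ^ n) := h.pow
    have h2 := h1.dvd_of_dvd_mul_left hx
    exact Dvd.dvd.mul_left ((dvd_pow_self f (by omega)).trans h2) y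
  · rcases lt_or_gt_of_ne hmn with h | h
    · obtain ⟨d, rfl⟩ := Nat.exists_eq_add_of_lt h
      rw [add_assoc, pow_add] at hy
      have h2 := (mul_dvd_mul_iff_left (pow_ne_zero m hf)).mp hy
      exact Dvd.dvd.mul_right ((dvd_pow_self f (by omega)).trans h2) x
    · obtain ⟨d, rfl⟩ := Nat.exists_eq_add_of_lt h
      rw [add_assoc, pow_add] at hx
      have h2 := (mul_dvd_mul_iff_left (pow_ne_zero n hf)).mp hx
      exact Dvd.dvd.mul_left ((dvd_pow_self f (by omega)).trans h2) y

end dvd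

section phi
variable {D : Type*} [CommRing D] {C : Type*} [Fintype C] [DecidableEq C] {α : C → Type*}
  [∀ c, Fintype (α c)] [∀ c, DecidableEq (α c)]

/-- local factor -/
abbrev OO (F : C → D) (e : C → ℕ) (c : C) : Type _ := D ⧸ Ideal.span {F c ^ e c}

/-- residue ring -/
abbrev KK (F : C → D) (c : C) : Type _ := D ⧸ Ideal.span {F c}

/-- the model module -/
abbrev MM (α : C → Type*) (F : C → D) (e : C → ℕ) : Type _ := (p : Σ c, α c) → OO F e p.1

variable {F : C → D} {e : C → ℕ}

theorem mk_zero_iff (c : C) (x : D) : (Ideal.Quotient.mk _ x : OO F e c) = 0 ↔ F c ^ e c ∣ x := by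
  rw [Ideal.Quotient.eq_zero_iff_mem, Ideal.mem_span_singleton]

theorem mkk_zero_iff (c : C) (x : D) : (Ideal.Quotient.mk _ x : KK F c) = 0 ↔ F c ∣ x := by
  rw [Ideal.Quotient.eq_zero_iff_mem, Ideal.mem_span_singleton]

theorem span_le (he : ∀ c, 1 ≤ e c) (c : C) : Ideal.span {F c ^ e c} ≤ Ideal.span {F c} := by
  rw [Ideal.span_singleton_le_span_singleton]
  exact dvd_pow_self _ (by have := he c; omega)

/-- the reduction map -/
def red (F : C → D) (e : C → ℕ) (he : ∀ c, 1 ≤ e c) (c : C) : OO F e c →+* KK F c :=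
  Ideal.Quotient.factor (span_le he c)

theorem red_mk (he : ∀ c, 1 ≤ e c) (c : C) (x : D) :
    red F e he c (Ideal.Quotient.mk _ x) = Ideal.Quotient.mk _ x := by
  rw [red, Ideal.Quotient.factor_mk]

/-- basis vectors -/
def ee (α : C → Type*) [∀ c, DecidableEq (α c)] (F : C → D) (e : C → ℕ) (p : Σ c, α c) : MM α F e := Pi.single p 1

theorem ee_self (p : Σ c, α c) : ee α F e p p = 1 := by simp [ee]
theorem ee_ne {p p' : Σ c, α c} (h : p' ≠ p) : ee α F e p p' = 0 := by simp [ee, h]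

theorem smul_mk (c : C) (x y : D) : x • (Ideal.Quotient.mk _ y : OO F e c) = Ideal.Quotient.mk _ (x * y) := by
  rw [map_mul]; rfl

theorem expand (v : MM α F e) (y : (Σ c, α c) → D)
    (hy : ∀ p, Ideal.Quotient.mk _ (y p) = v p) : v = ∑ p, y p • ee α F e p := by
  ext p
  rw [Finset.sum_apply, Finset.sum_eq_single p]
  · rw [Pi.smul_apply, ee_self, ← hy, show (1 : OO F e p.1) = Ideal.Quotient.mk _ 1 from rfl, smul_mk, mul_one]
  · intro b _ hb; rw [Pi.smul_apply, ee_ne hb.symm, smul_zero]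
  · simp

theorem expand_apply (X : Module.End D (MM α F e)) (v : MM α F e) (y : (Σ c, α c) → D)
    (hy : ∀ p, Ideal.Quotient.mk _ (y p) = v p) (p' : Σ c, α c) :
    X v p' = ∑ p, y p • X (ee α F e p) p' := by
  conv_lhs => rw [expand v y hy]
  rw [map_sum, Finset.sum_apply]
  exact Finset.sum_congr rfl fun p _ => by rw [map_smul]; rfl

theorem ann_ee (p : Σ c, α c) : (F p.1 ^ e p.1) • ee α F e p = 0 := by
  ext p'
  by_cases h : p' = p
  · subst h
    rw [Pi.smul_apply, ee_self, show (1 : OO F e p'.1) = Ideal.Quotient.mk _ 1 from rfl, smul_mk, mul_one]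
    exact (mk_zero_iff _ _).mpr dvd_rfl
  · rw [Pi.smul_apply, ee_ne h, smul_zero]; rfl

theorem ann_apply (X : Module.End D (MM α F e)) (p p' : Σ c, α c) (x : D)
    (hx : Ideal.Quotient.mk _ x = X (ee α F e p) p') : F p'.1 ^ e p'.1 ∣ F p.1 ^ e p.1 * x := by
  rw [← mk_zero_iff, ← smul_mk, hx]
  have := congrFun (congrArg X (ann_ee (α := α) (F := F) (e := e) p)) p'
  rw [map_smul, map_zero] at this
  exact this

variable [IsDomain D] (hF : ∀ c, F c ≠ 0) (he : ∀ c, 1 ≤ e c)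
  (hFe : ∀ c c', c ≠ c' → IsCoprime (F c) (F c') ∨ (F c = F c' ∧ e c ≠ e c'))

def phi0 (he : ∀ c, 1 ≤ e c) (X : Module.End D (MM α F e)) : ∀ c, Matrix (α c) (α c) (KK F c) :=
  fun c => Matrix.of fun a b => red F e he c (X (ee α F e ⟨c, b⟩) ⟨c, a⟩)

theorem phi0_one : phi0 (α := α) (F := F) he 1 = 1 := by
  ext c a b
  simp only [phi0, Matrix.of_apply, Module.End.one_apply]
  by_cases h : a = b
  · subst h; rw [ee_self]; simp
  · rw [ee_ne (by simpa using h)]; simp [h]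

include hF hFe in
theorem phi0_mul (X Y : Module.End D (MM α F e)) :
    phi0 (α := α) (F := F) he (X * Y) = phi0 he X * phi0 he Y := by
  classical
  ext c a b
  choose x hx using fun p : Σ c, α c => Ideal.Quotient.mk_surjective (X (ee α F e p) ⟨c, a⟩)
  choose y hy using fun p : Σ c, α c => Ideal.Quotient.mk_surjective (Y (ee α F e ⟨c, b⟩) p)
  simp only [phi0, Matrix.of_apply, Pi.mul_apply, Matrix.mul_apply, Module.End.mul_apply]
  rw [expand_apply X _ y hy, Fintype.sum_sigma, map_sum, Finset.sum_eq_single c, map_sum]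
  · refine Finset.sum_congr rfl fun b' _ => ?_
    rw [← hx, ← hy, smul_mk, red_mk, red_mk, red_mk, map_mul, mul_comm]
  · intro c' _ hc'
    rw [map_sum]
    refine Finset.sum_eq_zero fun b' _ => ?_
    rw [← hx, smul_mk, red_mk, mkk_zero_iff]
    exact dvd_key (hF c) (he c) (he c') (hFe c c' hc'.symm)
      (ann_apply X ⟨c', b'⟩ ⟨c, a⟩ _ (hx _)) (ann_apply Y ⟨c, b⟩ ⟨c', b'⟩ _ (hy _))
  · simp

/-- the reduction map as a ring homomorphism -/
def phi : Module.End D (MM α F e) →+* (∀ c, Matrix (α c) (α c) (KK F c)) where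
  toFun := phi0 he
  map_one' := phi0_one he
  map_mul' := phi0_mul hF he hFe
  map_zero' := by ext c a b; simp [phi0]
  map_add' := by intro X Y; ext c a b; simp [phi0]

theorem phi_apply (X : Module.End D (MM α F e)) (c : C) (a b : α c) :
    phi hF he hFe X c a b = red F e he c (X (ee α F e ⟨c, b⟩) ⟨c, a⟩) := rfl

theorem phi_surj : Function.Surjective (phi (α := α) hF he hFe) := by
  classical
  intro B
  choose β hβ using fun (c : C) (a b : α c) => Ideal.Quotient.mk_surjective (B c a b)
  let X : Module.End D (MM α F e) :=
    { toFun := fun v p => ∑ b, β p.1 p.2 b • v ⟨p.1, b⟩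
      map_add' := by
        intro v w; ext p; simp [Finset.sum_add_distrib]
      map_smul' := by
        intro r v; ext p
        simp only [Pi.smul_apply, RingHom.id_apply, Finset.smul_sum]
        exact Finset.sum_congr rfl fun b _ => smul_comm _ _ _ }
  refine ⟨X, ?_⟩
  ext c a b
  rw [phi_apply]
  have : X (ee α F e ⟨c, b⟩) ⟨c, a⟩ = Ideal.Quotient.mk _ (β c a b) := by
    show (∑ b', β c a b' • (ee α F e ⟨c, b⟩ ⟨c, b'⟩ : OO F e c) : OO F e c) = _
    rw [Finset.sum_eq_single b]
    · rw [ee_self, show (1 : OO F e c) = Ideal.Quotient.mk _ 1 from rfl, smul_mk, mul_one]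
    · intro b' _ hb
      rw [ee_ne (by simpa using hb), smul_zero]
    · simp
  rw [this, red_mk, hβ]

theorem phi_inj_of_unit (X : Module.End D (MM α F e)) (hX : IsUnit (phi hF he hFe X)) :
    Function.Injective X := by
  classical
  rw [injective_iff_map_eq_zero]
  by_contra hcon
  push Not at hcon
  obtain ⟨v, hv, hv0⟩ := hcon
  obtain ⟨p0, hp0⟩ := Function.ne_iff.mp hv0
  set f := F p0.1 with hf
  have hcop : ∀ p : Σ c, α c, F p.1 ≠ f → IsCoprime f (F p.1) := by
    intro p hp
    by_cases h : p0.1 = p.1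
    · exact absurd (by rw [hf, h]) hp
    · rcases hFe _ _ h with h | h
      · exact h
      · exact absurd h.1.symm hp
  let G : D := ∏ p : Σ c, α c, if F p.1 = f then 1 else F p.1 ^ e p.1
  have hG : IsCoprime f G := by
    refine IsCoprime.prod_right fun p _ => ?_
    split_ifs with h
    · exact isCoprime_one_right
    · exact (hcop p h).pow_right
  set v' := G • v with hv'
  have hXv' : X v' = 0 := by rw [hv', map_smul, hv, smul_zero]
  have hv'0 : v' ≠ 0 := by
    intro h
    apply hp0
    obtain ⟨y, hy⟩ := Ideal.Quotient.mk_surjective (v p0)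
    have h2 : G • v p0 = 0 := congrFun h p0
    rw [← hy, smul_mk, mk_zero_iff] at h2
    rw [← hy]
    exact (mk_zero_iff _ _).mpr ((hG.pow_left).dvd_of_dvd_mul_left h2)
  have hv'p : ∀ p : Σ c, α c, F p.1 ≠ f → v' p = 0 := by
    intro p hp
    obtain ⟨y, hy⟩ := Ideal.Quotient.mk_surjective (v p)
    rw [hv', Pi.smul_apply, ← hy, smul_mk, mk_zero_iff]
    refine Dvd.dvd.mul_right ?_ _
    have : (if F p.1 = f then 1 else F p.1 ^ e p.1) ∣ G := Finset.dvd_prod_of_mem _ (Finset.mem_univ p)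
    rwa [if_neg hp] at this
  have hex : ∃ N, f ^ N • v' = 0 := by
    refine ⟨∑ p : Σ c, α c, e p.1, ?_⟩
    ext p
    rw [Pi.smul_apply]
    by_cases hp : F p.1 = f
    · obtain ⟨y, hy⟩ := Ideal.Quotient.mk_surjective (v' p)
      rw [← hy, smul_mk]
      refine (mk_zero_iff _ _).mpr (Dvd.dvd.mul_right ?_ _)
      rw [hp]
      exact pow_dvd_pow _ (Finset.single_le_sum (f := fun p : Σ c, α c => e p.1) (fun _ _ => Nat.zero_le _) (Finset.mem_univ p))
    · rw [hv'p p hp, smul_zero]; rfl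
  obtain ⟨N, hN⟩ : ∃ N, Nat.find hex = N + 1 := by
    apply Nat.exists_eq_succ_of_ne_zero
    intro h
    have := Nat.find_spec hex
    rw [h, pow_zero, one_smul] at this
    exact hv'0 this
  set w := f ^ N • v' with hw
  have hw0 : w ≠ 0 := Nat.find_min hex (by omega)
  have hfw : f • w = 0 := by
    have := Nat.find_spec hex
    rw [hN, pow_succ', mul_smul] at this
    exact this
  have hXw : X w = 0 := by rw [hw, map_smul, hXv', smul_zero]
  have hwp : ∀ p : Σ c, α c, F p.1 ≠ f → w p = 0 := by
    intro p hp; rw [hw, Pi.smul_apply, hv'p p hp, smul_zero]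
  have hu : ∀ p : Σ c, α c, ∃ u : D, Ideal.Quotient.mk _ (F p.1 ^ (e p.1 - 1) * u) = w p ∧ (w p = 0 → u = 0) := by
    intro p
    by_cases h : w p = 0
    · exact ⟨0, by rw [h]; simp, fun _ => rfl⟩
    · have hp : F p.1 = f := by by_contra hp; exact h (hwp p hp)
      obtain ⟨y, hy⟩ := Ideal.Quotient.mk_surjective (w p)
      have h2 : f • w p = 0 := congrFun hfw p
      rw [← hy, smul_mk, mk_zero_iff, ← hp] at h2
      have h3 : F p.1 ^ e p.1 = F p.1 * F p.1 ^ (e p.1 - 1) := by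
        rw [← pow_succ']; congr 1; have := he p.1; omega
      rw [h3] at h2
      obtain ⟨u, rfl⟩ := (mul_dvd_mul_iff_left (hF p.1)).mp h2
      exact ⟨u, hy, fun h' => absurd h' h⟩
  choose u hu1 hu2 using hu
  obtain ⟨p2, hp2⟩ := Function.ne_iff.mp hw0
  obtain ⟨p1, hp1, hmin⟩ := Finset.exists_min_image (Finset.univ.filter fun p : Σ c, α c => w p ≠ 0) (fun p => e p.1)
    ⟨p2, by simpa using hp2⟩
  simp only [Finset.mem_filter, Finset.mem_univ, true_and] at hp1 hmin
  have hfp1 : F p1.1 = f := by by_contra hp; exact hp1 (hwp p1 hp)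
  obtain ⟨c, b1⟩ := p1
  simp only at hfp1 hmin
  have key : ∀ a : α c, ∑ b, phi hF he hFe X c a b * Ideal.Quotient.mk _ (u ⟨c, b⟩) = 0 := by
    intro a
    choose x hx using fun p : Σ c, α c => Ideal.Quotient.mk_surjective (X (ee α F e p) ⟨c, a⟩)
    have h1 := expand_apply X w (fun p => F p.1 ^ (e p.1 - 1) * u p) hu1 ⟨c, a⟩
    rw [hXw, Pi.zero_apply] at h1
    have h2 : F c ^ e c ∣ ∑ p : Σ c, α c, F p.1 ^ (e p.1 - 1) * u p * x p := by
      rw [← mk_zero_iff, map_sum, h1]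
      exact Finset.sum_congr rfl fun p _ => by rw [← hx, smul_mk]
    rw [Fintype.sum_sigma, ← Finset.add_sum_erase _ _ (Finset.mem_univ c)] at h2
    have h3 : F c ^ e c ∣ ∑ c' ∈ Finset.univ.erase c, ∑ b : α c', F c' ^ (e c' - 1) * u ⟨c', b⟩ * x ⟨c', b⟩ := by
      refine Finset.dvd_sum fun c' hc' => Finset.dvd_sum fun b _ => ?_
      by_cases h : w ⟨c', b⟩ = 0
      · rw [hu2 _ h]; simp
      · have h4 := hmin _ h
        simp only at h4
        have h5 : F c' = f := by by_contra hp; exact h (hwp _ hp)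
        have h6 : e c' ≠ e c := by
          have hne : c ≠ c' := (Finset.ne_of_mem_erase hc').symm
          rcases hFe c c' hne with h7 | h7
          · rw [hfp1, h5] at h7
            intro h8
            -- f coprime to itself: then f is a unit, so w vanishes
            have hunit := isCoprime_self.mp h7
            apply absurd hfw
            intro h9
            apply hw0
            obtain ⟨r, hr⟩ := hunit.exists_left_inv
            rw [← one_smul D w, ← hr, mul_smul, h9, smul_zero]
          · exact h7.2.symm
        rw [mul_assoc, h5, hfp1]
        exact Dvd.dvd.mul_right (pow_dvd_pow _ (by omega)) _
    have h4 := (dvd_add_left h3).mp h2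
    have h5 : F c ^ e c = F c ^ (e c - 1) * F c := by
      rw [← pow_succ]; congr 1; have := he c; omega
    have h6 : ∑ b : α c, F c ^ (e c - 1) * u ⟨c, b⟩ * x ⟨c, b⟩ =
        F c ^ (e c - 1) * ∑ b : α c, x ⟨c, b⟩ * u ⟨c, b⟩ := by
      rw [Finset.mul_sum]; exact Finset.sum_congr rfl fun b _ => by ring
    rw [h6, h5] at h4
    have h7 := (mul_dvd_mul_iff_left (pow_ne_zero _ (hF c))).mp h4
    rw [← mkk_zero_iff, map_sum] at h7
    rw [← h7]
    refine Finset.sum_congr rfl fun b _ => ?_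
    rw [phi_apply, ← hx, red_mk, map_mul]
  obtain ⟨Y, hY⟩ := hX.exists_left_inv
  have h8 : (Y * phi hF he hFe X) c *ᵥ (fun b => Ideal.Quotient.mk _ (u ⟨c, b⟩)) = 0 := by
    rw [Pi.mul_apply, ← mulVec_mulVec]
    have : phi hF he hFe X c *ᵥ (fun b => Ideal.Quotient.mk _ (u ⟨c, b⟩)) = 0 := by
      ext a; exact key a
    rw [this, mulVec_zero]
  rw [hY, Pi.one_apply, one_mulVec] at h8
  have h9 := congrFun h8 b1
  simp only [Pi.zero_apply] at h9
  rw [mkk_zero_iff] at h9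
  apply hp1
  rw [← hu1, mk_zero_iff]
  have h5 : F c ^ e c = F c ^ (e c - 1) * F c := by
    rw [← pow_succ]; congr 1; have := he c; omega
  show F c ^ e c ∣ F c ^ (e c - 1) * u ⟨c, b1⟩
  rw [h5]
  exact mul_dvd_mul_left _ h9

end phi
end FFU


namespace FFU

section count
variable {K R B : Type*} [Field K] [Ring R] [Ring B] [Finite R] [Finite B] [Module K R] [Module K B]
  {σ : K →+* K} (hσ : ∀ x, σ (σ x) = x) (hne : ∃ x, σ x ≠ x)

/-- fibres of a map equivariant under translations -/
theorem card_sub_fibers {R B : Type*} [AddCommGroup R] [AddCommGroup B] [Finite R] [Finite B]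
    (Φ : R →+ B) (H : AddSubgroup R) (T : B → Prop) (hT : ∀ b, T b → ∃ x ∈ H, Φ x = b) :
    Nat.card {x : R // x ∈ H ∧ T (Φ x)} = Nat.card {b // T b} * Nat.card {x : R // x ∈ H ∧ Φ x = 0} := by
  refine card_fibers (fun x : {x : R // x ∈ H ∧ T (Φ x)} => (⟨Φ x.1, x.2.2⟩ : {b // T b})) _ ?_
  rintro ⟨b, hb⟩
  obtain ⟨y, hy, rfl⟩ := hT b hb
  refine Nat.card_congr
    { toFun := fun x => ⟨x.1.1 - y, H.sub_mem x.1.2.1 hy, ?_⟩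
      invFun := fun x => ⟨⟨x.1 + y, H.add_mem x.2.1 hy, ?_⟩, ?_⟩
      left_inv := ?_
      right_inv := ?_ }
  · have := congrArg Subtype.val x.2
    simp only at this
    rw [map_sub, this, sub_self]
  · rw [map_add, x.2.2, zero_add]; exact hb
  · apply Subtype.ext; simp only; rw [map_add, x.2.2, zero_add]
  · intro x; apply Subtype.ext; apply Subtype.ext; simp
  · intro x; apply Subtype.ext; simp

include hσ hne in
theorem card_semilin {V : Type*} [AddCommGroup V] [Module K V] (adj : V → V)
    (hadd : ∀ x y, adj (x + y) = adj x + adj y) (hadj : ∀ x, adj (adj x) = x)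
    (hsm : ∀ (t : K) x, adj (t • x) = σ t • adj x) :
    Nat.card V = Nat.card {x : V // adj x = x} ^ 2 := by
  obtain ⟨w, hw⟩ := hne
  have hd : w - σ w ≠ 0 := fun h => hw (sub_eq_zero.mp h).symm
  have hneg : ∀ x, adj (-x) = - adj x := by
    intro x; have := hsm (-1) x; simpa using this
  have hs : σ (w - σ w)⁻¹ = -(w - σ w)⁻¹ := by
    rw [map_inv₀, map_sub, hσ, ← inv_neg]; congr 1; ring
  rw [pow_two, ← Nat.card_prod]
  symm
  refine Nat.card_congr (Equiv.ofBijective (fun p => p.1.1 + w • p.2.1) ⟨?_, ?_⟩)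
  · rintro ⟨⟨a, ha⟩, ⟨b, hb⟩⟩ ⟨⟨c, hc⟩, ⟨d, hd'⟩⟩ h
    simp only at h
    have h2 := congrArg adj h
    simp only [hadd, hsm, ha, hb, hc, hd'] at h2
    have h3 : (w - σ w) • (b - d) = 0 := by
      have : (a + w • b) - (a + σ w • b) = (c + w • d) - (c + σ w • d) := by rw [h, h2]
      rw [smul_sub, sub_smul, sub_smul]
      rw [add_sub_add_left_eq_sub, add_sub_add_left_eq_sub] at this
      rw [this, sub_self]
    have h4 : b = d := sub_eq_zero.mp ((smul_eq_zero.mp h3).resolve_left hd)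
    subst h4
    have h5 : a = c := add_right_cancel h
    subst h5; rfl
  · intro x
    set y := (w - σ w)⁻¹ • (x - adj x) with hy
    have hyf : adj y = y := by
      rw [hy, hsm, hs, sub_eq_add_neg x, hadd, hneg, hadj, neg_smul, ← smul_neg]
      congr 1; abel
    refine ⟨(⟨x - w • y, ?_⟩, ⟨y, hyf⟩), by simp⟩
    rw [sub_eq_add_neg, hadd, hneg, hsm, hyf]
    have : (w - σ w) • y = x - adj x := by rw [hy, smul_smul, mul_inv_cancel₀ hd, one_smul]
    rw [sub_smul] at this
    have h2 : adj x = x - (w • y - σ w • y) := by rw [this]; abel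
    rw [h2]; abel

include hσ hne in
theorem count_abs (Φ : R →+* B) (hs : Function.Surjective Φ) (hunit : ∀ X, IsUnit (Φ X) → IsUnit X)
    (hΦ : ∀ (t : K) X, Φ (t • X) = t • Φ X) (adj : R → R)
    (hadd : ∀ x y, adj (x + y) = adj x + adj y) (hadj : ∀ x, adj (adj x) = x)
    (hsm : ∀ (t : K) x, adj (t • x) = σ t • adj x) (τ : B → B) (hτ : ∀ X, Φ (adj X) = τ (Φ X)) :
    Nat.card {X : R // adj X = X ∧ IsUnit X} * Nat.card {X : R // adj X = X} *
      (Nat.card {b : B // IsUnit b} * Nat.card {b : B // τ b = b}) =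
    Nat.card {X : R // IsUnit X} * (Nat.card B * Nat.card {b : B // τ b = b ∧ IsUnit b}) := by
  have hneg : ∀ x, adj (-x) = - adj x := by
    intro x; have := hsm (-1) x; simpa using this
  have hu : ∀ X, IsUnit (Φ X) ↔ IsUnit X := fun X => ⟨hunit X, fun h => h.map Φ⟩
  let H : AddSubgroup R :=
    { carrier := {x | adj x = x}
      add_mem' := by intro a b ha hb; simp only [Set.mem_setOf_eq] at *; rw [hadd, ha, hb]
      zero_mem' := by have := hsm 0 0; simpa using this
      neg_mem' := by intro a ha; simp only [Set.mem_setOf_eq] at *; rw [hneg, ha] }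
  have hH : ∀ x, x ∈ H ↔ adj x = x := fun x => Iff.rfl
  have hlift : ∀ b, τ b = b → ∃ x ∈ H, Φ x = b := by
    intro b hb
    obtain ⟨t, ht⟩ := exists_trace_one hσ hne
    obtain ⟨x, rfl⟩ := hs b
    refine ⟨t • x + adj (t • x), ?_, ?_⟩
    · rw [hH, hadd, hadj, add_comm]
    · rw [map_add, hsm, hΦ, hΦ, hτ, hb, ← add_smul, ht, one_smul]
  have hHτ : ∀ x, x ∈ H → τ (Φ x) = Φ x := by
    intro x hx; rw [← hτ, (hH x).mp hx]
  have c1 := card_sub_fibers Φ.toAddMonoidHom H (fun b => τ b = b) hlift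
  have c2 := card_sub_fibers Φ.toAddMonoidHom H (fun b => τ b = b ∧ IsUnit b) (fun b hb => hlift b hb.1)
  have c3 := card_sub_fibers Φ.toAddMonoidHom ⊤ (fun b => IsUnit b)
    (fun b _ => by obtain ⟨x, hx⟩ := hs b; exact ⟨x, trivial, hx⟩)
  have c4 := card_sub_fibers Φ.toAddMonoidHom ⊤ (fun b => True)
    (fun b _ => by obtain ⟨x, hx⟩ := hs b; exact ⟨x, trivial, hx⟩)
  have d1 : Nat.card {x : R // x ∈ H ∧ τ (Φ x) = Φ x} = Nat.card {X : R // adj X = X} :=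
    Nat.card_congr (Equiv.subtypeEquivRight fun x => ⟨fun h => h.1, fun h => ⟨h, hHτ x h⟩⟩)
  have d2 : Nat.card {x : R // x ∈ H ∧ τ (Φ x) = Φ x ∧ IsUnit (Φ x)} = Nat.card {X : R // adj X = X ∧ IsUnit X} :=
    Nat.card_congr (Equiv.subtypeEquivRight fun x => ⟨fun h => ⟨h.1, hunit _ h.2.2⟩, fun h => ⟨h.1, hHτ x h.1, h.2.map Φ⟩⟩)
  have d3 : Nat.card {x : R // x ∈ (⊤ : AddSubgroup R) ∧ IsUnit (Φ x)} = Nat.card {X : R // IsUnit X} :=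
    Nat.card_congr (Equiv.subtypeEquivRight fun x => ⟨fun h => hunit _ h.2, fun h => ⟨trivial, h.map Φ⟩⟩)
  have d4 : Nat.card {x : R // x ∈ (⊤ : AddSubgroup R) ∧ True} = Nat.card R :=
    Nat.card_congr (Equiv.subtypeUnivEquiv fun x => ⟨trivial, trivial⟩)
  have d5 : Nat.card {b : B // True} = Nat.card B :=
    Nat.card_congr (Equiv.subtypeUnivEquiv fun x => trivial)
  have c5 := card_semilin hσ hne adj hadd hadj hsm
  change Nat.card {x : R // x ∈ H ∧ τ (Φ x) = Φ x} = _ at c1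
  change Nat.card {x : R // x ∈ H ∧ τ (Φ x) = Φ x ∧ IsUnit (Φ x)} = _ at c2
  change Nat.card {x : R // x ∈ (⊤ : AddSubgroup R) ∧ IsUnit (Φ x)} = _ at c3
  change Nat.card {x : R // x ∈ (⊤ : AddSubgroup R) ∧ True} = _ at c4
  rw [d1] at c1
  rw [d2] at c2
  rw [d3] at c3
  rw [d4, d5, c5] at c4
  rw [c2, c3]
  calc _ = Nat.card {b : B // τ b = b ∧ IsUnit b} * Nat.card {b : B // IsUnit b} *
        Nat.card {X : R // adj X = X} * (Nat.card {b : B // τ b = b} * 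
          Nat.card {x // x ∈ H ∧ Φ.toAddMonoidHom x = 0}) := by ring
    _ = Nat.card {b : B // τ b = b ∧ IsUnit b} * Nat.card {b : B // IsUnit b} *
        Nat.card {X : R // adj X = X}^2 := by rw [← c1]; ring
    _ = _ := by rw [c4]; ring

end count

/-! ### conjugation and trace-like functional on `K[X]/(g)` -/
section lam
open Polynomial
variable {K : Type*} [Field K] {σ : K →+* K}

/-- conjugation on the quotient -/
noncomputable def cj (σ : K →+* K) (g : K[X]) (hg : g.map σ = g) :
    K[X] ⧸ Ideal.span {g} →+* K[X] ⧸ Ideal.span {g} :=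
  Ideal.quotientMap _ (mapRingHom σ) (by
    rw [Ideal.span_singleton_le_iff_mem, Ideal.mem_comap, coe_mapRingHom, hg]
    exact Ideal.mem_span_singleton_self g)

theorem cj_mk {g : K[X]} (hg : g.map σ = g) (p : K[X]) :
    cj σ g hg (Ideal.Quotient.mk _ p) = Ideal.Quotient.mk _ (p.map σ) := by
  rw [cj, Ideal.quotientMap_mk]; rfl

theorem cj_cj (hσ : ∀ x, σ (σ x) = x) {g : K[X]} (hg : g.map σ = g) (x) : cj σ g hg (cj σ g hg x) = x := by
  obtain ⟨p, rfl⟩ := Ideal.Quotient.mk_surjective x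
  rw [cj_mk, cj_mk, Polynomial.map_map]
  congr 1
  ext i; simp [hσ]

/-- top coefficient functional -/
noncomputable def lam (g : K[X]) (x : K[X] ⧸ Ideal.span {g}) : K :=
  ((Function.surjInv Ideal.Quotient.mk_surjective x) %ₘ g).coeff (g.natDegree - 1)

theorem lam_mk {g : K[X]} (hm : g.Monic) (p : K[X]) :
    lam g (Ideal.Quotient.mk _ p) = (p %ₘ g).coeff (g.natDegree - 1) := by
  unfold lam
  set r := Function.surjInv Ideal.Quotient.mk_surjective (Ideal.Quotient.mk (Ideal.span {g}) p)
  have h : Ideal.Quotient.mk (Ideal.span {g}) r = Ideal.Quotient.mk _ p := Function.surjInv_eq _ _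
  rw [Ideal.Quotient.eq, Ideal.mem_span_singleton, ← modByMonic_eq_zero_iff_dvd hm, sub_modByMonic, sub_eq_zero] at h
  rw [h]

theorem lam_add {g : K[X]} (hm : g.Monic) (x y) : lam g (x + y) = lam g x + lam g y := by
  obtain ⟨p, rfl⟩ := Ideal.Quotient.mk_surjective x
  obtain ⟨r, rfl⟩ := Ideal.Quotient.mk_surjective y
  rw [← map_add, lam_mk hm, lam_mk hm, lam_mk hm, add_modByMonic, coeff_add]

theorem smulK_mk {g : K[X]} (c : K) (p : K[X]) :
    c • (Ideal.Quotient.mk (Ideal.span {g}) p) = Ideal.Quotient.mk _ (C c * p) := by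
  rw [← smul_eq_C_mul]; rfl

theorem lam_smul {g : K[X]} (hm : g.Monic) (c : K) (x) : lam g (c • x) = c * lam g x := by
  obtain ⟨p, rfl⟩ := Ideal.Quotient.mk_surjective x
  rw [smulK_mk, lam_mk hm, lam_mk hm, ← smul_eq_C_mul, smul_modByMonic, coeff_smul, smul_eq_mul]

theorem lam_cj {g : K[X]} (hm : g.Monic) (hg : g.map σ = g) (x) : lam g (cj σ g hg x) = σ (lam g x) := by
  obtain ⟨p, rfl⟩ := Ideal.Quotient.mk_surjective x
  rw [cj_mk, lam_mk hm, lam_mk hm, ← coeff_map, map_modByMonic σ hm, hg]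

theorem lam_nondeg {g : K[X]} (hm : g.Monic) (x) (h : ∀ y, lam g (y * x) = 0) : x = 0 := by
  obtain ⟨p, rfl⟩ := Ideal.Quotient.mk_surjective x
  by_contra hx
  rw [Ideal.Quotient.eq_zero_iff_mem, Ideal.mem_span_singleton, ← modByMonic_eq_zero_iff_dvd hm] at hx
  set r := p %ₘ g with hr
  have hg1 : g ≠ 1 := by
    rintro rfl; apply hx; rw [hr]; simp
  have hdeg : r.natDegree < g.natDegree := natDegree_modByMonic_lt p hm hg1
  have hpr : Ideal.Quotient.mk (Ideal.span {g}) p = Ideal.Quotient.mk _ r := by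
    rw [Ideal.Quotient.eq, Ideal.mem_span_singleton, ← modByMonic_eq_zero_iff_dvd hm, sub_modByMonic,
      sub_eq_zero, hr]
    symm
    rw [(modByMonic_eq_self_iff hm)]
    exact degree_modByMonic_lt p hm
  have h1 := h (Ideal.Quotient.mk _ (X ^ (g.natDegree - 1 - r.natDegree)))
  have h2 : (X ^ (g.natDegree - 1 - r.natDegree) * r) %ₘ g = X ^ (g.natDegree - 1 - r.natDegree) * r := by
    rw [(modByMonic_eq_self_iff hm)]
    apply degree_lt_degree
    rw [natDegree_X_pow_mul _ hx]
    omega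
  rw [hpr, ← map_mul, lam_mk hm, h2] at h1
  have h3 : (X ^ (g.natDegree - 1 - r.natDegree) * r).coeff (g.natDegree - 1) = r.leadingCoeff := by
    conv_lhs => rw [show g.natDegree - 1 = r.natDegree + (g.natDegree - 1 - r.natDegree) by omega]
    rw [show r.natDegree + (g.natDegree - 1 - r.natDegree) - r.natDegree = g.natDegree - 1 - r.natDegree by omega, coeff_X_pow_mul]
    rfl
  rw [h3] at h1
  exact hx (leadingCoeff_eq_zero.mp h1)

end lam
end FFU


namespace FFU

section model
/-- prime power -/
abbrev gg {D C : Type*} [CommRing D] (F : C → D) (e : C → ℕ) (c : C) : D := F c ^ e c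
open Polynomial
variable {K : Type*} [Field K] {σ : K →+* K} {C : Type*} [Fintype C] [DecidableEq C]
  {α : C → Type*} [∀ c, Fintype (α c)] [∀ c, DecidableEq (α c)] {F : C → K[X]} {e : C → ℕ}

theorem poly_lin {M M' : Type*} [AddCommGroup M] [AddCommGroup M'] [Module K M] [Module K M']
    [Module K[X] M] [Module K[X] M'] [IsScalarTower K K[X] M] [IsScalarTower K K[X] M']
    (f : M →ₗ[K] M') (h : ∀ v, f ((X : K[X]) • v) = (X : K[X]) • f v) (p : K[X]) (v : M) :
    f (p • v) = p • f v := by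
  induction p using Polynomial.induction_on' with
  | add p q hp hq => rw [add_smul, map_add, hp, hq, add_smul]
  | monomial n a =>
    rw [← mul_one a, ← smul_eq_mul, ← smul_monomial, ← Polynomial.X_pow_eq_monomial, smul_assoc, map_smul, smul_assoc]
    congr 1
    induction n generalizing v with
    | zero => simp
    | succ n ih => rw [pow_succ, mul_smul, ih, h, mul_smul]

theorem pow_fix (e : C → ℕ) (hFσ : ∀ c, (F c).map σ = F c) (c : C) : (gg F e c).map σ = gg F e c := by
  unfold gg; rw [Polynomial.map_pow, hFσ]

/-- conjugation on the local factors -/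
noncomputable def oc (e : C → ℕ) (hFσ : ∀ c, (F c).map σ = F c) (c : C) : OO F e c →+* OO F e c :=
  cj σ (gg F e c) (pow_fix e hFσ c)

/-- functional on the local factors -/
noncomputable def ol (F : C → K[X]) (e : C → ℕ) (c : C) : OO F e c → K := lam (gg F e c)

section oc
variable (hFσ : ∀ c, (F c).map σ = F c) (hm : ∀ c, (F c).Monic) (c : C)
theorem oc_mk (p : K[X]) : oc e hFσ c (Ideal.Quotient.mk _ p) = Ideal.Quotient.mk _ (p.map σ) := cj_mk _ p
theorem oc_oc (hσ : ∀ x, σ (σ x) = x) (x : OO F e c) : oc e hFσ c (oc e hFσ c x) = x := cj_cj hσ _ x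
include hm
theorem ol_add (x y : OO F e c) : ol F e c (x + y) = ol F e c x + ol F e c y := lam_add ((hm c).pow _) x y
theorem ol_smul (t : K) (x : OO F e c) : ol F e c (t • x) = t * ol F e c x := lam_smul ((hm c).pow _) t x
theorem ol_zero : ol F e c 0 = 0 := by
  have := ol_smul (e := e) hm c 0 0
  rwa [zero_smul, zero_mul] at this
theorem ol_neg (x : OO F e c) : ol F e c (-x) = - ol F e c x := by
  have := ol_smul (e := e) hm c (-1) x
  rwa [neg_smul, one_smul, neg_one_mul] at this
theorem ol_oc (x : OO F e c) : ol F e c (oc e hFσ c x) = σ (ol F e c x) := lam_cj ((hm c).pow _) _ x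
theorem ol_nondeg (x : OO F e c) (h : ∀ y, ol F e c (y * x) = 0) : x = 0 := lam_nondeg ((hm c).pow _) x h
end oc

/-- standard Hermitian form on the model -/
noncomputable def SS (hFσ : ∀ c, (F c).map σ = F c) (a b : MM α F e) : K :=
  ∑ p : (Σ c, α c), ol F e p.1 (oc e hFσ p.1 (a p) * b p)

variable (hFσ : ∀ c, (F c).map σ = F c) (hm : ∀ c, (F c).Monic)

include hm in
theorem SS_add (a b b' : MM α F e) : SS hFσ a (b + b') = SS hFσ a b + SS hFσ a b' := by
  simp only [SS, Pi.add_apply, mul_add, ← Finset.sum_add_distrib]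
  exact Finset.sum_congr rfl fun p _ => by rw [ol_add hm]

include hm in
theorem SS_smul (t : K) (a b : MM α F e) : SS hFσ a (t • b) = t * SS hFσ a b := by
  simp only [SS, Pi.smul_apply, Finset.mul_sum, mul_smul_comm]
  exact Finset.sum_congr rfl fun p _ => by rw [ol_smul hm]

include hm in
theorem SS_herm (hσ : ∀ x, σ (σ x) = x) (a b : MM α F e) : SS hFσ b a = σ (SS hFσ a b) := by
  simp only [SS, map_sum]
  refine Finset.sum_congr rfl fun p _ => ?_
  rw [← ol_oc hFσ hm p.1, map_mul, oc_oc hFσ p.1 hσ, mul_comm]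

theorem SS_X (a b : MM α F e) : SS hFσ a ((X : K[X]) • b) = SS hFσ ((X : K[X]) • a) b := by
  simp only [SS, Pi.smul_apply]
  refine Finset.sum_congr rfl fun p _ => ?_
  congr 1
  have h : ∀ x : OO F e p.1, (X : K[X]) • x = Ideal.Quotient.mk _ X * x := fun x => rfl
  rw [h, h, map_mul, oc_mk, Polynomial.map_X]
  ring

include hm in
theorem SS_ee (a : MM α F e) (p : Σ c, α c) (d : OO F e p.1) :
    SS hFσ (Pi.single p d) a = ol F e p.1 (oc e hFσ p.1 d * a p) := by
  rw [SS, Finset.sum_eq_single p]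
  · simp
  · intro b _ hb; rw [Pi.single_eq_of_ne hb, map_zero, zero_mul, ol_zero hm]
  · simp

include hm in
theorem SS_nondeg (hσ : ∀ x, σ (σ x) = x) (b : MM α F e) (h : ∀ a, SS hFσ a b = 0) : b = 0 := by
  ext p
  refine ol_nondeg hm p.1 _ fun y => ?_
  have := h (Pi.single p (oc e hFσ p.1 y))
  rwa [SS_ee hFσ hm, oc_oc hFσ _ hσ] at this

include hm in
/-- adjoint endomorphisms have conjugate transposed reductions -/
theorem adj_entry (hσ : ∀ x, σ (σ x) = x) (Y Y' : Module.End K[X] (MM α F e))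
    (h : ∀ a b, SS hFσ a (Y' b) = SS hFσ (Y a) b) (c : C) (a b : α c) :
    Y' (ee α F e ⟨c, b⟩) ⟨c, a⟩ = oc e hFσ c (Y (ee α F e ⟨c, a⟩) ⟨c, b⟩) := by
  rw [← sub_eq_zero]
  refine ol_nondeg hm c _ fun y => ?_
  obtain ⟨y, rfl⟩ := Function.Involutive.surjective (oc_oc (e := e) hFσ c hσ) y
  obtain ⟨r, rfl⟩ := Ideal.Quotient.mk_surjective y
  have h1 := h (Pi.single ⟨c, a⟩ (Ideal.Quotient.mk _ r)) (ee α F e ⟨c, b⟩)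
  rw [SS_ee hFσ hm, SS_herm hFσ hm hσ, ee, SS_ee hFσ hm, map_one, one_mul,
    ← ol_oc hFσ hm c] at h1
  have h2 : (Pi.single ⟨c, a⟩ (Ideal.Quotient.mk _ r) : MM α F e) = r • ee α F e ⟨c, a⟩ := by
    ext p
    by_cases hp : p = ⟨c, a⟩
    · subst hp
      rw [Pi.single_eq_same, Pi.smul_apply, ee_self,
        show (1 : OO F e c) = Ideal.Quotient.mk _ 1 from rfl, smul_mk, mul_one]
    · rw [Pi.single_eq_of_ne hp, Pi.smul_apply, ee_ne hp, smul_zero]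
  rw [h2, map_smul, Pi.smul_apply] at h1
  have h3 : ∀ x : OO F e c, r • x = Ideal.Quotient.mk _ r * x := fun x => rfl
  rw [h3, map_mul] at h1
  rw [mul_sub, sub_eq_add_neg, ← mul_neg, ol_add hm]
  rw [mul_neg, ol_neg hm]
  rw [← sub_eq_add_neg, sub_eq_zero]
  exact h1

theorem red_cj (he : ∀ c, 1 ≤ e c) (c : C) (x : OO F e c) :
    red F e he c (oc e hFσ c x) = cj σ _ (hFσ c) (red F e he c x) := by
  obtain ⟨r, rfl⟩ := Ideal.Quotient.mk_surjective x
  rw [oc_mk, red_mk, red_mk, cj_mk]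


theorem finite_quot [Finite K] {g : K[X]} (hg : g.Monic) : Finite (K[X] ⧸ Ideal.span {g}) := by
  have := hg.finite_adjoinRoot
  have h : Finite (AdjoinRoot g) := Module.finite_of_finite K
  exact h

section conj
variable {n : ℕ} {A : Matrix (Fin n) (Fin n) K} (φ : (Fin n → K) ≃ₗ[K] MM α F e)
  (hφ : ∀ v, φ (A *ᵥ v) = (X : K[X]) • φ v)

include hφ in
theorem phi_symm (w) : φ.symm ((X : K[X]) • w) = A *ᵥ φ.symm w := by
  apply φ.injective
  rw [hφ]; simp

/-- transport of a commuting matrix -/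
noncomputable def psi (Y : Subalgebra.centralizer K {A}) : Module.End K[X] (MM α F e) where
  toFun w := φ (Y.1 *ᵥ φ.symm w)
  map_add' := by intro a b; rw [map_add, mulVec_add, map_add]
  map_smul' := by
    intro p w
    refine poly_lin (φ.toLinearMap ∘ₗ (Matrix.mulVecLin Y.1) ∘ₗ φ.symm.toLinearMap) ?_ p w
    intro v
    have hY : A * Y.1 = Y.1 * A := Y.2 A (by simp)
    simp only [LinearMap.comp_apply, LinearEquiv.coe_coe, mulVecLin_apply]
    rw [phi_symm φ hφ, mulVec_mulVec, ← hY, ← mulVec_mulVec, hφ]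

theorem psi_apply (Y : Subalgebra.centralizer K {A}) (w) : psi φ hφ Y w = φ (Y.1 *ᵥ φ.symm w) := rfl

theorem psi_phi (Y : Subalgebra.centralizer K {A}) (w) : psi φ hφ Y (φ w) = φ (Y.1 *ᵥ w) := by
  rw [psi_apply, LinearEquiv.symm_apply_apply]

/-- as ring hom -/
noncomputable def psiR : Subalgebra.centralizer K {A} →+* Module.End K[X] (MM α F e) where
  toFun := psi φ hφ
  map_one' := by apply LinearMap.ext; intro w; simp [psi_apply]
  map_mul' := by intro a b; apply LinearMap.ext; intro w; simp [psi_apply]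
  map_zero' := by apply LinearMap.ext; intro w; simp [psi_apply]
  map_add' := by intro a b; apply LinearMap.ext; intro w; simp [psi_apply, add_mulVec]

theorem psiR_surj : Function.Surjective (psiR φ hφ) := by
  classical
  intro Z
  let L : (Fin n → K) →ₗ[K] (Fin n → K) := φ.symm.toLinearMap ∘ₗ (Z.restrictScalars K) ∘ₗ φ.toLinearMap
  have hL : ∀ v, (LinearMap.toMatrix' L) *ᵥ v = φ.symm (Z (φ v)) := by
    intro v; rw [LinearMap.toMatrix'_mulVec]; rfl
  refine ⟨⟨LinearMap.toMatrix' L, ?_⟩, ?_⟩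
  · rw [Subalgebra.mem_centralizer_iff]
    rintro _ rfl
    apply Matrix.ext_of_mulVec_single
    intro i
    rw [← mulVec_mulVec, ← mulVec_mulVec, hL, hL, hφ, map_smul, phi_symm φ hφ]
  · apply LinearMap.ext; intro w
    change φ (LinearMap.toMatrix' L *ᵥ φ.symm w) = Z w
    rw [hL]; simp

theorem centr_unit (Y : Subalgebra.centralizer K {A}) (h1 : IsUnit Y.1) : IsUnit Y := by
  obtain ⟨u, hu⟩ := h1
  have hA : A * Y.1 = Y.1 * A := Y.2 A (by simp)
  rw [← hu] at hA
  refine ⟨⟨Y, ⟨u⁻¹.1, ?_⟩, ?_, ?_⟩, rfl⟩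
  · rw [Subalgebra.mem_centralizer_iff]
    intro B hB
    rw [Set.mem_singleton_iff.mp hB]
    have : Commute A u.1 := hA
    exact this.units_inv_right
  · apply Subtype.ext; change Y.1 * u⁻¹.1 = 1; rw [← hu]; exact u.mul_inv
  · apply Subtype.ext; change u⁻¹.1 * Y.1 = 1; rw [← hu]; exact u.inv_mul

theorem unit_of_psi (Y : Subalgebra.centralizer K {A}) (h : Function.Injective (psi φ hφ Y)) : IsUnit Y := by
  apply centr_unit
  rw [← Matrix.mulVec_injective_iff_isUnit]
  intro v w hvw
  apply φ.injective
  apply h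
  rw [psi_phi, psi_phi]
  exact congrArg φ hvw

/-- Gram matrix -/
noncomputable def gram : Matrix (Fin n) (Fin n) K :=
  Matrix.of fun i j => SS hFσ (φ (Pi.single i 1)) (φ (Pi.single j 1))

theorem sig_mulVec (Y : Matrix (Fin n) (Fin n) K) (v u : Fin n → K) :
    (σ ∘ (Y *ᵥ v)) ⬝ᵥ u = (σ ∘ v) ⬝ᵥ (ct σ Y *ᵥ u) := by
  rw [dotProduct_mulVec]
  congr 1
  ext i
  simp only [Function.comp_apply, mulVec, vecMul, dotProduct, map_sum, map_mul, ct_apply]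
  exact Finset.sum_congr rfl fun j _ => mul_comm _ _

theorem sig_entry (M : Matrix (Fin n) (Fin n) K) (i j) :
    (σ ∘ (Pi.single i 1)) ⬝ᵥ (M *ᵥ Pi.single j 1) = M i j := by
  have : σ ∘ (Pi.single i 1 : Fin n → K) = Pi.single i 1 := by
    ext k; by_cases h : k = i
    · subst h; simp
    · simp [h]
  rw [this]; simp

include hm in
theorem SS_lin (a : MM α F e) (w : Fin n → K) :
    SS hFσ a (φ w) = ∑ j, w j * SS hFσ a (φ (Pi.single j 1)) := by
  let L : (Fin n → K) →ₗ[K] K :=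
    { toFun := fun w => SS hFσ a (φ w)
      map_add' := by intro x y; rw [map_add, SS_add hFσ hm]
      map_smul' := by intro x y; rw [map_smul, SS_smul hFσ hm]; rfl }
  have := LinearMap.pi_apply_eq_sum_univ L w
  change L w = _
  rw [this]
  refine Finset.sum_congr rfl fun j _ => ?_
  rw [smul_eq_mul]
  congr 1
  change SS hFσ a (φ _) = _
  congr 2
  ext k; rw [Pi.single_apply]; simp [eq_comm]

include hm in
theorem gram_form (hσ : ∀ x, σ (σ x) = x) (v w : Fin n → K) :
    SS hFσ (φ v) (φ w) = (σ ∘ v) ⬝ᵥ (gram hFσ φ *ᵥ w) := by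
  rw [SS_lin hFσ hm]
  simp only [dotProduct, mulVec, Finset.mul_sum]
  rw [Finset.sum_comm]
  refine Finset.sum_congr rfl fun j _ => ?_
  rw [SS_herm hFσ hm hσ, SS_lin hFσ hm, map_sum, Finset.mul_sum]
  refine Finset.sum_congr rfl fun i _ => ?_
  rw [map_mul, ← SS_herm hFσ hm hσ]
  simp only [gram, Matrix.of_apply, Function.comp_apply]
  ring

include hm in
theorem gram_herm (hσ : ∀ x, σ (σ x) = x) : ct σ (gram hFσ φ) = gram hFσ φ := by
  ext i j
  rw [ct_apply, gram, Matrix.of_apply, Matrix.of_apply, ← SS_herm hFσ hm hσ]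

include hm in
theorem gram_unit (hσ : ∀ x, σ (σ x) = x) : IsUnit (gram hFσ φ) := by
  rw [← Matrix.mulVec_injective_iff_isUnit]
  intro v w hvw
  rw [← sub_eq_zero]
  apply φ.injective
  rw [map_zero]
  apply SS_nondeg hFσ hm hσ
  intro a
  obtain ⟨x, rfl⟩ := φ.surjective a
  rw [gram_form hFσ hm φ hσ, mulVec_sub, sub_eq_zero.mpr hvw, dotProduct_zero]

include hm hφ in
theorem gram_compat (hσ : ∀ x, σ (σ x) = x) : gram hFσ φ * A = ct σ A * gram hFσ φ := by
  ext i j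
  rw [← sig_entry (σ := σ) (gram hFσ φ * A) i j, ← sig_entry (σ := σ) (ct σ A * gram hFσ φ) i j, ← mulVec_mulVec, ← mulVec_mulVec,
    ← gram_form hFσ hm φ hσ, ← sig_mulVec, ← gram_form hFσ hm φ hσ, hφ, hφ, SS_X]

include hm hφ in
theorem count_model [Finite K] (hσ : ∀ x, σ (σ x) = x) (hne : ∃ x, σ x ≠ x) (he : ∀ c, 1 ≤ e c)
    (hFe : ∀ c c', c ≠ c' → IsCoprime (F c) (F c') ∨ (F c = F c' ∧ e c ≠ e c')) :
    Hct σ A * Fct σ A *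
      (Nat.card {b : ∀ c, Matrix (α c) (α c) (KK F c) // IsUnit b} *
       Nat.card {b : ∀ c, Matrix (α c) (α c) (KK F c) // (fun c => ct (cj σ (F c) (hFσ c)) (b c)) = b}) =
    Nat.card {Y : Matrix (Fin n) (Fin n) K // A * Y = Y * A ∧ IsUnit Y} *
      (Nat.card (∀ c, Matrix (α c) (α c) (KK F c)) *
       Nat.card {b : ∀ c, Matrix (α c) (α c) (KK F c) //
        (fun c => ct (cj σ (F c) (hFσ c)) (b c)) = b ∧ IsUnit b}) := by
  have hF : ∀ c, F c ≠ 0 := fun c => (hm c).ne_zero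
  have : ∀ c, Finite (KK F c) := fun c => finite_quot (hm c)
  obtain ⟨u, hu⟩ := gram_unit hFσ hm φ hσ
  have hherm : ct σ u.1 = u.1 := by rw [hu]; exact gram_herm hFσ hm φ hσ
  have hcomp : u.1 * A = ct σ A * u.1 := by rw [hu]; exact gram_compat hFσ hm φ hφ hσ
  have hui : u⁻¹.1 * u.1 = 1 := u.inv_mul
  have huu : u.1 * u⁻¹.1 = 1 := u.mul_inv
  have hhermi : ct σ u⁻¹.1 = u⁻¹.1 := by
    have h1 : ct σ u⁻¹.1 * u.1 = 1 := by rw [← hherm, ← ct_mul, huu, ct_one]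
    calc ct σ u⁻¹.1 = ct σ u⁻¹.1 * (u.1 * u⁻¹.1) := by rw [huu, mul_one]
      _ = u⁻¹.1 := by rw [← mul_assoc, h1, one_mul]
  have hcompi : A * u⁻¹.1 = u⁻¹.1 * ct σ A := by
    calc A * u⁻¹.1 = u⁻¹.1 * (u.1 * A) * u⁻¹.1 := by rw [← mul_assoc, hui, one_mul]
      _ = u⁻¹.1 * ct σ A * (u.1 * u⁻¹.1) := by rw [hcomp]; noncomm_ring
      _ = _ := by rw [huu, mul_one]
  have hmem : ∀ Y : Matrix (Fin n) (Fin n) K, Y ∈ Subalgebra.centralizer K {A} ↔ A * Y = Y * A := by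
    intro Y; rw [Subalgebra.mem_centralizer_iff]; simp
  have hcY : ∀ Y : Subalgebra.centralizer K {A}, A * Y.1 = Y.1 * A := fun Y => (hmem _).mp Y.2
  have hcan : ∀ Z : Matrix (Fin n) (Fin n) K, u.1 * (u⁻¹.1 * Z) = Z := fun Z => by
    rw [← mul_assoc, huu, one_mul]
  have hcan' : ∀ Z : Matrix (Fin n) (Fin n) K, u⁻¹.1 * (u.1 * Z) = Z := fun Z => by
    rw [← mul_assoc, hui, one_mul]
  let adj : Subalgebra.centralizer K {A} → Subalgebra.centralizer K {A} := fun Y =>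
    ⟨u⁻¹.1 * (ct σ Y.1 * u.1), by
      rw [hmem]
      calc A * (u⁻¹.1 * (ct σ Y.1 * u.1)) = (A * u⁻¹.1) * (ct σ Y.1 * u.1) := by noncomm_ring
        _ = u⁻¹.1 * (ct σ A * ct σ Y.1 * u.1) := by rw [hcompi]; noncomm_ring
        _ = u⁻¹.1 * (ct σ Y.1 * (ct σ A * u.1)) := by rw [← ct_mul, ← hcY, ct_mul]; noncomm_ring
        _ = _ := by rw [← hcomp]; noncomm_ring⟩
  have hadj1 : ∀ Y, (adj Y).1 = u⁻¹.1 * (ct σ Y.1 * u.1) := fun Y => rfl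
  have hu1 : ∀ Y : Subalgebra.centralizer K {A}, IsUnit Y ↔ IsUnit Y.1 := fun Y =>
    ⟨fun h => h.map (Subalgebra.centralizer K {A}).val, centr_unit Y⟩
  have key := count_abs (R := Subalgebra.centralizer K {A}) (K := K) hσ hne
    ((phi (α := α) hF he hFe).comp (psiR φ hφ)) ((phi_surj hF he hFe).comp (psiR_surj φ hφ))
    (fun Y hY => unit_of_psi φ hφ Y (phi_inj_of_unit hF he hFe _ hY))
    (by
      intro t Y
      ext c a b
      change red F e he c (psi φ hφ (t • Y) (ee α F e ⟨c, b⟩) ⟨c, a⟩) =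
        t • red F e he c (psi φ hφ Y (ee α F e ⟨c, b⟩) ⟨c, a⟩)
      have h1 : psi φ hφ (t • Y) (ee α F e ⟨c, b⟩) = t • psi φ hφ Y (ee α F e ⟨c, b⟩) := by
        rw [psi_apply, psi_apply, ← map_smul, ← smul_mulVec]; rfl
      rw [h1, Pi.smul_apply]
      obtain ⟨r, hr⟩ := Ideal.Quotient.mk_surjective (psi φ hφ Y (ee α F e ⟨c, b⟩) ⟨c, a⟩)
      rw [← hr]
      rfl)
    adj
    (by intro x y; apply Subtype.ext
        change _ = (adj x).1 + (adj y).1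
        rw [hadj1, hadj1, hadj1]
        change u⁻¹.1 * (ct σ (x.1 + y.1) * u.1) = _
        rw [ct_add, add_mul, mul_add])
    (by intro x; apply Subtype.ext
        rw [hadj1, hadj1, ct_mul, ct_mul, hherm, hhermi, ct_ct hσ]
        calc u⁻¹.1 * (u.1 * x.1 * u⁻¹.1 * u.1) = (u⁻¹.1 * u.1) * x.1 * (u⁻¹.1 * u.1) := by noncomm_ring
          _ = x.1 := by rw [hui, one_mul, mul_one])
    (by intro t x; apply Subtype.ext
        change _ = σ t • (adj x).1
        rw [hadj1, hadj1]
        change u⁻¹.1 * (ct σ (t • x.1) * u.1) = _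
        rw [ct_smul, smul_mul_assoc, mul_smul_comm])
    (fun b c => ct (cj σ (F c) (hFσ c)) (b c))
    (by
      intro Y
      funext c
      ext a b
      rw [ct_apply]
      change red F e he c (psi φ hφ (adj Y) (ee α F e ⟨c, b⟩) ⟨c, a⟩) =
        cj σ (F c) (hFσ c) (red F e he c (psi φ hφ Y (ee α F e ⟨c, a⟩) ⟨c, b⟩))
      rw [← red_cj hFσ he, adj_entry hFσ hm hσ (psi φ hφ Y) (psi φ hφ (adj Y))]
      intro a b
      obtain ⟨v, rfl⟩ := φ.surjective a
      obtain ⟨w, rfl⟩ := φ.surjective b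
      rw [psi_phi, psi_phi, gram_form hFσ hm φ hσ, gram_form hFσ hm φ hσ, sig_mulVec, hadj1, ← hu,
        mulVec_mulVec, mulVec_mulVec, hcan])
  have e1 : Nat.card {Y : Subalgebra.centralizer K {A} // adj Y = Y ∧ IsUnit Y} = Hct σ A := by
    refine Nat.card_congr
      { toFun := fun Y => ⟨⟨u.1 * Y.1.1, ?_, ?_⟩, ?_⟩
        invFun := fun h => ⟨⟨u⁻¹.1 * h.1.1, ?_⟩, ?_, ?_⟩
        left_inv := ?_
        right_inv := ?_ }
    · have h := congrArg Subtype.val Y.2.1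
      rw [hadj1] at h
      rw [ct_mul, hherm]
      conv_rhs => rw [← h, hcan]
    · exact u.isUnit.mul ((hu1 _).mp Y.2.2)
    · change u.1 * Y.1.1 * A = ct σ A * (u.1 * Y.1.1)
      rw [mul_assoc, ← hcY, ← mul_assoc, hcomp, mul_assoc]
    · have h : h.1.1 * A = ct σ A * h.1.1 := h.2
      rw [hmem, ← mul_assoc, hcompi, mul_assoc, ← h, mul_assoc]
    · apply Subtype.ext
      rw [hadj1, ct_mul, hhermi, h.1.2.1, mul_assoc, hui, mul_one]
    · rw [hu1]; exact (u⁻¹).isUnit.mul h.1.2.2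
    · intro Y; apply Subtype.ext; apply Subtype.ext; exact hcan' _
    · intro Y; apply Subtype.ext; apply Subtype.ext; exact hcan _
  have e2 : Nat.card {Y : Subalgebra.centralizer K {A} // adj Y = Y} = Fct σ A := by
    refine Nat.card_congr
      { toFun := fun Y => ⟨⟨u.1 * Y.1.1, ?_⟩, ?_⟩
        invFun := fun h => ⟨⟨u⁻¹.1 * h.1.1, ?_⟩, ?_⟩
        left_inv := ?_
        right_inv := ?_ }
    · have h := congrArg Subtype.val Y.2
      rw [hadj1] at h
      rw [ct_mul, hherm]
      conv_rhs => rw [← h, hcan]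
    · change u.1 * Y.1.1 * A = ct σ A * (u.1 * Y.1.1)
      rw [mul_assoc, ← hcY, ← mul_assoc, hcomp, mul_assoc]
    · have h : h.1.1 * A = ct σ A * h.1.1 := h.2
      rw [hmem, ← mul_assoc, hcompi, mul_assoc, ← h, mul_assoc]
    · apply Subtype.ext
      rw [hadj1, ct_mul, hhermi, h.1.2, mul_assoc, hui, mul_one]
    · intro Y; apply Subtype.ext; apply Subtype.ext; exact hcan' _
    · intro Y; apply Subtype.ext; apply Subtype.ext; exact hcan _
  have e3 : Nat.card {Y : Subalgebra.centralizer K {A} // IsUnit Y} =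
      Nat.card {Y : Matrix (Fin n) (Fin n) K // A * Y = Y * A ∧ IsUnit Y} := by
    refine Nat.card_congr
      { toFun := fun Y => ⟨Y.1.1, hcY _, (hu1 _).mp Y.2⟩
        invFun := fun Y => ⟨⟨Y.1, (hmem _).mpr Y.2.1⟩, (hu1 _).mpr Y.2.2⟩
        left_inv := fun _ => rfl
        right_inv := fun _ => rfl }
  rw [e1, e2, e3] at key
  exact key

end conj
end model
end FFU


namespace FFU

/-- weight of an irreducible of degree `d` with multiplicity `m` -/
noncomputable def wt (z : ℝ) (d m : ℕ) : ℝ := ∏ j ∈ Finset.range m, (1 - z ^ ((j+1)*d))⁻¹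

section split
variable {κ E : Type*} [CommRing κ] [Field E] [Finite κ] [Finite E] (cjj : κ →+* κ) (π : κ →+* E)
  (hc : ∀ x, cjj (cjj x) = x) (hb : Function.Bijective (fun x => (π x, π (cjj x)))) (m : ℕ)

include hb in
theorem split_unit (x : κ) : IsUnit x ↔ IsUnit (π x) ∧ IsUnit (π (cjj x)) := by
  let Θ : κ ≃+* E × E := RingEquiv.ofBijective (π.prod (π.comp cjj)) hb
  rw [← MulEquiv.isUnit_map Θ, Prod.isUnit_iff]; rfl

include hb in
theorem split_unit_mat (M : Matrix (Fin m) (Fin m) κ) :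
    IsUnit M ↔ IsUnit (M.map π) ∧ IsUnit ((M.map cjj).map π) := by
  rw [isUnit_iff_isUnit_det, split_unit cjj π hb, isUnit_iff_isUnit_det, isUnit_iff_isUnit_det,
    RingHom.map_det, RingHom.map_det, RingHom.map_det]
  rfl

include hb in
theorem split_NU : Nat.card {M : Matrix (Fin m) (Fin m) κ // IsUnit M} =
    Nat.card {M : Matrix (Fin m) (Fin m) E // IsUnit M} ^ 2 := by
  obtain ⟨g, hg1, hg2⟩ := Function.bijective_iff_has_inverse.mp hb
  have hg3 : ∀ a b, π (g (a, b)) = a := fun a b => congrArg Prod.fst (hg2 (a, b))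
  have hg4 : ∀ a b, π (cjj (g (a, b))) = b := fun a b => congrArg Prod.snd (hg2 (a, b))
  rw [pow_two, ← Nat.card_prod]
  refine Nat.card_congr
    { toFun := fun M => (⟨M.1.map π, ((split_unit_mat cjj π hb m _).mp M.2).1⟩,
        ⟨(M.1.map cjj).map π, ((split_unit_mat cjj π hb m _).mp M.2).2⟩)
      invFun := fun P => ⟨Matrix.of fun i j => g (P.1.1 i j, P.2.1 i j), ?_⟩
      left_inv := ?_
      right_inv := ?_ }
  · rw [split_unit_mat cjj π hb]
    constructor
    · convert P.1.2 using 1; ext i j; simp [hg3]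
    · convert P.2.2 using 1; ext i j; simp [hg4]
  · intro M; apply Subtype.ext; ext i j; exact hg1 _
  · intro P; apply Prod.ext
    · apply Subtype.ext; ext i j; simp [hg3]
    · apply Subtype.ext; ext i j; simp [hg4]

include hc hb in
theorem split_NH (T : Matrix (Fin m) (Fin m) E → Prop) :
    Nat.card {M : Matrix (Fin m) (Fin m) κ // ct cjj M = M ∧ T (M.map π)} =
    Nat.card {M : Matrix (Fin m) (Fin m) E // T M} := by
  obtain ⟨g, hg1, hg2⟩ := Function.bijective_iff_has_inverse.mp hb
  have hg3 : ∀ a b, π (g (a, b)) = a := fun a b => congrArg Prod.fst (hg2 (a, b))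
  have hg4 : ∀ a b, π (cjj (g (a, b))) = b := fun a b => congrArg Prod.snd (hg2 (a, b))
  refine Nat.card_congr
    { toFun := fun M => ⟨M.1.map π, M.2.2⟩
      invFun := fun P => ⟨Matrix.of fun i j => g (P.1 i j, P.1 j i), ?_, ?_⟩
      left_inv := ?_
      right_inv := ?_ }
  · ext i j
    rw [ct_apply]
    apply hb.1
    simp only [Matrix.of_apply, hc, hg3, hg4]
  · convert P.2 using 1; ext i j; simp [hg3]
  · intro M; apply Subtype.ext; ext i j
    simp only [Matrix.of_apply, map_apply]
    apply hb.1
    simp only [hg3, hg4, Prod.mk.injEq, true_and]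
    have := congrFun (congrFun M.2.1 j) i
    rw [ct_apply] at this
    rw [this]
  · intro P; apply Subtype.ext; ext i j; simp [hg3]

theorem card_unit_eq_GL (R : Type*) [CommRing R] (m : ℕ) :
    Nat.card {M : Matrix (Fin m) (Fin m) R // IsUnit M} = Nat.card (GL (Fin m) R) := by
  refine Nat.card_congr (Equiv.ofBijective (fun M => M.2.unit) ⟨?_, ?_⟩)
  · intro M N h; apply Subtype.ext; exact congrArg Units.val h
  · intro u; exact ⟨⟨u.1, u.isUnit⟩, Units.ext rfl⟩

include hc hb in
theorem split_count {c : ℝ} (hcE : c = Nat.card E) {z : ℝ} {d : ℕ} (hz : z ^ d = 1/c) :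
    (Nat.card (Matrix (Fin m) (Fin m) κ) : ℝ) * Nat.card (HU cjj (Fin m)) =
    wt z d m * (Nat.card {M : Matrix (Fin m) (Fin m) κ // IsUnit M} * Nat.card (HM cjj (Fin m))) := by
  have h1 := split_NU cjj π hb m
  have h2 : Nat.card (HM cjj (Fin m)) = Nat.card (Matrix (Fin m) (Fin m) E) := by
    have := split_NH cjj π hc hb m (fun _ => True)
    rw [Nat.card_congr (Equiv.subtypeUnivEquiv fun _ => trivial)] at this
    rw [← this]
    exact Nat.card_congr (Equiv.subtypeEquivRight fun x => by simp)
  have h3 : Nat.card (HU cjj (Fin m)) = Nat.card {M : Matrix (Fin m) (Fin m) E // IsUnit M} := by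
    rw [← split_NH cjj π hc hb m]
    refine Nat.card_congr (Equiv.subtypeEquivRight fun x => ?_)
    refine and_congr_right fun hx => ?_
    rw [split_unit_mat cjj π hb]
    refine ⟨fun h => h.1, fun h => ⟨h, ?_⟩⟩
    have : (x.map cjj).map π = (x.map π)ᵀ := by
      conv_rhs => rw [← hx]
      rfl
    rw [this]
    rwa [isUnit_transpose]
  have h4 : Nat.card κ = Nat.card E ^ 2 := by
    rw [Nat.card_congr (Equiv.ofBijective _ hb), Nat.card_prod, pow_two]
  have hcm : ∀ (R : Type _) [Finite R], Nat.card (Matrix (Fin m) (Fin m) R) = Nat.card R ^ (m * m) := by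
    intro R _
    unfold Matrix
    rw [Nat.card_fun, Nat.card_fun, ← pow_mul]; simp
  have hcm' : ∀ (R : Type _) [Finite R], Nat.card (Matrix (Fin m) (Fin m) R) = Nat.card R ^ (m * m) := by
    intro R _
    unfold Matrix
    rw [Nat.card_fun, Nat.card_fun, ← pow_mul]; simp
  rw [h1, h2, h3, card_unit_eq_GL, hcm κ, hcm' E, h4]
  push_cast
  rw [card_GL_real E m hcE, ← hcE]
  have hc1 : 1 < c := by
    rw [hcE]; exact_mod_cast Finite.one_lt_card
  set P := ∏ i ∈ Finset.range m, (1 - (1 / c) ^ (i + 1)) with hP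
  have hw : wt z d m * P = 1 := by
    rw [wt, hP, ← Finset.prod_mul_distrib]
    apply Finset.prod_eq_one
    intro j _
    rw [mul_comm (j+1) d, pow_mul, hz]
    apply inv_mul_cancel₀
    have : (1/c)^(j+1) < 1 := by
      apply pow_lt_one₀ (by positivity) _ (by omega)
      rw [div_lt_one (by linarith)]; exact hc1
    linarith
  calc (c^2)^(m*m) * (c^(m*m) * P) = (c^(m*m))^2 * (c^(m*m) * P) * 1 := by ring
    _ = _ := by rw [← hw]; ring

end split

section inert
variable {E : Type*} [Field E] [Finite E] (cjj : E →+* E)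
  (hc : ∀ x, cjj (cjj x) = x) (hne : ∃ x, cjj x ≠ x) (m : ℕ)

include hc hne in
theorem inert_count {Q : ℝ} (hQ : Q = Nat.card {x // cjj x = x}) {z : ℝ} {d : ℕ} (hz : z ^ d = -1/Q) :
    (Nat.card (Matrix (Fin m) (Fin m) E) : ℝ) * Nat.card (HU cjj (Fin m)) =
    wt z d m * (Nat.card {M : Matrix (Fin m) (Fin m) E // IsUnit M} * Nat.card (HM cjj (Fin m))) := by
  have hQ1 : 1 < Q := by rw [hQ]; exact_mod_cast fix_card_gt hc hne
  have hE : (Nat.card E : ℝ) = Q^2 := by rw [card_eq_fix_sq hc hne, hQ]; push_cast; rfl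
  have hM : Nat.card (Matrix (Fin m) (Fin m) E) = Nat.card E ^ (m * m) := by
    unfold Matrix
    rw [Nat.card_fun, Nat.card_fun, ← pow_mul]; simp
  have hM2 := card_semilin hc hne (V := Matrix (Fin m) (Fin m) E) (ct cjj) ct_add (ct_ct hc) ct_smul
  have hH : (Nat.card (HM cjj (Fin m)) : ℝ) = Q^(m*m) := by
    have h1 : (Nat.card (HM cjj (Fin m)) : ℝ)^2 = (Q^(m*m))^2 := by
      rw [← pow_mul, mul_comm (m*m) 2, pow_mul, ← hE]
      exact_mod_cast hM2.symm.trans hM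
    exact (pow_left_inj₀ (by positivity) (by positivity) two_ne_zero).mp h1
  rw [card_unit_eq_GL, hM, hH, card_HU_real hc hne m hQ, card_GL_real E m hE.symm]
  push_cast
  rw [hE]
  have hw : wt z d m * ∏ i ∈ Finset.range m, (1 - (1 / Q^2) ^ (i + 1)) =
      ∏ i ∈ Finset.range m, (1 + (-1 / Q) ^ (i + 1)) := by
    rw [wt, ← Finset.prod_mul_distrib]
    refine Finset.prod_congr rfl fun j _ => ?_
    rw [mul_comm (j+1) d, pow_mul, hz]
    have h1 : (1 / Q^2) ^ (j+1) = ((-1/Q)^(j+1))^2 := by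
      rw [← pow_mul, mul_comm (j+1) 2, pow_mul]; congr 1; rw [div_pow]; norm_num
    have h2 : (1 - (-1/Q)^(j+1)) ≠ 0 := by
      have : |(-1/Q)^(j+1)| < 1 := by
        rw [abs_pow]
        apply pow_lt_one₀ (abs_nonneg _) _ (by omega)
        rw [abs_div, abs_neg, abs_one, abs_of_pos (by linarith), div_lt_one (by linarith)]; exact hQ1
      have := (abs_lt.mp this).2
      linarith
    rw [h1, inv_mul_eq_iff_eq_mul₀ h2]; ring
  rw [← hw]; ring

end inert


section poly
open Polynomial
variable {k K : Type*} [Field k] [Field K] (i : k →+* K) {σ : K →+* K} (hσ : ∀ x, σ (σ x) = x)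
  (hi : ∀ x, σ x = x ↔ ∃ y, i y = x)

include hi in
theorem map_fix (f : k[X]) : (f.map i).map σ = f.map i := by
  rw [Polynomial.map_map]
  congr 1
  ext x; exact (hi _).mpr ⟨x, rfl⟩

include hi in
theorem exists_lift {p : K[X]} (hp : p.map σ = p) : ∃ r : k[X], r.map i = p := by
  have : p ∈ lifts i := by
    rw [lifts_iff_coeff_lifts]
    intro n
    have := congrArg (fun r => r.coeff n) hp
    simp only [coeff_map] at this
    exact (hi _).mp this
  exact (mem_lifts _).mp this

include hσ in
theorem map_map_sig (p : K[X]) : (p.map σ).map σ = p := by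
  rw [Polynomial.map_map]
  ext n; simp [hσ]

/-- the coefficientwise conjugation as ring equiv -/
noncomputable def sigE (hσ : ∀ x, σ (σ x) = x) : K[X] ≃+* K[X] :=
  RingEquiv.ofRingHom (mapRingHom σ) (mapRingHom σ) (by apply RingHom.ext; intro p; exact map_map_sig hσ p)
    (by apply RingHom.ext; intro p; exact map_map_sig hσ p)

include hσ in
theorem irr_sig {p : K[X]} (hp : Irreducible p) : Irreducible (p.map σ) :=
  (MulEquiv.irreducible_iff (sigE hσ)).mpr hp

include hσ hi in
theorem dichotomy {f : k[X]} (hf : f.Monic) (hirr : Irreducible f) :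
    Irreducible (f.map i) ∨ ∃ p : K[X], p.Monic ∧ Irreducible p ∧ IsCoprime p (p.map σ) ∧ f.map i = p * p.map σ := by
  have hnu : ¬ IsUnit (f.map i) := by
    intro h
    have h1 := natDegree_eq_zero_of_isUnit h
    rw [natDegree_map] at h1
    have := hirr.natDegree_pos
    omega
  obtain ⟨p, hpm, hp, hpd⟩ := exists_monic_irreducible_factor (f.map i) hnu
  have key : ∀ r : k[X], r.Monic → r ≠ 1 → r.map i ∣ f.map i → r = f := by
    intro r hr hr1 hd
    have h1 : r ∣ f := (Polynomial.map_dvd_map' i).mp hd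
    obtain ⟨t, ht⟩ := h1
    rcases hirr.isUnit_or_isUnit ht with h | h
    · exact absurd (hr.isUnit_iff.mp h) hr1
    · exact eq_of_monic_of_associated hr hf ⟨h.unit, by simp [ht]⟩
  have hlm : ∀ r : k[X], (r.map i).Monic → r.Monic := by
    intro r hr; exact Polynomial.monic_of_injective i.injective hr
  by_cases h : p.map σ = p
  · left
    obtain ⟨r, rfl⟩ := exists_lift i hi h
    rw [← key r (hlm r hpm) (by rintro rfl; simp at hp) hpd]
    exact hp
  · right
    have hp' := irr_sig hσ hp
    have hpm' : (p.map σ).Monic := hpm.map σ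
    have hcop : IsCoprime p (p.map σ) := by
      rcases (EuclideanDomain.dvd_or_coprime p (p.map σ) hp).symm with h1 | h1
      · exact h1
      · exact absurd (eq_of_monic_of_associated hpm hpm' (hp.associated_of_dvd hp' h1)).symm h
    have hpd' : p.map σ ∣ f.map i := by
      have := Polynomial.map_dvd σ hpd
      rwa [map_fix i hi] at this
    have hpp : (p * p.map σ).map σ = p * p.map σ := by
      rw [Polynomial.map_mul, map_map_sig hσ, mul_comm]
    obtain ⟨r, hr⟩ := exists_lift i hi hpp
    refine ⟨p, hpm, hp, hcop, ?_⟩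
    rw [← hr]
    rw [key r (hlm r (hr ▸ hpm.mul hpm')) ?_ (hr ▸ hcop.mul_dvd hpd hpd')]
    rintro rfl
    rw [Polynomial.map_one] at hr
    exact hp.not_isUnit (IsUnit.of_mul_eq_one _ hr.symm)

theorem card_quot [Finite K] {g : K[X]} (hg : g.Monic) :
    Nat.card (K[X] ⧸ Ideal.span {g}) = Nat.card K ^ g.natDegree := by
  have := hg.finite_adjoinRoot
  have h := Module.natCard_eq_pow_finrank (K := K) (V := AdjoinRoot g)
  rw [(AdjoinRoot.powerBasis' hg).finrank] at h
  exact h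

include hi in
theorem card_fix : Nat.card {x : K // σ x = x} = Nat.card k := by
  symm
  refine Nat.card_congr (Equiv.ofBijective (fun y => ⟨i y, (hi _).mpr ⟨y, rfl⟩⟩) ⟨?_, ?_⟩)
  · intro a b h; exact i.injective (congrArg Subtype.val h)
  · rintro ⟨x, hx⟩; obtain ⟨y, hy⟩ := (hi x).mp hx; exact ⟨y, Subtype.ext hy⟩

/-- degree parity in the inert case -/
theorem inert_odd {E : Type*} [Field E] [Finite E] (cjj : E →+* E) (j : K →+* E) [Finite K]
    (hσ : ∀ x, σ (σ x) = x) (hne : ∃ x, σ x ≠ x) (hj : ∀ x, cjj (j x) = j (σ x)) {d : ℕ}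
    (hfix : Nat.card {x // cjj x = x} = Nat.card {x : K // σ x = x} ^ d) : Odd d := by
  classical
  rw [← Nat.not_even_iff_odd]
  rintro ⟨a, rfl⟩
  obtain ⟨x, hx⟩ := hne
  set q := Nat.card {x : K // σ x = x} with hq
  have hK : Nat.card K = q^2 := card_eq_fix_sq hσ ⟨x, hx⟩
  set Q := Nat.card {x // cjj x = x} with hQ
  let S : Subfield E := cjj.eqLocusField (RingHom.id E)
  have hS : ∀ y, y ∈ S ↔ cjj y = y := fun y => Iff.rfl
  have hSc : Nat.card S = Q := Nat.card_congr (Equiv.subtypeEquivRight hS)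
  have hQ1 : 1 < Q := by rw [← hSc]; exact Finite.one_lt_card
  have hpow : ∀ y, cjj y = y → y ^ Q = y := by
    intro y hy
    have := Fintype.ofFinite S
    have h := FiniteField.pow_card (⟨y, hy⟩ : S)
    rw [← Nat.card_eq_fintype_card, hSc] at h
    exact congrArg Subtype.val h
  have hjx : (j x)^Q = j x := by
    rw [← map_pow]; congr 1
    have := Fintype.ofFinite K
    have h := FiniteField.pow_card x
    rw [← Nat.card_eq_fintype_card, hK] at h
    rw [hfix, show a + a = 2 * a by ring, pow_mul]
    have hh : ∀ b, x ^ ((q^2)^b) = x := by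
      intro b
      induction b with
      | zero => simp
      | succ b ih => rw [pow_succ, pow_mul, ih, h]
    exact hh a
  have hne0 : (X ^ Q - X : E[X]) ≠ 0 := FiniteField.X_pow_card_sub_X_ne_zero E hQ1
  have := Fintype.ofFinite E
  let T : Finset E := Finset.univ.filter fun y => cjj y = y
  have hT : T.card = Q := by
    rw [hQ, Nat.card_eq_fintype_card, Fintype.card_subtype]
  have hsub : insert (j x) T ⊆ (X ^ Q - X : E[X]).roots.toFinset := by
    intro y hy
    rw [Multiset.mem_toFinset, mem_roots hne0]
    have : y ^ Q = y := by
      rcases Finset.mem_insert.mp hy with rfl | h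
      · exact hjx
      · exact hpow y (Finset.mem_filter.mp h).2
    simp [this]
  have hcard := Finset.card_le_card hsub
  rw [Finset.card_insert_of_notMem, hT] at hcard
  · have h1 := Multiset.toFinset_card_le (X ^ Q - X : E[X]).roots
    have h2 := card_roots' (X ^ Q - X : E[X])
    rw [FiniteField.X_pow_card_sub_X_natDegree_eq E hQ1] at h2
    omega
  · intro h
    have h := (Finset.mem_filter.mp h).2
    rw [hj] at h
    exact hx (j.injective h)

theorem inert_ring {κ : Type*} [CommRing κ] [Finite κ] (hf : IsField κ) (cjj : κ →+* κ) (j : K →+* κ) [Finite K]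
    (hσ : ∀ x, σ (σ x) = x) (hne : ∃ x, σ x ≠ x) (hc : ∀ x, cjj (cjj x) = x) (hj : ∀ x, cjj (j x) = j (σ x)) {d : ℕ}
    (hcard : Nat.card κ = Nat.card K ^ d) {q : ℝ} (hq : q = Nat.card {x : K // σ x = x}) (m : ℕ) :
    (Nat.card (Matrix (Fin m) (Fin m) κ) : ℝ) * Nat.card (HU cjj (Fin m)) =
    wt (-1/q) d m * (Nat.card {M : Matrix (Fin m) (Fin m) κ // IsUnit M} * Nat.card (HM cjj (Fin m))) := by
  letI : Field κ := hf.toField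
  have hne' : ∃ x, cjj x ≠ x := by
    obtain ⟨x, hx⟩ := hne
    refine ⟨j x, fun h => hx ?_⟩
    rw [hj] at h; exact j.injective h
  have h1 := card_eq_fix_sq hc hne'
  rw [hcard, card_eq_fix_sq hσ hne, ← pow_mul, mul_comm, pow_mul] at h1
  have h2 := (Nat.pow_left_injective two_ne_zero h1).symm
  have hodd := inert_odd cjj j hσ hne hj h2
  refine inert_count cjj hc hne' m rfl ?_
  rw [h2, div_pow, hodd.neg_one_pow, hq]; push_cast; rfl

include hσ hi in
theorem wcount [Finite K] (hne : ∃ x, σ x ≠ x) {q : ℝ} (hq : q = Nat.card k) {f : k[X]} (hf : f.Monic)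
    (hirr : Irreducible f) (hfix : (f.map i).map σ = f.map i) (m : ℕ) :
    (Nat.card (Matrix (Fin m) (Fin m) (K[X] ⧸ Ideal.span {f.map i})) : ℝ) *
      Nat.card (HU (cj σ (f.map i) hfix) (Fin m)) =
    wt (-1/q) f.natDegree m * (Nat.card {M : Matrix (Fin m) (Fin m) (K[X] ⧸ Ideal.span {f.map i}) // IsUnit M} *
      Nat.card (HM (cj σ (f.map i) hfix) (Fin m))) := by
  have hm : (f.map i).Monic := hf.map i
  have := finite_quot hm
  have hcard := card_quot hm
  rw [natDegree_map] at hcard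
  have hq' : q = Nat.card {x : K // σ x = x} := by rw [card_fix i hi, hq]
  rcases dichotomy i hσ hi hf hirr with h | ⟨p, hpm, hp, hcop, hpp⟩
  · have hmax : (Ideal.span {f.map i}).IsMaximal := PrincipalIdealRing.isMaximal_of_irreducible h
    refine inert_ring ((Ideal.Quotient.maximal_ideal_iff_isField_quotient _).mp hmax) _
      ((Ideal.Quotient.mk _).comp C) hσ hne (cj_cj hσ hfix) ?_ hcard hq' m
    intro x
    simp only [RingHom.comp_apply]
    rw [cj_mk, Polynomial.map_C]
  · have hmax : (Ideal.span {p}).IsMaximal := PrincipalIdealRing.isMaximal_of_irreducible hp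
    letI : Field (K[X] ⧸ Ideal.span {p}) := Ideal.Quotient.field _
    have := finite_quot hpm
    have hd : f.natDegree = p.natDegree + p.natDegree := by
      have := congrArg natDegree hpp
      rwa [natDegree_map, hpm.natDegree_mul (hpm.map σ), natDegree_map] at this
    have hcp := card_quot hpm
    let π : K[X] ⧸ Ideal.span {f.map i} →+* K[X] ⧸ Ideal.span {p} :=
      Ideal.Quotient.factor (by
        rw [Ideal.span_singleton_le_span_singleton, hpp]; exact dvd_mul_right _ _)
    have hπ : ∀ r, π (Ideal.Quotient.mk _ r) = Ideal.Quotient.mk _ r := fun r => Ideal.Quotient.factor_mk _ r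
    refine split_count (cj σ (f.map i) hfix) π (cj_cj hσ hfix) ?_ m rfl ?_
    · have hinj : Function.Injective (fun x => (π x, π (cj σ (f.map i) hfix x))) := by
        have : Function.Injective (π.prod (π.comp (cj σ (f.map i) hfix))) := by
          rw [injective_iff_map_eq_zero]
          intro x hx
          obtain ⟨r, rfl⟩ := Ideal.Quotient.mk_surjective x
          have h1 : π (Ideal.Quotient.mk _ r) = 0 := congrArg Prod.fst hx
          have h2 : π (cj σ (f.map i) hfix (Ideal.Quotient.mk _ r)) = 0 := congrArg Prod.snd hx
          rw [cj_mk] at h2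
          rw [hπ, Ideal.Quotient.eq_zero_iff_mem, Ideal.mem_span_singleton] at h1 h2
          have h3 := Polynomial.map_dvd σ h2
          rw [map_map_sig hσ] at h3
          rw [Ideal.Quotient.eq_zero_iff_mem, Ideal.mem_span_singleton, hpp]
          exact hcop.mul_dvd h1 h3
        exact this
      refine (Nat.bijective_iff_injective_and_card _).mpr ⟨hinj, ?_⟩
      rw [Nat.card_prod, hcard, hcp, hd, pow_add]
    · rw [hcp, hd, div_pow, card_eq_fix_sq hσ hne, hq', ← two_mul, pow_mul (-1:ℝ), neg_one_sq, one_pow, pow_mul]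
      push_cast; rfl

end poly
end FFU


namespace FFU
section types
open Polynomial
open scoped Classical
variable {k K : Type*} [Field k] [Field K] (i : k →+* K) {σ : K →+* K} (hσ : ∀ x, σ (σ x) = x)
  (hi : ∀ x, σ x = x ↔ ∃ y, i y = x)

/-- index type of blocks -/
abbrev TC (T : Multiset (k[X] × ℕ)) : Type _ := {c : k[X] × ℕ // c ∈ T.toFinset}
/-- multiplicity spaces -/
abbrev TA (T : Multiset (k[X] × ℕ)) (c : TC T) : Type := Fin (T.count c.1)
/-- base polynomials -/
noncomputable abbrev TF (T : Multiset (k[X] × ℕ)) (c : TC T) : K[X] := c.1.1.map i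
/-- exponents -/
abbrev TE (T : Multiset (k[X] × ℕ)) (c : TC T) : ℕ := c.1.2 + 1

/-- admissible types -/
def Adm (T : Multiset (k[X] × ℕ)) : Prop := ∀ c ∈ T, c.1.Monic ∧ Irreducible c.1

/-- model module of a type -/
abbrev TM (T : Multiset (k[X] × ℕ)) : Type _ := MM (TA T) (TF i T) (TE T)

/-- `A` has type `T` -/
def IsoT {n : ℕ} (A : Matrix (Fin n) (Fin n) K) (T : Multiset (k[X] × ℕ)) : Prop :=
  ∃ φ : (Fin n → K) ≃ₗ[K] TM i T, ∀ v, φ (A *ᵥ v) = (X : K[X]) • φ v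

variable {T : Multiset (k[X] × ℕ)} (hT : Adm T)

include hT
theorem Adm.mem (c : TC T) : c.1.1.Monic ∧ Irreducible c.1.1 := hT c.1 (Multiset.mem_toFinset.mp c.2)

theorem TF_monic (c : TC T) : (TF i T c).Monic := (hT.mem c).1.map i

theorem TF_ne (c c' : TC T) (h : c ≠ c') : IsCoprime (TF i T c) (TF i T c') ∨
    (TF i T c = TF i T c' ∧ TE T c ≠ TE T c') := by
  by_cases hf : c.1.1 = c'.1.1
  · right
    refine ⟨by unfold TF; rw [hf], fun he => h ?_⟩
    apply Subtype.ext
    apply Prod.ext hf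
    simpa using he
  · left
    have h1 := hT.mem c
    have h2 := hT.mem c'
    have : IsCoprime c.1.1 c'.1.1 := by
      rcases h1.2.isCoprime_or_dvd c'.1.1 with h3 | h3
      · exact h3
      · exact absurd (eq_of_monic_of_associated h1.1 h2.1 (h1.2.associated_of_dvd h2.2 h3)) hf
    exact this.map (mapRingHom i)

include hσ hi in
theorem HF_eq [Finite K] (hne : ∃ x, σ x ≠ x) {q : ℝ} (hq : q = Nat.card k) {n : ℕ}
    {A : Matrix (Fin n) (Fin n) K} (hA : IsoT i A T) :
    (Hct σ A * Fct σ A : ℝ) = Nat.card {Y : Matrix (Fin n) (Fin n) K // A * Y = Y * A ∧ IsUnit Y} *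
      ∏ c ∈ T.toFinset, wt (-1/q) c.1.natDegree (T.count c) := by
  obtain ⟨φ, hφ⟩ := hA
  have hFσ : ∀ c : TC T, (TF i T c).map σ = TF i T c := fun c => map_fix i hi _
  have key := count_model hFσ (TF_monic i hT) φ hφ hσ hne (fun c => Nat.le_add_left 1 _) (TF_ne i hT)
  have hfin : ∀ c : TC T, Finite (KK (TF i T) c) := fun c => finite_quot (TF_monic i hT c)
  have e1 : Nat.card {b : ∀ c, Matrix (TA T c) (TA T c) (KK (TF i T) c) // IsUnit b} =
      ∏ c, Nat.card {b : Matrix (TA T c) (TA T c) (KK (TF i T) c) // IsUnit b} := by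
    rw [← Nat.card_pi]
    exact Nat.card_congr ((Equiv.subtypeEquivRight fun b => Pi.isUnit_iff).trans Equiv.subtypePiEquivPi)
  have e2 : Nat.card {b : ∀ c, Matrix (TA T c) (TA T c) (KK (TF i T) c) //
        (fun c => ct (cj σ (TF i T c) (hFσ c)) (b c)) = b} =
      ∏ c, Nat.card (HM (cj σ (TF i T c) (hFσ c)) (TA T c)) := by
    rw [← Nat.card_pi]
    exact Nat.card_congr ((Equiv.subtypeEquivRight fun b => funext_iff).trans
      (Equiv.subtypePiEquivPi (p := fun (c : TC T) b => ct (cj σ (TF i T c) (hFσ c)) b = b)))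
  have e3 : Nat.card {b : ∀ c, Matrix (TA T c) (TA T c) (KK (TF i T) c) //
        (fun c => ct (cj σ (TF i T c) (hFσ c)) (b c)) = b ∧ IsUnit b} =
      ∏ c, Nat.card (HU (cj σ (TF i T c) (hFσ c)) (TA T c)) := by
    rw [← Nat.card_pi]
    refine Nat.card_congr ((Equiv.subtypeEquivRight fun b => ?_).trans Equiv.subtypePiEquivPi)
    rw [funext_iff, Pi.isUnit_iff, forall_and]
  rw [e1, e2, e3, Nat.card_pi] at key
  have key' : (Hct σ A * Fct σ A : ℝ) * (∏ c, (Nat.card {b : Matrix (TA T c) (TA T c) (KK (TF i T) c) // IsUnit b} *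
       Nat.card (HM (cj σ (TF i T c) (hFσ c)) (TA T c)) : ℝ)) =
      Nat.card {Y : Matrix (Fin n) (Fin n) K // A * Y = Y * A ∧ IsUnit Y} *
       ∏ c, (Nat.card (Matrix (TA T c) (TA T c) (KK (TF i T) c)) *
        Nat.card (HU (cj σ (TF i T c) (hFσ c)) (TA T c)) : ℝ) := by
    rw [Finset.prod_mul_distrib, Finset.prod_mul_distrib]
    exact_mod_cast key
  have hw : ∀ c : TC T, (Nat.card (Matrix (TA T c) (TA T c) (KK (TF i T) c)) *
        Nat.card (HU (cj σ (TF i T c) (hFσ c)) (TA T c)) : ℝ) =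
      wt (-1/q) c.1.1.natDegree (T.count c.1) *
       (Nat.card {b : Matrix (TA T c) (TA T c) (KK (TF i T) c) // IsUnit b} *
       Nat.card (HM (cj σ (TF i T c) (hFσ c)) (TA T c))) := fun c =>
    wcount i hσ hi hne hq (hT.mem c).1 (hT.mem c).2 _ _
  simp_rw [hw] at key'
  rw [Finset.prod_mul_distrib (f := fun c : TC T => wt (-1/q) c.1.1.natDegree (T.count c.1)),
    ← mul_assoc (Nat.card {Y : Matrix (Fin n) (Fin n) K // A * Y = Y * A ∧ IsUnit Y} : ℝ)] at key'
  have hpos : (∏ c, (Nat.card {b : Matrix (TA T c) (TA T c) (KK (TF i T) c) // IsUnit b} *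
       Nat.card (HM (cj σ (TF i T c) (hFσ c)) (TA T c)) : ℝ)) ≠ 0 := by
    rw [Finset.prod_ne_zero_iff]
    intro c _
    have : Nonempty {b : Matrix (TA T c) (TA T c) (KK (TF i T) c) // IsUnit b} := ⟨⟨1, isUnit_one⟩⟩
    have : Nonempty (HM (cj σ (TF i T c) (hFσ c)) (TA T c)) := ⟨⟨0, ct_zero⟩⟩
    have h1 : 0 < Nat.card {b : Matrix (TA T c) (TA T c) (KK (TF i T) c) // IsUnit b} := Nat.card_pos
    have h2 : 0 < Nat.card (HM (cj σ (TF i T c) (hFσ c)) (TA T c)) := Nat.card_pos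
    positivity
  refine (mul_right_cancel₀ hpos key').trans ?_
  congr 1
  exact (Finset.prod_coe_sort T.toFinset fun c => wt (-1/q) c.1.natDegree (T.count c))

/-- dimension of the model -/
theorem TM_card [Finite K] : Nat.card (TM i T) = Nat.card K ^ (T.map fun c => (c.2 + 1) * c.1.natDegree).sum := by
  have hfin : ∀ c : TC T, Finite (OO (TF i T) (TE T) c) := fun c => finite_quot ((TF_monic i hT c).pow _)
  have h1 : ∀ c : TC T, Nat.card (OO (TF i T) (TE T) c) = Nat.card K ^ ((c.1.2 + 1) * c.1.1.natDegree) := by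
    intro c
    have := card_quot ((TF_monic i hT c).pow (TE T c))
    rw [(TF_monic i hT c).natDegree_pow, natDegree_map] at this
    exact this
  rw [Nat.card_pi, Fintype.prod_sigma]
  simp only [h1, Finset.prod_const, Finset.card_univ, Fintype.card_fin, ← pow_mul]
  rw [Finset.prod_pow_eq_pow_sum]
  congr 1
  rw [Finset.sum_multiset_map_count]
  exact (Finset.sum_congr rfl fun c _ => by rw [smul_eq_mul, mul_comm]).trans
    (Finset.sum_coe_sort T.toFinset (fun c => T.count c • ((c.2+1)*c.1.natDegree)))

theorem exists_IsoT [Finite K] {n : ℕ} (hn : (T.map fun c => (c.2 + 1) * c.1.natDegree).sum = n) :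
    ∃ A : Matrix (Fin n) (Fin n) K, IsoT i A T := by
  have hfin : ∀ c : TC T, Finite (OO (TF i T) (TE T) c) := fun c => finite_quot ((TF_monic i hT c).pow _)
  have hc := TM_card i hT (K := K)
  rw [hn] at hc
  have : Finite (TM i T) := inferInstance
  have h2 := Module.natCard_eq_pow_finrank (K := K) (V := TM i T)
  rw [hc] at h2
  have h3 := Nat.pow_right_injective Finite.one_lt_card h2
  have h4 : Module.finrank K (Fin n → K) = Module.finrank K (TM i T) := by rw [← h3]; simp
  let φ := LinearEquiv.ofFinrankEq (R := K) (Fin n → K) (TM i T) h4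
  let L : TM i T →ₗ[K] TM i T :=
    { toFun := fun v => (X : K[X]) • v
      map_add' := by intro a b; rw [smul_add]
      map_smul' := by intro a b; simp only [RingHom.id_apply]; rw [smul_comm] }
  refine ⟨LinearMap.toMatrix' (φ.symm.toLinearMap ∘ₗ L ∘ₗ φ.toLinearMap), φ, ?_⟩
  intro v
  rw [LinearMap.toMatrix'_mulVec]
  simp only [LinearMap.comp_apply, LinearEquiv.coe_coe, LinearEquiv.apply_symm_apply]
  rfl

omit hT in
theorem IsoT_conj {n : ℕ} {A A' : Matrix (Fin n) (Fin n) K} (h : IsoT i A T) (h' : IsoT i A' T) :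
    ∃ g : GL (Fin n) K, g.1 * A = A' * g.1 := by
  obtain ⟨φ, hφ⟩ := h
  obtain ⟨φ', hφ'⟩ := h'
  let Φ := φ.trans φ'.symm
  have hΦ : ∀ v, Φ (A *ᵥ v) = A' *ᵥ Φ v := by
    intro v
    simp only [Φ, LinearEquiv.trans_apply]
    rw [hφ, phi_symm φ' hφ']
  have hu : IsUnit (LinearMap.toMatrix' Φ.toLinearMap) := by
    rw [← Matrix.mulVec_injective_iff_isUnit]
    intro v w h
    rw [LinearMap.toMatrix'_mulVec, LinearMap.toMatrix'_mulVec] at h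
    exact Φ.injective h
  refine ⟨hu.unit, ?_⟩
  apply Matrix.ext_of_mulVec_single
  intro j
  rw [← mulVec_mulVec, ← mulVec_mulVec]
  change LinearMap.toMatrix' Φ.toLinearMap *ᵥ _ = A' *ᵥ (LinearMap.toMatrix' Φ.toLinearMap *ᵥ _)
  rw [LinearMap.toMatrix'_mulVec, LinearMap.toMatrix'_mulVec]
  exact hΦ _

omit hT in
theorem conj_IsoT {n : ℕ} {A A' : Matrix (Fin n) (Fin n) K} (h : IsoT i A T) (g : GL (Fin n) K)
    (hg : g.1 * A = A' * g.1) : IsoT i A' T := by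
  obtain ⟨φ, hφ⟩ := h
  let Γ : (Fin n → K) ≃ₗ[K] (Fin n → K) :=
    { Matrix.mulVecLin g⁻¹.1 with
      invFun := fun v => g.1 *ᵥ v
      left_inv := by
        intro v
        change g.1 *ᵥ (g⁻¹.1 *ᵥ v) = v
        rw [mulVec_mulVec, g.mul_inv, one_mulVec]
      right_inv := by
        intro v
        change g⁻¹.1 *ᵥ (g.1 *ᵥ v) = v
        rw [mulVec_mulVec, g.inv_mul, one_mulVec] }
  have hΓ : ∀ v, Γ v = g⁻¹.1 *ᵥ v := fun v => rfl
  refine ⟨Γ.trans φ, fun v => ?_⟩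
  simp only [LinearEquiv.trans_apply, hΓ]
  rw [← hφ, mulVec_mulVec, mulVec_mulVec]
  congr 2
  calc g⁻¹.1 * A' = g⁻¹.1 * (A' * g.1) * g⁻¹.1 := by
        rw [mul_assoc, mul_assoc, g.mul_inv, mul_one]
    _ = A * g⁻¹.1 := by rw [← hg, ← mul_assoc, g.inv_mul, one_mul]

/-- orbit-stabilizer -/
theorem orbit_sum [Fintype K] {n : ℕ} (hn : (T.map fun c => (c.2 + 1) * c.1.natDegree).sum = n) :
    ∑ A : Matrix (Fin n) (Fin n) K, (if IsoT i A T then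
      Nat.card {Y : Matrix (Fin n) (Fin n) K // A * Y = Y * A ∧ IsUnit Y} else 0) = Nat.card (GL (Fin n) K) := by
  obtain ⟨A₀, hA₀⟩ := exists_IsoT i hT (K := K) hn
  rw [card_sum_fibers (fun g : GL (Fin n) K => g.1 * A₀ * g⁻¹.1)]
  refine Finset.sum_congr rfl fun A _ => ?_
  have hiff : ∀ g : GL (Fin n) K, g.1 * A₀ * g⁻¹.1 = A ↔ g.1 * A₀ = A * g.1 := by
    intro g
    constructor
    · rintro rfl; rw [mul_assoc, g.inv_mul, mul_one]
    · intro h; rw [h, mul_assoc, g.mul_inv, mul_one]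
  split_ifs with h
  · obtain ⟨g₀, hg₀⟩ := IsoT_conj i hA₀ h
    symm
    refine Nat.card_congr
      { toFun := fun g => ⟨(g.1 * g₀⁻¹).1, ?_, (g.1 * g₀⁻¹).isUnit⟩
        invFun := fun Y => ⟨Y.2.2.unit * g₀, ?_⟩
        left_inv := ?_
        right_inv := ?_ }
    · have h1 := (hiff g.1).mp g.2
      have h2 : A₀ * g₀⁻¹.1 = g₀⁻¹.1 * A := by
        calc A₀ * g₀⁻¹.1 = g₀⁻¹.1 * (g₀.1 * A₀) * g₀⁻¹.1 := by rw [← mul_assoc, g₀.inv_mul, one_mul]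
          _ = g₀⁻¹.1 * A * (g₀.1 * g₀⁻¹.1) := by rw [hg₀]; noncomm_ring
          _ = _ := by rw [g₀.mul_inv, mul_one]
      rw [Units.val_mul, ← mul_assoc, ← h1, mul_assoc, h2, mul_assoc]
    · rw [hiff, Units.val_mul]
      change Y.1 * g₀.1 * A₀ = A * (Y.1 * g₀.1)
      rw [mul_assoc, hg₀, ← mul_assoc, ← Y.2.1, mul_assoc]
    · intro g; apply Subtype.ext; apply Units.ext
      change (g.1 * g₀⁻¹).1 * g₀.1 = g.1.1
      rw [← Units.val_mul, inv_mul_cancel_right]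
    · intro Y; apply Subtype.ext
      change (Y.2.2.unit * g₀ * g₀⁻¹).1 = Y.1
      rw [mul_inv_cancel_right]; rfl
  · symm
    rw [Nat.card_eq_zero]
    left
    constructor
    rintro ⟨g, hg⟩
    exact h (conj_IsoT i hA₀ g ((hiff g).mp hg))

end types
end FFU


namespace FFU
section uniq
open Polynomial
open scoped Classical
variable {k K : Type*} [Field k] [Field K] (i : k →+* K)

theorem ker_coprime {F G : K[X]} (h : IsCoprime F G) (e j : ℕ) :
    Nat.card {x : K[X] ⧸ Ideal.span {G ^ e} // F ^ j • x = 0} = 1 := by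
  rw [Nat.card_eq_one_iff_unique]
  refine ⟨⟨?_⟩, ⟨⟨0, smul_zero _⟩⟩⟩
  have key : ∀ x : K[X] ⧸ Ideal.span {G ^ e}, F ^ j • x = 0 → x = 0 := by
    intro x hx
    obtain ⟨r, rfl⟩ := Ideal.Quotient.mk_surjective x
    change Ideal.Quotient.mk _ (F ^ j * r) = 0 at hx
    rw [Ideal.Quotient.eq_zero_iff_mem, Ideal.mem_span_singleton] at hx ⊢
    exact (IsCoprime.pow h.symm).dvd_of_dvd_mul_left hx
  rintro ⟨x, hx⟩ ⟨y, hy⟩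
  apply Subtype.ext
  change x = y
  rw [key x hx, key y hy]

theorem ker_same [Finite K] {F : K[X]} (hF : F.Monic) (e j : ℕ) :
    Nat.card {x : K[X] ⧸ Ideal.span {F ^ e} // F ^ j • x = 0} = Nat.card K ^ (min j e * F.natDegree) := by
  obtain ⟨m, d, hmd, hm, hd⟩ : ∃ m d, m + d = e ∧ m = min j e ∧ (d = 0 ∨ j = m) :=
    ⟨min j e, e - min j e, by omega, rfl, by omega⟩
  rw [← hm, ← hF.natDegree_pow, ← card_quot (hF.pow m)]
  symm
  have hF0 : F ≠ 0 := hF.ne_zero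
  have hout : ∀ x : K[X] ⧸ Ideal.span {F ^ m}, Ideal.Quotient.mk _ (Quotient.out x) = x := fun x => Quotient.out_eq x
  have hjd : F ^ e ∣ F ^ j * F ^ d := by
    rw [← pow_add]; apply pow_dvd_pow; omega
  refine Nat.card_eq_of_bijective (fun x => ⟨Ideal.Quotient.mk _ (F ^ d * Quotient.out x), ?_⟩) ⟨?_, ?_⟩
  · change Ideal.Quotient.mk _ (F ^ j * (F ^ d * _)) = 0
    rw [Ideal.Quotient.eq_zero_iff_mem, Ideal.mem_span_singleton, ← mul_assoc]
    exact Dvd.dvd.mul_right hjd _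
  · intro x y hxy
    have h := congrArg Subtype.val hxy
    change Ideal.Quotient.mk _ (F ^ d * Quotient.out x) = Ideal.Quotient.mk _ (F ^ d * Quotient.out y) at h
    rw [Ideal.Quotient.eq, Ideal.mem_span_singleton, ← mul_sub, ← hmd, add_comm, pow_add,
      mul_dvd_mul_iff_left (pow_ne_zero _ hF0)] at h
    rw [← hout x, ← hout y, Ideal.Quotient.eq, Ideal.mem_span_singleton]
    exact h
  · rintro ⟨y, hy⟩
    obtain ⟨r, rfl⟩ := Ideal.Quotient.mk_surjective y
    change Ideal.Quotient.mk _ (F ^ j * r) = 0 at hy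
    rw [Ideal.Quotient.eq_zero_iff_mem, Ideal.mem_span_singleton] at hy
    have hr : F ^ d ∣ r := by
      rcases hd with hd | hd
      · rw [hd]; simp
      · rw [← hmd, ← hd, pow_add] at hy
        exact (mul_dvd_mul_iff_left (pow_ne_zero _ hF0)).mp hy
    obtain ⟨s, rfl⟩ := hr
    refine ⟨Ideal.Quotient.mk _ s, ?_⟩
    apply Subtype.ext
    change Ideal.Quotient.mk _ (F ^ d * _) = Ideal.Quotient.mk _ (F ^ d * s)
    rw [Ideal.Quotient.eq, Ideal.mem_span_singleton, ← mul_sub, ← hmd, add_comm, pow_add,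
      mul_dvd_mul_iff_left (pow_ne_zero _ hF0)]
    have := hout (Ideal.Quotient.mk _ s)
    rw [Ideal.Quotient.eq, Ideal.mem_span_singleton] at this
    exact this

theorem TM_ker [Finite K] {T : Multiset (k[X] × ℕ)} (hT : Adm T) {f : k[X]} (hf : f.Monic) (hf' : Irreducible f)
    (j : ℕ) : Nat.card {v : TM i T // (f.map i) ^ j • v = 0} =
      Nat.card K ^ ((T.map fun c => if c.1 = f then min j (c.2 + 1) else 0).sum * f.natDegree) := by
  have hfin : ∀ c : TC T, Finite (OO (TF i T) (TE T) c) := fun c => finite_quot ((TF_monic i hT c).pow _)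
  have h1 : ∀ c : TC T, Nat.card {x : OO (TF i T) (TE T) c // (f.map i) ^ j • x = 0} =
      Nat.card K ^ ((if c.1.1 = f then min j (c.1.2 + 1) else 0) * f.natDegree) := by
    intro c
    split_ifs with h
    · have := ker_same (hf.map i) (c.1.2 + 1) j
      rw [natDegree_map] at this
      rw [← this]
      unfold OO TF TE
      rw [h]
    · rw [zero_mul, pow_zero]
      refine ker_coprime ?_ _ _
      have : IsCoprime f c.1.1 := by
        rcases hf'.isCoprime_or_dvd c.1.1 with h3 | h3
        · exact h3
        · exact absurd (eq_of_monic_of_associated hf (hT.mem c).1 (hf'.associated_of_dvd (hT.mem c).2 h3)).symm h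
      exact this.map (mapRingHom i)
  have h2 : Nat.card {v : TM i T // (f.map i) ^ j • v = 0} =
      ∏ p : (Σ c : TC T, TA T c), Nat.card {x : OO (TF i T) (TE T) p.1 // (f.map i) ^ j • x = 0} := by
    rw [← Nat.card_pi]
    exact Nat.card_congr ((Equiv.subtypeEquivRight fun b => funext_iff).trans
      (Equiv.subtypePiEquivPi (p := fun (p : Σ c : TC T, TA T c) (x : OO (TF i T) (TE T) p.1) => (f.map i) ^ j • x = 0)))
  rw [h2, Fintype.prod_sigma]
  simp only [h1, Finset.prod_const, Finset.card_univ, Fintype.card_fin, ← pow_mul]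
  rw [Finset.prod_pow_eq_pow_sum]
  congr 1
  rw [Finset.sum_multiset_map_count, Finset.sum_mul]
  exact (Finset.sum_congr rfl fun c _ => by rw [smul_eq_mul]; ring).trans
    (Finset.sum_coe_sort T.toFinset (fun c => T.count c • (if c.1 = f then min j (c.2 + 1) else 0) * f.natDegree))

theorem second_diff (T : Multiset (k[X] × ℕ)) (f : k[X]) (j : ℕ) :
    2 * (T.map fun c => if c.1 = f then min (j+1) (c.2 + 1) else 0).sum =
     (T.map fun c => if c.1 = f then min j (c.2 + 1) else 0).sum +
     (T.map fun c => if c.1 = f then min (j+2) (c.2 + 1) else 0).sum + T.count (f, j) := by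
  induction T using Multiset.induction_on with
  | empty => simp
  | cons c T ih =>
    simp only [Multiset.map_cons, Multiset.sum_cons, Multiset.count_cons]
    have : (if c.1 = f then min (j+1) (c.2 + 1) else 0) * 2 = (if c.1 = f then min j (c.2 + 1) else 0) +
      (if c.1 = f then min (j+2) (c.2 + 1) else 0) + (if (f, j) = c then 1 else 0) := by
      obtain ⟨a, b⟩ := c
      by_cases h : a = f
      · subst h
        by_cases h2 : j = b
        · subst h2; simp; omega
        · simp [h2]; omega
      · have : ¬ (f = a) := fun h' => h h'.symm
        simp [h, this]
    omega

theorem IsoT_unique [Finite K] {T T' : Multiset (k[X] × ℕ)} (hT : Adm T) (hT' : Adm T') {n : ℕ}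
    {A : Matrix (Fin n) (Fin n) K} (h : IsoT i A T) (h' : IsoT i A T') : T = T' := by
  obtain ⟨φ, hφ⟩ := h
  obtain ⟨φ', hφ'⟩ := h'
  let Φ := φ.symm.trans φ'
  have hX : ∀ v, Φ ((X : K[X]) • v) = (X : K[X]) • Φ v := by
    intro v
    simp only [Φ, LinearEquiv.trans_apply]
    rw [phi_symm φ hφ, hφ']
  have hp : ∀ (p : K[X]) v, Φ (p • v) = p • Φ v := fun p v => poly_lin Φ.toLinearMap hX p v
  have hN : ∀ f : k[X], f.Monic → Irreducible f → ∀ j,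
      (T.map fun c => if c.1 = f then min j (c.2 + 1) else 0).sum =
      (T'.map fun c => if c.1 = f then min j (c.2 + 1) else 0).sum := by
    intro f hf hf' j
    have h1 : Nat.card {v : TM i T // (f.map i) ^ j • v = 0} = Nat.card {v : TM i T' // (f.map i) ^ j • v = 0} := by
      refine Nat.card_congr (Equiv.subtypeEquiv Φ.toEquiv fun v => ?_)
      change _ ↔ (f.map i) ^ j • Φ v = 0
      rw [← hp, map_eq_zero_iff Φ Φ.injective]
    rw [TM_ker i hT hf hf', TM_ker i hT' hf hf'] at h1
    have h3 := Nat.pow_right_injective Finite.one_lt_card h1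
    exact Nat.eq_of_mul_eq_mul_right hf'.natDegree_pos h3
  ext ⟨f, j⟩
  by_cases hf : f.Monic ∧ Irreducible f
  · have h1 := second_diff T f j
    have h2 := second_diff T' f j
    rw [hN f hf.1 hf.2, hN f hf.1 hf.2, hN f hf.1 hf.2] at h1
    omega
  · rw [Multiset.count_eq_zero_of_notMem fun h => hf (hT _ h), Multiset.count_eq_zero_of_notMem fun h => hf (hT' _ h)]

theorem IsoT_size [Finite K] {T : Multiset (k[X] × ℕ)} (hT : Adm T) {n : ℕ}
    {A : Matrix (Fin n) (Fin n) K} (h : IsoT i A T) : (T.map fun c => (c.2 + 1) * c.1.natDegree).sum = n := by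
  obtain ⟨φ, hφ⟩ := h
  have h1 := Nat.card_congr φ.toEquiv
  rw [TM_card i hT, Nat.card_fun] at h1
  have := Nat.pow_right_injective Finite.one_lt_card h1
  simpa using this.symm
end uniq
end FFU


namespace FFU
universe v
section exist
open Polynomial
open scoped Classical
variable {k K : Type*} [Field k] [Field K] (i : k →+* K) {σ : K →+* K} (hσ : ∀ x, σ (σ x) = x)
  (hi : ∀ x, σ x = x ↔ ∃ y, i y = x)

include hi in
theorem sigma_ideal (I : Ideal K[X]) (h0 : I ≠ ⊥) (hI : ∀ p ∈ I, p.map σ ∈ I) :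
    ∃ m : k[X], m.Monic ∧ ∀ p, p ∈ I ↔ m.map i ∣ p := by
  set g := Submodule.IsPrincipal.generator I with hg
  have hg0 : g ≠ 0 := fun h => h0 ((Submodule.IsPrincipal.eq_bot_iff_generator_eq_zero I).mpr h)
  set μ := normalize g with hμ
  have hmem : ∀ p, p ∈ I ↔ μ ∣ p := by
    intro p
    rw [hμ, normalize_dvd_iff]
    exact Submodule.IsPrincipal.mem_iff_generator_dvd I
  have hm : μ.Monic := monic_normalize hg0
  have h1 : μ ∣ μ.map σ := (hmem _).mp (hI _ ((hmem _).mpr dvd_rfl))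
  have h2 : μ.map σ = μ := (eq_of_monic_of_dvd_of_natDegree_le hm (hm.map σ) h1 (by rw [natDegree_map]))
  obtain ⟨m, hm'⟩ := exists_lift i hi h2
  refine ⟨m, monic_of_injective i.injective (hm' ▸ hm), fun p => ?_⟩
  rw [hmem, hm']

section form
variable {V : Type*} [AddCommGroup V] [Module K V] [Module K[X] V] [IsScalarTower K K[X] V]

/-- a nondegenerate Hermitian form for which `X` is self adjoint -/
structure HForm (σ : K →+* K) (B : V → V → K) : Prop where
  hadd : ∀ x y z, B x (y + z) = B x y + B x z
  hsmul : ∀ (c : K) x y, B x (c • y) = c * B x y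
  hherm : ∀ x y, B y x = σ (B x y)
  hX : ∀ x y, B x ((X : K[X]) • y) = B ((X : K[X]) • x) y
  hnd : ∀ y, (∀ x, B x y = 0) → y = 0

variable {B : V → V → K} (hB : HForm σ B)
include hB
theorem HForm.zero_right (x : V) : B x 0 = 0 := by
  have := hB.hadd x 0 0
  simpa using this

theorem HForm.zero_left (x : V) : B 0 x = 0 := by
  rw [hB.hherm x 0, hB.zero_right, map_zero]

theorem HForm.add_left (x y z : V) : B (x + y) z = B x z + B y z := by
  rw [hB.hherm z, hB.hherm z x, hB.hherm z y, hB.hadd, map_add]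

theorem HForm.sub_left (x y z : V) : B (x - y) z = B x z - B y z := by
  rw [eq_sub_iff_add_eq, ← hB.add_left, sub_add_cancel]

theorem HForm.smul_left (c : K) (x y : V) : B (c • x) y = σ c * B x y := by
  rw [hB.hherm y, hB.hsmul, map_mul, ← hB.hherm]

theorem HForm.poly (p : K[X]) : ∀ x y : V, B x (p.map σ • y) = B (p • x) y := by
  induction p using Polynomial.induction_on' with
  | add p q hp hq =>
    intro x y; rw [Polynomial.map_add, add_smul, add_smul, hB.hadd, hB.add_left, hp, hq]
  | monomial n a =>
    intro x y
    have h : ∀ (a : K) (v : V), (monomial n a : K[X]) • v = a • (X ^ n : K[X]) • v := by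
      intro a v
      rw [← smul_assoc, smul_X_eq_monomial]
    rw [Polynomial.map_monomial, h, h, hB.hsmul, hB.smul_left]
    congr 1
    clear h
    induction n generalizing x with
    | zero => simp
    | succ n ih => rw [pow_succ', mul_smul, hB.hX, ih, ← mul_smul, ← pow_succ, pow_succ']

include hσ in
theorem HForm.poly' (p : K[X]) (x y : V) : B x (p • y) = B (p.map σ • x) y := by
  rw [← hB.poly, map_map_sig hσ]

include hσ hi in
theorem HForm.core [Finite V] [Nontrivial V] (hne : ∃ x, σ x ≠ x) :
    ∃ (f : k[X]) (e : ℕ) (x : V), f.Monic ∧ Irreducible f ∧ (f.map i) ^ (e + 1) • x = 0 ∧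
      B x ((f.map i) ^ e • x) ≠ 0 ∧
      ∀ r : K[X], (∀ s : K[X], B x (s • r • x) = 0) → (f.map i) ^ (e + 1) ∣ r := by
  have hann : Module.annihilator K[X] V ≠ ⊥ := by
    intro h
    have hinj : Function.Injective (fun (p : K[X]) (v : V) => p • v) := by
      intro p q hpq
      have : p - q ∈ Module.annihilator K[X] V := by
        rw [Module.mem_annihilator]; intro v
        rw [sub_smul, sub_eq_zero]; exact congrFun hpq v
      rw [h, Submodule.mem_bot, sub_eq_zero] at this
      exact this
    have := Finite.of_injective _ hinj
    exact not_finite K[X]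
  obtain ⟨m, hm, hmem⟩ := sigma_ideal i hi (Module.annihilator K[X] V) hann (by
    intro p hp
    rw [Module.mem_annihilator] at hp ⊢
    intro v
    apply hB.hnd
    intro x
    rw [hB.poly, hp, hB.zero_left])
  have hm1 : ¬ IsUnit m := by
    intro h
    obtain ⟨v, hv⟩ := exists_ne (0 : V)
    have h1 := (hmem 1).mpr (by rw [hm.isUnit_iff.mp h]; simp)
    rw [Module.mem_annihilator] at h1
    exact hv (by simpa using h1 v)
  obtain ⟨f, hf, hfi, hfm⟩ := exists_monic_irreducible_factor m hm1
  have hfin : FiniteMultiplicity f m := FiniteMultiplicity.of_prime_left hfi.prime hm.ne_zero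
  obtain ⟨m', hm', hnd⟩ := hfin.exists_eq_pow_mul_and_not_dvd
  obtain ⟨e, he⟩ : ∃ e, multiplicity f m = e + 1 := by
    cases h : multiplicity f m with
    | zero => rw [h, pow_zero, one_mul] at hm'; rw [hm'] at hfm; exact absurd hfm hnd
    | succ n => exact ⟨n, rfl⟩
  rw [he] at hm'
  set F := f.map i with hF
  set M' := m'.map i with hM'
  have hF0 : F ≠ 0 := (hf.map i).ne_zero
  have hm'0 : M' ≠ 0 := by
    rw [hM', Ne, Polynomial.map_eq_zero]; rintro rfl; exact hm.ne_zero (by rw [hm', mul_zero])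
  have hFσ : F.map σ = F := map_fix i hi f
  have hMσ : M'.map σ = M' := map_fix i hi m'
  have hmap : m.map i = F ^ (e+1) * M' := by rw [hm', Polynomial.map_mul, Polynomial.map_pow]
  have hgσ : (F ^ e * M' ^ 2).map σ = F ^ e * M' ^ 2 := by
    rw [Polynomial.map_mul, Polynomial.map_pow, Polynomial.map_pow, hFσ, hMσ]
  have hkill : ∀ v : V, (F ^ (e+1) * M') • v = 0 := by
    intro v
    have := (hmem (m.map i)).mpr dvd_rfl
    rw [Module.mem_annihilator, hmap] at this
    exact this v
  have h1 : ∃ x, B x ((F ^ e * M' ^ 2) • x) ≠ 0 := by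
    by_contra hcon
    push Not at hcon
    have := aniso hne (fun x y => B x ((F ^ e * M' ^ 2) • y)) (by intro x y z; simp only [smul_add, hB.hadd])
      (by intro c x y; simp only [smul_comm _ c, hB.hsmul])
      (by
        intro x y
        rw [hB.poly' hσ, hgσ, hB.hherm]) hcon
    have h2 : F ^ e * M' ^ 2 ∈ Module.annihilator K[X] V := by
      rw [Module.mem_annihilator]; intro v
      exact hB.hnd _ fun x => this x v
    rw [hmem, hmap, pow_succ, pow_two, ← mul_assoc, mul_dvd_mul_iff_right hm'0,
      mul_dvd_mul_iff_left (pow_ne_zero _ hF0)] at h2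
    exact hnd ((Polynomial.map_dvd_map' i).mp h2)
  obtain ⟨x, hx⟩ := h1
  have hx1 : F ^ (e + 1) • M' • x = 0 := by rw [← mul_smul]; exact hkill x
  have hx2 : B (M' • x) (F ^ e • M' • x) ≠ 0 := by
    rw [← hB.poly, hMσ, ← mul_smul, ← mul_smul]
    convert hx using 3
    ring
  refine ⟨f, e, M' • x, hf, hfi, hx1, hx2, ?_⟩
  set y := M' • x with hy
  let J : Ideal K[X] :=
    { carrier := {r | ∀ s : K[X], B y (s • r • y) = 0}
      add_mem' := by
        intro a b ha hb s
        rw [add_smul, smul_add, hB.hadd, ha, hb, add_zero]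
      zero_mem' := by intro s; rw [zero_smul, smul_zero, hB.zero_right]
      smul_mem' := by
        intro c a ha s
        rw [smul_eq_mul, mul_smul, ← mul_smul s]; exact ha _ }
  have hJ : ∀ r, r ∈ J ↔ ∀ s : K[X], B y (s • r • y) = 0 := fun r => Iff.rfl
  have hJF : F ^ (e+1) ∈ J := by
    rw [hJ]; intro s; rw [hx1, smul_zero, hB.zero_right]
  obtain ⟨l, hl, hlmem⟩ := sigma_ideal i hi J (by
      intro h; rw [h, Submodule.mem_bot] at hJF; exact pow_ne_zero _ hF0 hJF) (by
    intro p hp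
    rw [hJ] at hp ⊢
    intro s
    rw [← mul_smul, hB.poly' hσ, Polynomial.map_mul, map_map_sig hσ, hB.hherm y, mul_smul, hp, map_zero])
  have h3 : l ∣ f ^ (e + 1) := by
    rw [hlmem, hF, ← Polynomial.map_pow] at hJF
    exact (Polynomial.map_dvd_map' i).mp hJF
  obtain ⟨j, hj, hassoc⟩ := (dvd_prime_pow hfi.prime _).mp h3
  have hlj : l = f ^ j := eq_of_monic_of_associated hl (hf.pow j) hassoc
  have hje : j = e + 1 := by
    by_contra hcon
    have : F ^ e ∈ J := by
      rw [hlmem, hlj, Polynomial.map_pow]; exact pow_dvd_pow _ (by omega)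
    have := (hJ _).mp this 1
    rw [one_smul] at this
    exact hx2 this
  intro r hr
  have := (hlmem r).mp ((hJ r).mpr hr)
  rwa [hlj, Polynomial.map_pow, hje] at this

omit hB in
include hσ hi in
theorem exists_decomp [Finite K] (hne : ∃ x, σ x ≠ x) (N : ℕ) : ∀ (V : Type v) [AddCommGroup V] [Module K V] [Module K[X] V]
    [IsScalarTower K K[X] V] [Finite V] (B : V → V → K) (hB : HForm σ B), Nat.card V ≤ N →
    ∃ (ι : Type) (_ : Fintype ι) (t : ι → k[X]) (e : ι → ℕ), (∀ j, (t j).Monic ∧ Irreducible (t j)) ∧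
      Nonempty (V ≃ₗ[K[X]] ((j : ι) → K[X] ⧸ Ideal.span {(t j).map i ^ (e j + 1)})) := by
  induction N with
  | zero =>
    intro V _ _ _ _ _ B hB hc
    have : 0 < Nat.card V := Nat.card_pos
    omega
  | succ N ih =>
    intro V _ _ _ _ _ B hB hc
    rcases subsingleton_or_nontrivial V with hV | hV
    · refine ⟨Empty, inferInstance, Empty.elim, Empty.elim, fun j => j.elim, ⟨?_⟩⟩
      exact { toFun := fun _ j => j.elim, invFun := fun _ => 0, map_add' := fun _ _ => Subsingleton.elim _ _,
              map_smul' := fun _ _ => Subsingleton.elim _ _, left_inv := fun _ => Subsingleton.elim _ _,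
              right_inv := fun _ => Subsingleton.elim _ _ }
    obtain ⟨f, e, x, hf, hfi, hx0, hxn, hx⟩ := hB.core i hσ hi hne
    set F := f.map i with hF
    -- projection
    have hproj : ∀ v : V, ∃ r : K[X], ∀ s : K[X], B (v - r • x) (s • x) = 0 := by
      let W : Submodule K V := (Submodule.span K[X] {x}).restrictScalars K
      have hWmem : ∀ w, w ∈ W ↔ ∃ r : K[X], r • x = w := fun w => Submodule.mem_span_singleton
      have hfd : Module.Finite K W := Module.Finite.of_finite
      let D : V → Module.Dual K W := fun v =>
        { toFun := fun w => B v w.1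
          map_add' := by intro a b; exact hB.hadd _ _ _
          map_smul' := by intro c a; exact hB.hsmul _ _ _ }
      have hDfin : Finite (Module.Dual K W) := Module.finite_of_finite K
      have hinj : Function.Injective (fun w : W => D w.1) := by
        rintro ⟨w, hw⟩ ⟨w', hw'⟩ h
        apply Subtype.ext
        change w = w'
        obtain ⟨r, rfl⟩ := (hWmem _).mp hw
        obtain ⟨r', rfl⟩ := (hWmem _).mp hw'
        have h1 : ∀ s : K[X], B (r • x) (s • x) = B (r' • x) (s • x) := by
          intro s
          exact congrArg (fun L : Module.Dual K W => L ⟨s • x, (hWmem _).mpr ⟨s, rfl⟩⟩) h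
        have h2 : F ^ (e+1) ∣ r - r' := by
          apply hx
          intro s
          rw [hB.poly' hσ, hB.hherm, sub_smul, hB.sub_left, h1, sub_self, map_zero]
        obtain ⟨a, ha⟩ := h2
        rw [← sub_eq_zero, ← sub_smul, ha, mul_comm, mul_smul, hx0, smul_zero]
      have hcard : Nat.card W = Nat.card (Module.Dual K W) := by
        rw [Module.natCard_eq_pow_finrank (K := K) (V := W), Module.natCard_eq_pow_finrank (K := K) (V := Module.Dual K W),
          Subspace.dual_finrank_eq]
      have hbij := (Nat.bijective_iff_injective_and_card _).mpr ⟨hinj, hcard⟩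
      intro v
      obtain ⟨⟨w, hw⟩, h⟩ := hbij.2 (D v)
      obtain ⟨r, rfl⟩ := (hWmem _).mp hw
      refine ⟨r, fun s => ?_⟩
      have := congrArg (fun L : Module.Dual K W => L ⟨s • x, (hWmem _).mpr ⟨s, rfl⟩⟩) h
      change B (r • x) (s • x) = B v (s • x) at this
      rw [hB.sub_left, this, sub_self]
    let U : Submodule K[X] V :=
      { carrier := {v | ∀ s : K[X], B v (s • x) = 0}
        add_mem' := by intro a b ha hb s; rw [hB.add_left, ha, hb, add_zero]
        zero_mem' := by intro s; exact hB.zero_left _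
        smul_mem' := by intro c a ha s; rw [← hB.poly, ← mul_smul]; exact ha _ }
    have hU : ∀ v, v ∈ U ↔ ∀ s : K[X], B v (s • x) = 0 := fun v => Iff.rfl
    have hBU : HForm σ (fun a b : U => B a.1 b.1) :=
      { hadd := fun a b c => hB.hadd _ _ _
        hsmul := fun c a b => hB.hsmul _ _ _
        hherm := fun a b => hB.hherm _ _
        hX := fun a b => hB.hX _ _
        hnd := by
          intro u hu
          apply Subtype.ext
          apply hB.hnd
          intro v
          obtain ⟨r, hr⟩ := hproj v
          have h1 : v = (v - r • x) + r • x := by abel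
          rw [h1, hB.add_left, hu ⟨_, hr⟩, hB.hherm u.1, u.2, map_zero, add_zero] }
    have hxU : x ∉ U := by
      intro h
      exact hxn ((hU x).mp h _)
    have hcU : Nat.card U ≤ N := by
      have : Nat.card U < Nat.card V := by
        have : (U : Set V) ⊂ Set.univ := by
          rw [Set.ssubset_univ_iff]; intro h
          exact hxU (by rw [← SetLike.mem_coe, h]; trivial)
        have := Set.ncard_lt_ncard this
        rwa [Set.ncard_univ] at this
      omega
    obtain ⟨ι, hι, t, e', ht, ⟨Φ⟩⟩ := ih U _ hBU hcU
    refine ⟨Option ι, inferInstance, fun o => o.elim f t, fun o => o.elim e e', ?_, ⟨?_⟩⟩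
    · rintro (_ | j)
      · exact ⟨hf, hfi⟩
      · exact ht j
    · let ρ : (K[X] ⧸ Ideal.span {F ^ (e+1)}) →ₗ[K[X]] V :=
        Submodule.liftQ _ (LinearMap.toSpanSingleton K[X] V x) (by
          rw [Ideal.span, Submodule.span_le]
          rintro _ rfl
          exact hx0)
      have hρ : ∀ r : K[X], ρ (Ideal.Quotient.mk _ r) = r • x := fun r => rfl
      let Ψ : ((K[X] ⧸ Ideal.span {F ^ (e+1)}) × U) →ₗ[K[X]] V := ρ.coprod U.subtype
      have hΨ : Function.Bijective Ψ := by
        constructor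
        · rw [injective_iff_map_eq_zero]
          rintro ⟨o, u⟩ h
          obtain ⟨r, rfl⟩ := Ideal.Quotient.mk_surjective o
          have h' : r • x + u.1 = 0 := h
          have hr : F ^ (e+1) ∣ r := by
            apply hx
            intro s
            have : r • x = (-u).1 := eq_neg_of_add_eq_zero_left h'
            rw [hB.poly' hσ, hB.hherm, this, (-u).2, map_zero]
          have h1 : (Ideal.Quotient.mk (Ideal.span {F ^ (e+1)}) r) = 0 := by
            rw [Ideal.Quotient.eq_zero_iff_mem, Ideal.mem_span_singleton]; exact hr
          have h2 : r • x = 0 := by rw [← hρ, h1, map_zero]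
          rw [h2, zero_add] at h'
          exact Prod.ext h1 (Subtype.ext h')
        · intro v
          obtain ⟨r, hr⟩ := hproj v
          refine ⟨(Ideal.Quotient.mk _ r, ⟨v - r • x, hr⟩), ?_⟩
          change r • x + (v - r • x) = v
          abel
      exact ((LinearEquiv.ofBijective Ψ hΨ).symm.trans (LinearEquiv.prodCongr (LinearEquiv.refl _ _) Φ)).trans
        (LinearEquiv.piOptionEquivProd K[X] (M := fun o : Option ι =>
          K[X] ⧸ Ideal.span {(o.elim f t).map i ^ (o.elim e e' + 1)})).symm

omit hB in
theorem regroup {ι : Type} [Fintype ι] (t : ι → k[X]) (e : ι → ℕ) :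
    Nonempty (((j : ι) → K[X] ⧸ Ideal.span {(t j).map i ^ (e j + 1)}) ≃ₗ[K[X]]
      TM i (Finset.univ.val.map fun j => (t j, e j))) := by
  set T := Finset.univ.val.map fun j => (t j, e j) with hT
  let h : ι → TC T := fun j => ⟨(t j, e j), by
    rw [Multiset.mem_toFinset, hT]; exact Multiset.mem_map_of_mem _ (Finset.mem_univ j)⟩
  have hcard : ∀ c : TC T, Fintype.card {j // h j = c} = T.count c.1 := by
    intro c
    have h0 : T.count c.1 = (Finset.univ.val.map fun j => (t j, e j)).count c.1 := rfl
    rw [h0, Multiset.count_map, Fintype.card_subtype]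
    change Multiset.card _ = _
    congr 1
    rw [Finset.filter_val]
    apply Multiset.filter_congr
    intro j _
    rw [Subtype.ext_iff]
    exact eq_comm
  let E : (Σ c : TC T, TA T c) ≃ ι :=
    (Equiv.sigmaCongrRight fun c => (Fintype.equivFinOfCardEq (hcard c)).symm).trans (Equiv.sigmaFiberEquiv h)
  have hE : ∀ p, h (E p) = p.1 := by
    rintro ⟨c, a⟩
    exact ((Fintype.equivFinOfCardEq (hcard c)).symm a).2
  have hE' : ∀ p, Ideal.span {TF i T p.1 ^ TE T p.1} = Ideal.span {(t (E p)).map i ^ (e (E p) + 1)} := by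
    intro p
    rw [← hE p]
  exact ⟨((LinearEquiv.piCongrRight fun p => Submodule.quotEquivOfEq _ _ (hE' p)).trans
    (LinearEquiv.piCongrLeft K[X] (fun j => K[X] ⧸ Ideal.span {(t j).map i ^ (e j + 1)}) E)).symm⟩

end form

include hσ hi in
theorem exists_type [Finite K] (hne : ∃ x, σ x ≠ x) {n : ℕ} {A : Matrix (Fin n) (Fin n) K} (hA : Hct σ A ≠ 0) :
    ∃ T : Multiset (k[X] × ℕ), Adm T ∧ IsoT i A T := by
  have hne' : Nonempty {h : HU σ (Fin n) // h.1 * A = ct σ A * h.1} := by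
    by_contra hcon
    rw [not_nonempty_iff] at hcon
    exact hA Nat.card_of_isEmpty
  obtain ⟨⟨⟨h, hh, hu⟩, hc⟩⟩ := hne'
  simp only at hc
  let φ : (Fin n → K) →ₗ[K] (Fin n → K) := Matrix.mulVecLin A
  let o := Module.AEval'.of φ
  have hfin : Finite (Module.AEval' φ) := Finite.of_equiv _ o.toEquiv
  let B : Module.AEval' φ → Module.AEval' φ → K := fun v w => (σ ∘ (o.symm v)) ⬝ᵥ (h *ᵥ (o.symm w))
  have hB : HForm σ B :=
    { hadd := by intro x y z; simp only [B, map_add, mulVec_add, dotProduct_add]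
      hsmul := by intro c x y; simp only [B, map_smul, mulVec_smul, dotProduct_smul, smul_eq_mul]
      hherm := by
        intro x y
        simp only [B]
        conv_lhs => rw [← hh]
        simp only [dotProduct, mulVec, map_sum, map_mul, Finset.mul_sum, Function.comp, hσ, ct_apply]
        rw [Finset.sum_comm]
        refine Finset.sum_congr rfl fun i _ => Finset.sum_congr rfl fun j _ => by ring
      hX := by
        intro x y
        simp only [B, o, Module.AEval'.of_symm_X_smul]
        change _ ⬝ᵥ (h *ᵥ (A *ᵥ _)) = (σ ∘ (A *ᵥ _)) ⬝ᵥ _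
        rw [sig_mulVec, mulVec_mulVec, mulVec_mulVec, hc]
      hnd := by
        intro y hy
        apply o.symm.injective
        rw [map_zero]
        have h1 : h *ᵥ (o.symm y) = 0 := by
          ext j
          have h2 := hy (o (Pi.single j 1))
          simp only [B, LinearEquiv.symm_apply_apply] at h2
          have : σ ∘ (Pi.single j 1 : Fin n → K) = Pi.single j 1 := by
            ext k; by_cases h : k = j
            · subst h; simp
            · simp [h]
          rw [this] at h2
          simpa using h2
        exact (Matrix.mulVec_injective_iff_isUnit.mpr hu) (by rw [h1, mulVec_zero]) }
  obtain ⟨ι, hι, t, e, ht, ⟨Φ⟩⟩ := exists_decomp i hσ hi hne _ _ B hB le_rfl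
  obtain ⟨Φ'⟩ := regroup (K := K) i t e
  refine ⟨Finset.univ.val.map fun j => (t j, e j), ?_, ?_⟩
  · intro c hc
    obtain ⟨j, _, rfl⟩ := Multiset.mem_map.mp hc
    exact ht j
  · refine ⟨o.trans ((Φ.trans Φ').restrictScalars K), fun v => ?_⟩
    change (Φ.trans Φ') (o (φ v)) = X • (Φ.trans Φ') (o v)
    rw [← Module.AEval'.X_smul_of, map_smul]
end exist
end FFU


namespace FFU
section comb
open Polynomial
open scoped Classical
variable {k : Type*} [Field k] [Finite k]

theorem fin_ms {Y : Type*} (good : Y → Prop) (ω : Y → ℕ) (h1 : ∀ c, good c → 1 ≤ ω c) (n : ℕ)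
    (hfin : {c | good c ∧ ω c ≤ n}.Finite) :
    {T : Multiset Y | (∀ c ∈ T, good c) ∧ (T.map ω).sum = n}.Finite := by
  refine Set.Finite.subset (Finset.finite_toSet (n • hfin.toFinset.val).powerset.toFinset) ?_
  rintro T ⟨hg, hs⟩
  simp only [Finset.mem_coe, Multiset.mem_toFinset, Multiset.mem_powerset]
  rw [Multiset.le_iff_count]
  intro c
  by_cases hc : c ∈ T
  · have h2 : T.count c * ω c ≤ n := by
      rw [← hs, Finset.sum_multiset_map_count]
      have := Finset.single_le_sum (s := T.toFinset) (f := fun c => T.count c • ω c) (fun _ _ => Nat.zero_le _)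
        (Multiset.mem_toFinset.mpr hc)
      simpa using this
    have h3 := h1 c (hg c hc)
    have h4 : 1 ≤ T.count c := Multiset.one_le_count_iff_mem.mpr hc
    have h5 : c ∈ hfin.toFinset := by
      rw [Set.Finite.mem_toFinset]; exact ⟨hg c hc, by nlinarith⟩
    have h6 : 1 ≤ hfin.toFinset.val.count c := Multiset.one_le_count_iff_mem.mpr h5
    rw [Multiset.count_nsmul]
    nlinarith
  · rw [Multiset.count_eq_zero_of_notMem hc]; exact Nat.zero_le _

theorem fin_deg (n : ℕ) : {f : k[X] | f.natDegree ≤ n}.Finite := by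
  have h : Finite (degreeLT k (n+1)) := Finite.of_equiv _ (degreeLTEquiv k (n+1)).toEquiv.symm
  have : (degreeLT k (n+1) : Set k[X]).Finite := h
  refine this.subset ?_
  intro f hf
  simp only [SetLike.mem_coe, mem_degreeLT]
  exact lt_of_le_of_lt degree_le_natDegree (by simp only [Set.mem_setOf_eq] at hf; exact_mod_cast Nat.lt_succ_of_le hf)

theorem MS_fin (n : ℕ) : {M : Multiset k[X] | (∀ f ∈ M, f.Monic ∧ Irreducible f) ∧ (M.map natDegree).sum = n}.Finite := by
  refine fin_ms _ _ (fun c hc => hc.2.natDegree_pos) n ((fin_deg n).subset ?_)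
  rintro f ⟨_, h⟩; exact h

/-- multisets of monic irreducible polynomials -/
noncomputable def MS (k : Type*) [Field k] [Finite k] (n : ℕ) : Finset (Multiset k[X]) := (MS_fin (k := k) n).toFinset

theorem mem_MS {n : ℕ} {M : Multiset k[X]} :
    M ∈ MS k n ↔ (∀ f ∈ M, f.Monic ∧ Irreducible f) ∧ (M.map natDegree).sum = n := by
  rw [MS, Set.Finite.mem_toFinset]; rfl

theorem ST_fin (s n : ℕ) : {T : Multiset (k[X] × ℕ) | Adm T ∧ (T.map fun c => (c.2 + s + 1) * c.1.natDegree).sum = n}.Finite := by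
  refine fin_ms (fun c : k[X] × ℕ => c.1.Monic ∧ Irreducible c.1) _
    (fun c hc => by have := hc.2.natDegree_pos; nlinarith) n
    (((fin_deg n).prod (Set.finite_Iic n)).subset ?_)
  rintro ⟨f, e⟩ ⟨h, h'⟩
  have := h.2.natDegree_pos
  simp only at h' this
  refine ⟨?_, ?_⟩
  · simp only [Set.mem_setOf_eq]; nlinarith
  · simp only [Set.mem_Iic]; nlinarith

/-- shifted types -/
noncomputable def ST (k : Type*) [Field k] [Finite k] (s n : ℕ) : Finset (Multiset (k[X] × ℕ)) := (ST_fin (k := k) s n).toFinset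

theorem mem_ST {s n : ℕ} {T : Multiset (k[X] × ℕ)} :
    T ∈ ST k s n ↔ Adm T ∧ (T.map fun c => (c.2 + s + 1) * c.1.natDegree).sum = n := by
  rw [ST, Set.Finite.mem_toFinset]; rfl

/-- weight -/
noncomputable def wM (z : ℝ) (M : Multiset k[X]) : ℝ := ∏ f ∈ M.toFinset, wt z f.natDegree (M.count f)
/-- weight -/
noncomputable def wT (z : ℝ) (T : Multiset (k[X] × ℕ)) : ℝ := ∏ c ∈ T.toFinset, wt z c.1.natDegree (T.count c)

theorem wt_zero (z : ℝ) (d : ℕ) : wt z d 0 = 1 := by simp [wt]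

theorem wM_eq (z : ℝ) (M : Multiset k[X]) (S : Finset k[X]) (h : M.toFinset ⊆ S) :
    wM z M = ∏ f ∈ S, wt z f.natDegree (M.count f) := by
  refine Finset.prod_subset h fun f _ hf => ?_
  rw [Multiset.count_eq_zero_of_notMem (by rwa [Multiset.mem_toFinset] at hf), wt_zero]

theorem wT_eq (z : ℝ) (T : Multiset (k[X] × ℕ)) (S : Finset (k[X] × ℕ)) (h : T.toFinset ⊆ S) :
    wT z T = ∏ c ∈ S, wt z c.1.natDegree (T.count c) := by
  refine Finset.prod_subset h fun f _ hf => ?_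
  rw [Multiset.count_eq_zero_of_notMem (by rwa [Multiset.mem_toFinset] at hf), wt_zero]

variable {K : Type*} [Field K] [Fintype K] (i : k →+* K) {σ : K →+* K} (hσ : ∀ x, σ (σ x) = x)
  (hi : ∀ x, σ x = x ↔ ∃ y, i y = x)

include hσ hi in
theorem sum_HF (hne : ∃ x, σ x ≠ x) {q : ℝ} (hq : q = Nat.card k) (n : ℕ) :
    ∑ A : Matrix (Fin n) (Fin n) K, (Hct σ A * Fct σ A : ℝ) =
      Nat.card (GL (Fin n) K) * ∑ T ∈ ST k 0 n, wT (-1/q) T := by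
  have hA : ∀ A : Matrix (Fin n) (Fin n) K, (Hct σ A * Fct σ A : ℝ) =
      ∑ T ∈ ST k 0 n, wT (-1/q) T * ((if IsoT i A T then
      Nat.card {Y : Matrix (Fin n) (Fin n) K // A * Y = Y * A ∧ IsUnit Y} else 0 : ℕ) : ℝ) := by
    intro A
    by_cases h : ∃ T : Multiset (k[X] × ℕ), Adm T ∧ IsoT i A T
    · obtain ⟨T, hT, hAT⟩ := h
      rw [Finset.sum_eq_single T]
      · rw [if_pos hAT, HF_eq i hσ hi hT hne hq hAT, mul_comm]; rfl
      · intro T' hT' hne'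
        rw [if_neg, Nat.cast_zero, mul_zero]
        intro hAT'
        exact hne' (IsoT_unique i (mem_ST.mp hT').1 hT hAT' hAT)
      · intro hcon
        exact absurd (mem_ST.mpr ⟨hT, IsoT_size i hT hAT⟩) hcon
    · have h0 : Hct σ A = 0 := by
        by_contra hcon
        exact h (exists_type i hσ hi hne hcon)
      rw [h0, Nat.cast_zero, zero_mul, Finset.sum_eq_zero]
      intro T hT
      rw [if_neg, Nat.cast_zero, mul_zero]
      intro hAT
      exact h ⟨T, (mem_ST.mp hT).1, hAT⟩
  rw [Finset.sum_congr rfl fun A _ => hA A, Finset.sum_comm, Finset.mul_sum]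
  refine Finset.sum_congr rfl fun T hT => ?_
  rw [← Finset.mul_sum, ← Nat.cast_sum, orbit_sum i (mem_ST.mp hT).1 (mem_ST.mp hT).2, mul_comm]

include hσ hi in
theorem U_formula (hne : ∃ x, σ x ≠ x) {q : ℝ} (hq : q = Nat.card k) (n : ℕ) :
    (Nat.card {P : Matrix (Fin n) (Fin n) K × Matrix (Fin n) (Fin n) K //
      ct σ P.1 = -P.1 ∧ ct σ P.2 = -P.2 ∧ P.1 * P.2 = P.2 * P.1} : ℝ) =
     (q ^ (n * (n-1) / 2) * ∏ i ∈ Finset.range n, (q ^ (i+1) - (-1)^(i+1))) * ∑ T ∈ ST k 0 n, wT (-1/q) T := by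
  rw [card_HP_eq_skew hσ hne]
  have h1 := sum_HF i hσ hi hne hq n
  have h2 := HP_mul_HU hσ hne n
  have h3 := card_GL_eq hσ hne n (Q := q) (by rw [hq, card_fix i hi])
  have h4 : (Nat.card (HU σ (Fin n)) : ℝ) * Nat.card (HP σ n) = ∑ A : Matrix (Fin n) (Fin n) K, (Hct σ A * Fct σ A : ℝ) := by
    exact_mod_cast h2
  rw [h1, h3, mul_assoc] at h4
  have h5 : (Nat.card (HU σ (Fin n)) : ℝ) ≠ 0 := by
    have : Nonempty (HU σ (Fin n)) := ⟨⟨1, ct_one, isUnit_one⟩⟩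
    have : 0 < Nat.card (HU σ (Fin n)) := Nat.card_pos
    positivity
  exact mul_left_cancel₀ h5 h4
end comb
end FFU


namespace FFU
section comb2
open Polynomial UniqueFactorizationMonoid
open scoped Classical
variable {k : Type*} [Field k] [Finite k]

theorem ms_prod {M : Multiset k[X]} (h : ∀ f ∈ M, f.Monic ∧ Irreducible f) :
    M.prod.Monic ∧ normalizedFactors M.prod = M ∧ M.prod.natDegree = (M.map natDegree).sum := by
  have h1 : M.prod.Monic := by
    have := monic_multiset_prod_of_monic M id (fun f hf => (h f hf).1)
    simpa using this
  refine ⟨h1, ?_, ?_⟩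
  · rw [normalizedFactors_prod_eq M fun f hf => (h f hf).2]
    conv_rhs => rw [← Multiset.map_id M]
    exact Multiset.map_congr rfl fun f hf => (h f hf).1.normalize_eq_self
  · rw [natDegree_multiset_prod]
    intro h0
    exact (h 0 h0).2.ne_zero rfl

theorem card_MS (n : ℕ) : (MS k n).card = Nat.card k ^ n := by
  have h1 : Nat.card {p : k[X] // p.Monic ∧ p.natDegree = n} = Nat.card k ^ n := by
    rw [Nat.card_congr ((monicEquivDegreeLT n).trans (degreeLTEquiv k n).toEquiv), Nat.card_fun, Nat.card_fin]
  have h2 : Nat.card (MS k n) = (MS k n).card := by simp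
  rw [← h1, ← h2]
  refine Nat.card_eq_of_bijective (fun M : MS k n => ⟨M.1.prod, ?_⟩) ⟨?_, ?_⟩
  · obtain ⟨h, hs⟩ := mem_MS.mp M.2
    exact ⟨(ms_prod h).1, (ms_prod h).2.2.trans hs⟩
  · intro M M' h
    have h' : M.1.prod = M'.1.prod := congrArg Subtype.val h
    apply Subtype.ext
    rw [← (ms_prod (mem_MS.mp M.2).1).2.1, h', (ms_prod (mem_MS.mp M'.2).1).2.1]
  · rintro ⟨p, hp, hd⟩
    have hgood : ∀ f ∈ normalizedFactors p, f.Monic ∧ Irreducible f := by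
      intro f hf
      have hfi := irreducible_of_normalized_factor f hf
      refine ⟨?_, hfi⟩
      rw [← normalize_normalized_factor f hf]
      exact monic_normalize hfi.ne_zero
    have hprod : (normalizedFactors p).prod = p := by
      rw [prod_normalizedFactors_eq hp.ne_zero, hp.normalize_eq_self]
    refine ⟨⟨normalizedFactors p, mem_MS.mpr ⟨hgood, ?_⟩⟩, Subtype.ext hprod⟩
    rw [← (ms_prod hgood).2.2, hprod, hd]

/-- total weight -/
noncomputable def aM (k : Type*) [Field k] [Finite k] (z : ℝ) (n : ℕ) : ℝ := ∑ M ∈ MS k n, wM z M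
/-- total weight -/
noncomputable def pT (k : Type*) [Field k] [Finite k] (z : ℝ) (s n : ℕ) : ℝ := ∑ T ∈ ST k s n, wT z T

/-- glue -/
def glue (M : Multiset k[X]) (T : Multiset (k[X] × ℕ)) : Multiset (k[X] × ℕ) :=
  M.map (fun f => (f, 0)) + T.map (fun c => (c.1, c.2 + 1))
/-- layer -/
noncomputable def lay (T : Multiset (k[X] × ℕ)) : Multiset k[X] := (T.filter (fun c => c.2 = 0)).map Prod.fst
/-- rest -/
noncomputable def rest (T : Multiset (k[X] × ℕ)) : Multiset (k[X] × ℕ) :=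
  (T.filter (fun c => ¬ c.2 = 0)).map (fun c => (c.1, c.2 - 1))

theorem lay_glue (M : Multiset k[X]) (T : Multiset (k[X] × ℕ)) : lay (glue M T) = M := by
  unfold lay glue
  rw [Multiset.filter_add, Multiset.filter_map, Multiset.filter_map,
    Multiset.filter_eq_self.mpr (by intro a _; rfl), Multiset.filter_eq_nil.mpr (by intro a _; simp)]
  simp

theorem rest_glue (M : Multiset k[X]) (T : Multiset (k[X] × ℕ)) : rest (glue M T) = T := by
  unfold rest glue
  rw [Multiset.filter_add, Multiset.filter_map, Multiset.filter_map,
    Multiset.filter_eq_nil.mpr (by intro a _; simp), Multiset.filter_eq_self.mpr (by intro a _; simp)]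
  simp

theorem glue_lay_rest (T : Multiset (k[X] × ℕ)) : glue (lay T) (rest T) = T := by
  unfold rest glue lay
  rw [Multiset.map_map, Multiset.map_map]
  conv_rhs => rw [← Multiset.filter_add_not (fun c : k[X] × ℕ => c.2 = 0) T]
  congr 1
  · conv_rhs => rw [← Multiset.map_id (Multiset.filter _ T)]
    refine Multiset.map_congr rfl fun c hc => ?_
    rw [Multiset.mem_filter] at hc
    exact Prod.ext rfl hc.2.symm
  · conv_rhs => rw [← Multiset.map_id (Multiset.filter _ T)]
    refine Multiset.map_congr rfl fun c hc => ?_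
    rw [Multiset.mem_filter] at hc
    exact Prod.ext rfl (by have := hc.2; simp only [Function.comp, id]; omega)

theorem glue_size (s : ℕ) (M : Multiset k[X]) (T : Multiset (k[X] × ℕ)) :
    ((glue M T).map fun c => (c.2 + s + 1) * c.1.natDegree).sum =
      (s + 1) * (M.map natDegree).sum + (T.map fun c => (c.2 + (s+1) + 1) * c.1.natDegree).sum := by
  unfold glue
  rw [Multiset.map_add, Multiset.sum_add, Multiset.map_map, Multiset.map_map, ← Multiset.sum_map_mul_left]
  congr 2
  · refine Multiset.map_congr rfl fun c hc => ?_
    simp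
  · refine Multiset.map_congr rfl fun c hc => ?_
    simp only [Function.comp]; ring

theorem glue_adm (M : Multiset k[X]) (T : Multiset (k[X] × ℕ)) :
    Adm (glue M T) ↔ (∀ f ∈ M, f.Monic ∧ Irreducible f) ∧ Adm T := by
  unfold Adm glue
  constructor
  · intro h
    refine ⟨fun f hf => h (f, 0) ?_, fun c hc => h (c.1, c.2 + 1) ?_⟩
    · rw [Multiset.mem_add]; left; exact Multiset.mem_map_of_mem _ hf
    · rw [Multiset.mem_add]; right; exact Multiset.mem_map_of_mem (fun c : k[X] × ℕ => (c.1, c.2 + 1)) hc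
  · rintro ⟨h1, h2⟩ c hc
    rw [Multiset.mem_add, Multiset.mem_map, Multiset.mem_map] at hc
    rcases hc with ⟨f, hf, rfl⟩ | ⟨c, hc, rfl⟩
    · exact h1 f hf
    · exact h2 c hc

theorem glue_wT (z : ℝ) (M : Multiset k[X]) (T : Multiset (k[X] × ℕ)) :
    wT z (glue M T) = wM z M * wT z T := by
  have hi1 : Function.Injective (fun f : k[X] => (f, 0)) := by intro a b h; exact congrArg Prod.fst h
  have hi2 : Function.Injective (fun c : k[X] × ℕ => (c.1, c.2 + 1)) := by
    rintro ⟨a, b⟩ ⟨a', b'⟩ h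
    simpa using h
  have hd : Disjoint (M.toFinset.image (fun f : k[X] => (f, 0))) (T.toFinset.image (fun c : k[X] × ℕ => (c.1, c.2 + 1))) := by
    rw [Finset.disjoint_left]
    intro c hc hc'
    obtain ⟨f, _, rfl⟩ := Finset.mem_image.mp hc
    obtain ⟨d, _, h⟩ := Finset.mem_image.mp hc'
    simpa using congrArg Prod.snd h
  rw [wT_eq z _ (M.toFinset.image (fun f : k[X] => (f, 0)) ∪ T.toFinset.image (fun c : k[X] × ℕ => (c.1, c.2 + 1)))]
  · rw [Finset.prod_union hd, Finset.prod_image (fun a _ b _ h => hi1 h), Finset.prod_image (fun a _ b _ h => hi2 h)]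
    unfold wM wT glue
    congr 1
    · refine Finset.prod_congr rfl fun f _ => ?_
      rw [Multiset.count_add, Multiset.count_map_eq_count' _ _ hi1,
        Multiset.count_eq_zero_of_notMem (s := T.map _), add_zero]
      intro h
      obtain ⟨d, _, h⟩ := Multiset.mem_map.mp h
      simpa using congrArg Prod.snd h
    · refine Finset.prod_congr rfl fun c _ => ?_
      rw [Multiset.count_add, Multiset.count_map_eq_count' _ _ hi2,
        Multiset.count_eq_zero_of_notMem (s := M.map _), zero_add]
      intro h
      obtain ⟨d, _, h⟩ := Multiset.mem_map.mp h
      simpa using congrArg Prod.snd h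
  · intro c hc
    unfold glue at hc
    rw [Multiset.toFinset_add, Finset.mem_union, Multiset.mem_toFinset, Multiset.mem_toFinset, Multiset.mem_map, Multiset.mem_map] at hc
    rw [Finset.mem_union, Finset.mem_image, Finset.mem_image]
    simpa [Multiset.mem_toFinset] using hc

theorem pT_step (z : ℝ) (s n : ℕ) : pT k z s n =
    ∑ x ∈ Finset.HasAntidiagonal.antidiagonal n, (if (s+1) ∣ x.1 then aM k z (x.1 / (s+1)) else 0) * pT k z (s+1) x.2 := by
  have h1 : ∀ x : ℕ × ℕ, (if (s+1) ∣ x.1 then aM k z (x.1 / (s+1)) else 0) * pT k z (s+1) x.2 =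
      ∑ p ∈ (if (s+1) ∣ x.1 then MS k (x.1 / (s+1)) else ∅) ×ˢ ST k (s+1) x.2, wM z p.1 * wT z p.2 := by
    intro x
    rw [Finset.sum_product]
    split_ifs with h
    · rw [aM, pT, Finset.sum_mul_sum]
    · simp
  rw [Finset.sum_congr rfl fun x _ => h1 x, Finset.sum_sigma', pT]
  refine Finset.sum_nbij' (fun T => ⟨((s+1) * ((lay T).map natDegree).sum,
      ((rest T).map fun c => (c.2 + (s+1) + 1) * c.1.natDegree).sum), (lay T, rest T)⟩)
    (fun y => glue y.2.1 y.2.2) ?_ ?_ ?_ ?_ ?_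
  · intro T hT
    obtain ⟨ha, hs⟩ := mem_ST.mp hT
    rw [← glue_lay_rest T] at ha hs
    rw [glue_size] at hs
    rw [glue_adm] at ha
    rw [Finset.mem_sigma, Finset.HasAntidiagonal.mem_antidiagonal, Finset.mem_product]
    refine ⟨hs, ?_, mem_ST.mpr ⟨ha.2, rfl⟩⟩
    simp only [dvd_mul_right, if_true]
    rw [Nat.mul_div_cancel_left _ (Nat.succ_pos s)]
    exact mem_MS.mpr ⟨ha.1, rfl⟩
  · rintro ⟨⟨a, b⟩, M, T⟩ hy
    rw [Finset.mem_sigma, Finset.HasAntidiagonal.mem_antidiagonal, Finset.mem_product] at hy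
    obtain ⟨hab, hM, hT⟩ := hy
    simp only at hab hM hT
    split_ifs at hM with hd
    · obtain ⟨hM1, hM2⟩ := mem_MS.mp hM
      obtain ⟨hT1, hT2⟩ := mem_ST.mp hT
      rw [mem_ST]
      refine ⟨(glue_adm _ _).mpr ⟨hM1, hT1⟩, ?_⟩
      rw [glue_size, hM2, hT2, Nat.mul_div_cancel' hd, hab]
    · simp at hM
  · intro T _; exact glue_lay_rest T
  · rintro ⟨⟨a, b⟩, M, T⟩ hy
    rw [Finset.mem_sigma, Finset.HasAntidiagonal.mem_antidiagonal, Finset.mem_product] at hy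
    obtain ⟨hab, hM, hT⟩ := hy
    simp only at hab hM hT
    split_ifs at hM with hd
    · obtain ⟨hM1, hM2⟩ := mem_MS.mp hM
      obtain ⟨hT1, hT2⟩ := mem_ST.mp hT
      simp only [lay_glue, rest_glue]
      rw [hM2, hT2, Nat.mul_div_cancel' hd]
    · simp at hM
  · intro T hT
    simp only
    rw [← glue_wT, glue_lay_rest]

theorem pT_small (z : ℝ) (s n : ℕ) (h : n ≤ s) : pT k z s n = if n = 0 then 1 else 0 := by
  have h0 : ∀ T ∈ ST k s n, T = 0 := by
    intro T hT
    obtain ⟨ha, hs⟩ := mem_ST.mp hT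
    by_contra hne
    obtain ⟨c, hc⟩ := Multiset.exists_mem_of_ne_zero hne
    have h1 := Multiset.single_le_sum (s := T.map fun c => (c.2 + s + 1) * c.1.natDegree) (fun _ _ => Nat.zero_le _) _
      (Multiset.mem_map_of_mem _ hc)
    have := (ha c hc).2.natDegree_pos
    rw [hs] at h1
    nlinarith
  split_ifs with hn
  · subst hn
    have : ST k s 0 = {0} := by
      apply Finset.eq_singleton_iff_unique_mem.mpr
      exact ⟨mem_ST.mpr ⟨fun c hc => by simp at hc, by simp⟩, h0⟩
    rw [pT, this, Finset.sum_singleton]; simp [wT]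
  · have : ST k s n = ∅ := by
      apply Finset.eq_empty_of_forall_notMem
      intro T hT
      have h1 := h0 T hT
      have h2 := (mem_ST.mp hT).2
      rw [h1] at h2
      simp at h2; omega
    rw [pT, this, Finset.sum_empty]
end comb2
end FFU


namespace FFU
section comb3
open Polynomial
open scoped Classical

theorem one_sub_pow_pos {z : ℝ} (hz : |z| < 1) {d : ℕ} (hd : d ≠ 0) : 0 < 1 - z ^ d := by
  have h1 : |z ^ d| < 1 := by rw [abs_pow]; exact pow_lt_one₀ (abs_nonneg _) hz hd
  have := (abs_lt.mp h1).2
  linarith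

theorem wt_pos {z : ℝ} (hz : |z| < 1) {d : ℕ} (hd : d ≠ 0) (m : ℕ) : 0 < wt z d m := by
  unfold wt
  refine Finset.prod_pos fun j _ => inv_pos.mpr (one_sub_pow_pos hz ?_)
  exact Nat.mul_ne_zero (by omega) hd

theorem wt_sum {z : ℝ} (hz : |z| < 1) {d : ℕ} (hd : d ≠ 0) (m : ℕ) :
    ∑ j ∈ Finset.range (m+1), wt z d j * (z ^ d) ^ j = wt z d m := by
  induction m with
  | zero => simp [wt]
  | succ m ih =>
    rw [Finset.sum_range_succ, ih]
    have h : wt z d (m+1) = wt z d m * (1 - z ^ ((m+1)*d))⁻¹ := by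
      unfold wt; rw [Finset.prod_range_succ]
    rw [h]
    have h0 : 1 - z ^ ((m+1)*d) ≠ 0 := (one_sub_pow_pos hz (Nat.mul_ne_zero (by omega) hd)).ne'
    have h1 : (z ^ d) ^ (m+1) = z ^ ((m+1)*d) := by rw [← pow_mul, mul_comm]
    rw [h1]
    field_simp
    ring

variable {k : Type*} [Field k] [Finite k]

theorem sum_deg_eq (M : Multiset k[X]) (S : Finset k[X]) (h : M.toFinset ⊆ S) :
    (M.map natDegree).sum = ∑ f ∈ S, M.count f * f.natDegree := by
  rw [Finset.sum_multiset_map_count]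
  refine Finset.sum_subset_zero_on_sdiff h ?_ ?_
  · intro f hf
    rw [Finset.mem_sdiff, Multiset.mem_toFinset] at hf
    rw [Multiset.count_eq_zero_of_notMem hf.2, zero_mul]
  · intro f _; simp

theorem wM_sum {z : ℝ} (hz : |z| < 1) (M : Multiset k[X]) (hM : ∀ f ∈ M, f.natDegree ≠ 0) :
    wM z M = ∑ M' ∈ M.powerset.toFinset, wM z M' * z ^ (M'.map natDegree).sum := by
  have h1 : wM z M = ∏ f : M.toFinset, ∑ j ∈ Finset.range (M.count f.1 + 1), wt z f.1.natDegree j * (z ^ f.1.natDegree) ^ j := by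
    unfold wM
    rw [← Finset.prod_coe_sort]
    refine Finset.prod_congr rfl fun f _ => ?_
    rw [wt_sum hz (hM _ (Multiset.mem_toFinset.mp f.2))]
  rw [h1, Finset.prod_univ_sum]
  symm
  have hcount : ∀ (p : M.toFinset → ℕ) (f : M.toFinset), (∑ g : M.toFinset, p g • ({g.1} : Multiset k[X])).count f.1 = p f := by
    intro p f
    rw [Multiset.count_sum']
    rw [Finset.sum_eq_single f]
    · simp
    · intro g _ hg
      rw [Multiset.count_nsmul, Multiset.count_singleton, if_neg, mul_zero]
      intro h; exact hg (Subtype.ext h.symm)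
    · simp
  have hcount0 : ∀ (p : M.toFinset → ℕ) (f : k[X]), f ∉ M.toFinset → (∑ g : M.toFinset, p g • ({g.1} : Multiset k[X])).count f = 0 := by
    intro p f hf
    rw [Multiset.count_sum']
    refine Finset.sum_eq_zero fun g _ => ?_
    rw [Multiset.count_nsmul, Multiset.count_singleton, if_neg, mul_zero]
    rintro rfl; exact hf g.2
  refine Finset.sum_nbij' (fun M' f => M'.count f.1) (fun p => ∑ g : M.toFinset, p g • ({g.1} : Multiset k[X])) ?_ ?_ ?_ ?_ ?_
  · intro M' h
    rw [Multiset.mem_toFinset, Multiset.mem_powerset] at h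
    rw [Fintype.mem_piFinset]
    intro f
    rw [Finset.mem_range]
    have := Multiset.le_iff_count.mp h f.1
    omega
  · intro p h
    rw [Fintype.mem_piFinset] at h
    rw [Multiset.mem_toFinset, Multiset.mem_powerset, Multiset.le_iff_count]
    intro f
    by_cases hf : f ∈ M.toFinset
    · have := h ⟨f, hf⟩
      rw [Finset.mem_range] at this
      have h2 := hcount p ⟨f, hf⟩
      simp only at h2 this
      omega
    · rw [hcount0 p f hf]; exact Nat.zero_le _
  · intro M' h
    rw [Multiset.mem_toFinset, Multiset.mem_powerset] at h
    ext f
    by_cases hf : f ∈ M.toFinset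
    · exact hcount (fun f => M'.count f.1) ⟨f, hf⟩
    · refine (hcount0 (fun f => M'.count f.1) f hf).trans ?_
      have := Multiset.le_iff_count.mp h f
      rw [Multiset.count_eq_zero_of_notMem (s := M) (by rwa [Multiset.mem_toFinset] at hf)] at this
      omega
  · intro p h
    funext f
    exact hcount p f
  · intro M' h
    rw [Multiset.mem_toFinset, Multiset.mem_powerset] at h
    have hs : M'.toFinset ⊆ M.toFinset := Multiset.toFinset_subset.mpr (Multiset.subset_of_le h)
    rw [wM_eq z M' M.toFinset hs, sum_deg_eq M' M.toFinset hs, ← Finset.prod_pow_eq_pow_sum,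
      ← Finset.prod_mul_distrib, ← Finset.prod_coe_sort]
    refine Finset.prod_congr rfl fun f _ => ?_
    rw [← pow_mul, mul_comm (f.1.natDegree)]

theorem aM_rec {z : ℝ} (hz : |z| < 1) (n : ℕ) :
    aM k z n = ∑ x ∈ Finset.HasAntidiagonal.antidiagonal n, aM k z x.1 * z ^ x.1 * (Nat.card k : ℝ) ^ x.2 := by
  have hdeg : ∀ f : k[X], (f.Monic ∧ Irreducible f) → f.natDegree ≠ 0 := fun f hf => hf.2.natDegree_pos.ne'
  have h1 : aM k z n = ∑ p ∈ (MS k n).sigma (fun M => M.powerset.toFinset), wM z p.2 * z ^ (p.2.map natDegree).sum := by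
    rw [Finset.sum_sigma]
    unfold aM
    refine Finset.sum_congr rfl fun M hM => ?_
    rw [wM_sum hz M fun f hf => hdeg f ((mem_MS.mp hM).1 f hf)]
  have h2 : ∀ x : ℕ × ℕ, aM k z x.1 * z ^ x.1 * (Nat.card k : ℝ) ^ x.2 =
      ∑ p ∈ MS k x.1 ×ˢ MS k x.2, wM z p.1 * z ^ (p.1.map natDegree).sum := by
    intro x
    rw [Finset.sum_product]
    simp only [Finset.sum_const, card_MS, nsmul_eq_mul]
    unfold aM
    rw [Finset.sum_mul, Finset.sum_mul]
    refine Finset.sum_congr rfl fun M hM => ?_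
    rw [(mem_MS.mp hM).2]
    push_cast; ring
  rw [h1, Finset.sum_congr rfl fun x _ => h2 x]
  rw [Finset.sum_sigma' (Finset.HasAntidiagonal.antidiagonal n) (fun x => MS k x.1 ×ˢ MS k x.2)]
  refine Finset.sum_nbij' (fun p => ⟨((p.2.map natDegree).sum, ((p.1 - p.2).map natDegree).sum), (p.2, p.1 - p.2)⟩)
    (fun p => ⟨p.2.1 + p.2.2, p.2.1⟩) ?_ ?_ ?_ ?_ ?_
  · rintro ⟨M, M'⟩ h
    rw [Finset.mem_sigma, Multiset.mem_toFinset, Multiset.mem_powerset, mem_MS] at h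
    obtain ⟨⟨h1, h2⟩, h3⟩ := h
    simp only at h1 h2 h3
    rw [Finset.mem_sigma, Finset.HasAntidiagonal.mem_antidiagonal, Finset.mem_product, mem_MS, mem_MS]
    refine ⟨?_, ⟨fun f hf => h1 f (Multiset.mem_of_le h3 hf), rfl⟩, fun f hf => h1 f (Multiset.mem_of_le (Multiset.sub_le_self _ _) hf), rfl⟩
    simp only
    rw [← Multiset.sum_add, ← Multiset.map_add, add_tsub_cancel_of_le h3, h2]
  · rintro ⟨⟨a, b⟩, M, M'⟩ h
    rw [Finset.mem_sigma, Finset.HasAntidiagonal.mem_antidiagonal, Finset.mem_product, mem_MS, mem_MS] at h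
    obtain ⟨h0, ⟨h1, h2⟩, h3, h4⟩ := h
    simp only at h0 h1 h2 h3 h4
    rw [Finset.mem_sigma, Multiset.mem_toFinset, Multiset.mem_powerset, mem_MS]
    simp only
    refine ⟨⟨?_, ?_⟩, Multiset.le_add_right _ _⟩
    · intro f hf
      rcases Multiset.mem_add.mp hf with h | h
      · exact h1 f h
      · exact h3 f h
    · rw [Multiset.map_add, Multiset.sum_add, h2, h4, h0]
  · rintro ⟨M, M'⟩ h
    rw [Finset.mem_sigma, Multiset.mem_toFinset, Multiset.mem_powerset, mem_MS] at h
    have h3 := h.2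
    simp only at h3 ⊢
    rw [add_tsub_cancel_of_le h3]
  · rintro ⟨⟨a, b⟩, M, M'⟩ h
    rw [Finset.mem_sigma, Finset.HasAntidiagonal.mem_antidiagonal, Finset.mem_product, mem_MS, mem_MS] at h
    obtain ⟨h0, ⟨h1, h2⟩, h3, h4⟩ := h
    simp only at h0 h1 h2 h3 h4
    simp only [add_tsub_cancel_left, h2, h4]
  · rintro ⟨M, M'⟩ h
    rfl

theorem aM_zero (z : ℝ) : aM k z 0 = 1 := by
  have h : MS k 0 = {0} := by
    refine Finset.eq_singleton_iff_unique_mem.mpr ⟨mem_MS.mpr ⟨by simp, by simp⟩, ?_⟩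
    intro M hM
    obtain ⟨h1, h2⟩ := mem_MS.mp hM
    refine Multiset.eq_zero_of_forall_notMem fun f hf => ?_
    have h3 : f.natDegree ∈ M.map natDegree := Multiset.mem_map_of_mem _ hf
    have := Multiset.le_sum_of_mem h3
    have := (h1 f hf).2.natDegree_pos
    omega
  unfold aM
  rw [h]; simp [wM]

theorem aM_step {z : ℝ} (hz : |z| < 1) (n : ℕ) :
    aM k z (n+1) * (1 - z^(n+1)) = Nat.card k * aM k z n := by
  have h := aM_rec (k := k) hz (n+1)
  rw [Finset.Nat.antidiagonal_succ', Finset.sum_cons, Finset.sum_map] at h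
  simp only [Function.Embedding.prodMap, Function.Embedding.coeFn_mk, Prod.map, Function.Embedding.refl_apply, Nat.succ_eq_add_one, pow_zero, mul_one] at h
  have h2 := aM_rec (k := k) hz n
  have : ∑ x ∈ Finset.HasAntidiagonal.antidiagonal n, aM k z x.1 * z ^ x.1 * (Nat.card k : ℝ) ^ (x.2+1) = Nat.card k * aM k z n := by
    rw [h2, Finset.mul_sum]
    refine Finset.sum_congr rfl fun x _ => ?_
    ring
  rw [← this]
  linarith

theorem wM_nonneg {z : ℝ} (hz : |z| < 1) (M : Multiset k[X]) (h : ∀ f ∈ M, f.Monic ∧ Irreducible f) : 0 ≤ wM z M := by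
  unfold wM
  refine Finset.prod_nonneg fun f hf => (wt_pos hz ?_ _).le
  exact (h f (Multiset.mem_toFinset.mp hf)).2.natDegree_pos.ne'

theorem aM_nonneg {z : ℝ} (hz : |z| < 1) (n : ℕ) : 0 ≤ aM k z n :=
  Finset.sum_nonneg fun M hM => wM_nonneg hz M (mem_MS.mp hM).1

theorem pT_nonneg {z : ℝ} (hz : |z| < 1) (s n : ℕ) : 0 ≤ pT k z s n := by
  refine Finset.sum_nonneg fun T hT => ?_
  unfold wT
  refine Finset.prod_nonneg fun f hf => (wt_pos hz ?_ _).le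
  exact ((mem_ST.mp hT).1 f (Multiset.mem_toFinset.mp hf)).2.natDegree_pos.ne'

end comb3
end FFU


namespace FFU
section ana
open Filter Topology

variable {a : ℕ → ℝ} {q : ℝ} (hq : 1 < q) (ha0 : a 0 = 1)
  (ha : ∀ n, a (n+1) * (1 - (-1/q)^(n+1)) = q * a n) (hann : ∀ n, 0 ≤ a n)

include hq in
theorem abs_z : |(-1/q)| < 1 := by
  rw [abs_div, abs_neg, abs_one, abs_of_pos (by linarith), div_lt_one (by linarith)]; exact hq

include hq ha0 ha hann in
theorem a_pos (n : ℕ) : 0 < a n := by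
  induction n with
  | zero => rw [ha0]; norm_num
  | succ n ih =>
    refine (hann _).lt_of_ne' fun h => ?_
    have := ha n
    rw [h, zero_mul] at this
    have : 0 < q * a n := by positivity
    linarith

include hq ha0 ha hann in
theorem a_summable {v : ℝ} (hv : |v| < 1 / q) : Summable fun n => a n * v ^ n := by
  have hz := abs_z hq
  have hq0 : 0 < q := by linarith
  rcases eq_or_ne v 0 with rfl | hv0
  · refine summable_of_ne_finset_zero (s := {0}) fun n hn => ?_
    rw [zero_pow (by simpa using hn), mul_zero]
  have hlim : Tendsto (fun n => q / (1 - (-1/q)^(n+1)) * |v|) atTop (𝓝 (q / (1 - 0) * |v|)) := by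
    have h1 : Tendsto (fun n : ℕ => (-1/q)^(n+1)) atTop (𝓝 0) :=
      (tendsto_add_atTop_iff_nat 1).mpr (tendsto_pow_atTop_nhds_zero_of_abs_lt_one hz)
    exact ((tendsto_const_nhds.div (tendsto_const_nhds.sub h1) (by norm_num))).mul_const _
  refine summable_of_ratio_test_tendsto_lt_one (l := q / (1 - 0) * |v|) ?_ ?_ ?_
  · rw [sub_zero, div_one]
    rw [lt_div_iff₀ hq0] at hv; linarith
  · exact Eventually.of_forall fun n => mul_ne_zero (a_pos hq ha0 ha hann n).ne' (pow_ne_zero _ hv0)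
  · refine hlim.congr fun n => ?_
    have h1 := one_sub_pow_pos hz (Nat.succ_ne_zero n)
    have h2 : a (n+1) = q * a n / (1 - (-1/q)^(n+1)) := by
      rw [eq_div_iff h1.ne']; exact ha n
    have h3 := a_pos hq ha0 ha hann n
    have h4 : 0 < |v| ^ n := by positivity
    rw [norm_mul, norm_mul, norm_pow, norm_pow, Real.norm_eq_abs, Real.norm_eq_abs, Real.norm_eq_abs,
      abs_of_pos h3, abs_of_pos (a_pos hq ha0 ha hann (n+1)), h2, pow_succ |v|]
    simp only [Nat.succ_eq_add_one] at h1
    field_simp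

include hq ha0 ha hann in
theorem F_step {v : ℝ} (hv : |v| < 1 / q) :
    (1 - q * v) * (∑' n, a n * v ^ n) = ∑' n, a n * ((-1/q) * v) ^ n := by
  have hz := abs_z hq
  have hq0 : 0 < q := by linarith
  have hzv : |(-1/q) * v| < 1/q := by
    rw [abs_mul]
    refine lt_of_le_of_lt ?_ hv
    nlinarith [abs_nonneg v]
  have s1 := a_summable hq ha0 ha hann hv
  have s2 := a_summable hq ha0 ha hann hzv
  have e1 := s1.tsum_eq_zero_add
  have e2 := s2.tsum_eq_zero_add
  have h : ∀ n, a (n+1) * ((-1/q) * v) ^ (n+1) = a (n+1) * v^(n+1) - q * v * (a n * v^n) := by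
    intro n
    have := ha n
    rw [mul_pow]
    have : a (n+1) * (-1/q)^(n+1) = a (n+1) - q * a n := by linarith
    calc _ = (a (n+1) * (-1/q)^(n+1)) * v^(n+1) := by ring
      _ = _ := by rw [this]; ring
  rw [e2, tsum_congr h, Summable.tsum_sub ((summable_nat_add_iff 1).mpr s1) (s1.mul_left _), tsum_mul_left]
  simp only [pow_zero, mul_one] at *
  linarith

include hq ha0 ha hann in
theorem F_prod {v : ℝ} (hv : |v| < 1 / q) (L : ℕ) :
    (∏ l ∈ Finset.range L, (1 - q * ((-1/q)^l * v))⁻¹) * (∑' n, a n * ((-1/q)^L * v) ^ n) = ∑' n, a n * v ^ n := by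
  have hz := abs_z hq
  have hq0 : 0 < q := by linarith
  have hb : ∀ l : ℕ, |(-1/q)^l * v| < 1/q := by
    intro l
    rw [abs_mul, abs_pow]
    refine lt_of_le_of_lt ?_ hv
    have := pow_le_one₀ (n := l) (abs_nonneg (-1/q)) hz.le
    nlinarith [abs_nonneg v]
  induction L with
  | zero => simp
  | succ L ih =>
    rw [← ih, Finset.prod_range_succ, mul_assoc]
    congr 1
    have h1 := F_step hq ha0 ha hann (hb L)
    have h2 : (-1/q) ^ (L+1) * v = (-1/q) * ((-1/q)^L * v) := by ring
    rw [h2, ← h1, ← mul_assoc, inv_mul_cancel₀, one_mul]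
    have h3 := hb L
    rw [lt_div_iff₀ hq0] at h3
    have := (abs_lt.mp (show |q * ((-1/q)^L * v)| < 1 by rw [abs_mul, abs_of_pos hq0]; linarith)).2
    linarith

include hq ha0 ha hann in
theorem F_lim {v : ℝ} (hv : |v| < 1 / q) :
    Tendsto (fun L => ∏ l ∈ Finset.range L, (1 - q * ((-1/q)^l * v))⁻¹) atTop (𝓝 (∑' n, a n * v ^ n)) := by
  have hz := abs_z hq
  have hq0 : 0 < q := by linarith
  have h1 : Tendsto (fun L : ℕ => ∑' n, a n * ((-1/q)^L * v) ^ n) atTop (𝓝 (∑' n, a n * (0:ℝ)^n)) := by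
    refine tendsto_tsum_of_dominated_convergence (bound := fun n => a n * |v|^n)
      (a_summable hq ha0 ha hann (by rwa [abs_abs])) ?_ ?_
    · intro n
      have h2 := (tendsto_pow_atTop_nhds_zero_of_abs_lt_one hz).mul_const v
      rw [zero_mul] at h2
      exact (h2.pow n).const_mul _
    · refine Eventually.of_forall fun L n => ?_
      rw [norm_mul, norm_pow, Real.norm_eq_abs, Real.norm_eq_abs, abs_of_nonneg (hann n)]
      refine mul_le_mul_of_nonneg_left (pow_le_pow_left₀ (abs_nonneg _) ?_ _) (hann n)
      rw [abs_mul, abs_pow]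
      have := pow_le_one₀ (n := L) (abs_nonneg (-1/q)) hz.le
      nlinarith [abs_nonneg v]
  have h0 : ∑' n, a n * (0:ℝ)^n = 1 := by
    rw [tsum_eq_single 0]
    · simp [ha0]
    · intro n hn; rw [zero_pow hn, mul_zero]
  rw [h0] at h1
  have h2 := (tendsto_const_nhds (x := ∑' n, a n * v ^ n)).div h1 one_ne_zero
  rw [div_one] at h2
  refine h2.congr' ?_
  filter_upwards [h1.eventually_ne one_ne_zero] with L hL
  rw [Pi.div_apply, div_eq_iff hL]
  exact (F_prod hq ha0 ha hann hv L).symm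

theorem inv_multi {ι : Type*} {x : ι → ℝ} {c : ℝ} (hc : c < 1) (hx : ∀ i, |x i| ≤ c) (hs : Summable fun i => |x i|) :
    Multipliable fun i => (1 - x i)⁻¹ := by
  have hp : ∀ i, 1 - c ≤ 1 - x i := by
    intro i
    have := le_of_abs_le (hx i)
    linarith
  have hm : Multipliable fun i => 1 + x i / (1 - x i) := by
    refine multipliable_one_add_of_summable ?_
    refine Summable.of_nonneg_of_le (fun _ => norm_nonneg _) ?_ (hs.mul_left (1 - c)⁻¹)
    intro i
    have := hp i
    rw [norm_div, Real.norm_eq_abs, Real.norm_eq_abs, abs_of_pos (a := 1 - _) (by linarith), div_eq_inv_mul]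
    gcongr
  refine hm.congr fun i => ?_
  have h1 := hp i
  have h0 : 1 - x i ≠ 0 := by
    have : 0 < 1 - x i := by linarith
    exact this.ne'
  field_simp
  ring

include hq in
theorem g_multi {u : ℝ} (hu : |u| < 1 / q) :
    (Multipliable fun il : ℕ × ℕ => (1 - q * ((-1/q)^il.2 * u^(il.1+1)))⁻¹) ∧
    ∀ i : ℕ, Multipliable fun l : ℕ => (1 - q * ((-1/q)^l * u^(i+1)))⁻¹ := by
  have hz := abs_z hq
  have hq0 : 0 < q := by linarith
  have hu1 : |u| < 1 := hu.trans ((div_lt_one hq0).mpr hq)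
  have hqu : q * |u| < 1 := by rw [lt_div_iff₀ hq0] at hu; linarith
  have hx : ∀ il : ℕ × ℕ, |q * ((-1/q)^il.2 * u^(il.1+1))| ≤ q * |u| := by
    intro il
    rw [abs_mul, abs_mul, abs_pow, abs_pow, abs_of_pos hq0, pow_succ]
    have h1 := pow_le_one₀ (n := il.2) (abs_nonneg (-1/q)) hz.le
    have h2 := pow_le_one₀ (n := il.1) (abs_nonneg u) hu1.le
    refine mul_le_mul_of_nonneg_left ?_ hq0.le
    calc _ ≤ 1 * (1 * |u|) := by gcongr
      _ = |u| := by ring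
  have hs : Summable fun il : ℕ × ℕ => |q * ((-1/q)^il.2 * u^(il.1+1))| := by
    have h1 : Summable fun i : ℕ => |u|^i := summable_geometric_of_lt_one (abs_nonneg _) hu1
    have h2 : Summable fun i : ℕ => |-1/q|^i := summable_geometric_of_lt_one (abs_nonneg _) hz
    have h3 := (h1.mul_of_nonneg h2 (fun _ => by positivity) (fun _ => by positivity)).mul_left (q * |u|)
    refine h3.congr fun il => ?_
    rw [abs_mul, abs_mul, abs_pow, abs_pow, abs_of_pos hq0, pow_succ]
    ring
  exact ⟨inv_multi hqu hx hs, fun i => inv_multi hqu (fun l => hx (i, l)) (hs.prod_factor i)⟩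

include hq in
theorem abs_pow_lt {u : ℝ} (hu : |u| < 1 / q) (s : ℕ) : |u ^ (s+1)| < 1 / q := by
  have hu1 : |u| < 1 := hu.trans ((div_lt_one (by linarith)).mpr hq)
  refine lt_of_le_of_lt ?_ hu
  rw [abs_pow, pow_succ]
  have h2 := pow_le_one₀ (n := s) (abs_nonneg u) hu1.le
  nlinarith [abs_nonneg u]

include hq ha0 ha hann in
theorem prod_lim {u : ℝ} (hu : |u| < 1 / q) :
    Tendsto (fun N => ∏ s ∈ Finset.range N, ∑' n, a n * (u^(s+1)) ^ n) atTop
      (𝓝 (∏' il : ℕ × ℕ, (1 - q * ((-1/q)^il.2 * u^(il.1+1)))⁻¹)) := by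
  obtain ⟨h1, h2⟩ := g_multi hq hu
  refine (h1.hasProd.prod_fiberwise fun i => ?_).tendsto_prod_nat
  have h3 := (h2 i).hasProd
  have h4 := tendsto_nhds_unique h3.tendsto_prod_nat (F_lim hq ha0 ha hann (abs_pow_lt hq hu i))
  rw [h4] at h3
  exact h3

/-- spread coefficients -/
noncomputable def fS (a : ℕ → ℝ) (s n : ℕ) : ℝ := if (s+1) ∣ n then a (n / (s+1)) else 0
/-- partial product coefficients -/
noncomputable def cN (a : ℕ → ℝ) : ℕ → ℕ → ℝ
  | 0, n => if n = 0 then 1 else 0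
  | N+1, n => ∑ x ∈ Finset.HasAntidiagonal.antidiagonal n, cN a N x.1 * fS a N x.2

include hann in
theorem fS_nonneg (s n : ℕ) : 0 ≤ fS a s n := by
  unfold fS; split_ifs
  · exact hann _
  · exact le_rfl

include hann in
theorem cN_nonneg (N n : ℕ) : 0 ≤ cN a N n := by
  induction N generalizing n with
  | zero => unfold cN; split_ifs <;> norm_num
  | succ N ih => unfold cN; exact Finset.sum_nonneg fun x _ => mul_nonneg (ih _) (fS_nonneg hann _ _)

include hq ha0 ha hann in
theorem fS_hasSum {v : ℝ} (hv : |v| < 1 / q) (s : ℕ) :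
    HasSum (fun n => fS a s n * v ^ n) (∑' n, a n * (v^(s+1)) ^ n) := by
  have hi : Function.Injective fun m : ℕ => (s+1) * m := fun x y h => Nat.eq_of_mul_eq_mul_left (Nat.succ_pos s) h
  rw [← hi.hasSum_iff]
  · have h1 := (a_summable hq ha0 ha hann (abs_pow_lt hq hv s)).hasSum
    convert h1 using 2 with m
    simp only [Function.comp]
    unfold fS
    rw [if_pos (Dvd.intro m rfl), Nat.mul_div_cancel_left m (Nat.succ_pos s), pow_mul]
  · intro n hn
    unfold fS
    rw [if_neg, zero_mul]
    rintro ⟨m, rfl⟩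
    exact hn ⟨m, rfl⟩

include hq ha0 ha hann in
theorem cN_hasSum {v : ℝ} (hv : |v| < 1 / q) (N : ℕ) :
    HasSum (fun n => cN a N n * v ^ n) (∏ s ∈ Finset.range N, ∑' n, a n * (v^(s+1)) ^ n) := by
  induction N with
  | zero =>
    rw [Finset.prod_range_zero]
    convert hasSum_ite_eq (0 : ℕ) (1 : ℝ) using 2 with n
    unfold cN
    by_cases h : n = 0
    · simp [h]
    · simp [h]
  | succ N ih =>
    have h1 := fS_hasSum hq ha0 ha hann hv N
    have e : ∀ n, ∑ kl ∈ Finset.HasAntidiagonal.antidiagonal n, (cN a N kl.1 * v^kl.1) * (fS a N kl.2 * v^kl.2) = cN a (N+1) n * v^n := by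
      intro n
      rw [cN, Finset.sum_mul]
      refine Finset.sum_congr rfl fun x hx => ?_
      rw [← Finset.HasAntidiagonal.mem_antidiagonal.mp hx, pow_add]; ring
    have h2 := summable_norm_sum_mul_antidiagonal_of_summable_norm ih.summable.norm h1.summable.norm
    have h3 := tsum_mul_tsum_eq_tsum_sum_antidiagonal_of_summable_norm ih.summable.norm h1.summable.norm
    rw [Finset.prod_range_succ, ← ih.tsum_eq, ← h1.tsum_eq, h3]
    simp only [e] at h2 ⊢
    exact h2.of_norm.hasSum

variable {p : ℕ → ℕ → ℝ} (hp0 : ∀ s n, 0 ≤ p s n)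
  (hstep : ∀ s n, p s n = ∑ x ∈ Finset.HasAntidiagonal.antidiagonal n, fS a s x.1 * p (s+1) x.2)
  (hsmall : ∀ s n, n ≤ s → p s n = if n = 0 then 1 else 0)

include hstep in
theorem p_cN (N n : ℕ) : p 0 n = ∑ x ∈ Finset.HasAntidiagonal.antidiagonal n, cN a N x.1 * p N x.2 := by
  have key : PowerSeries.mk (p 0) = PowerSeries.mk (cN a N) * PowerSeries.mk (p N) := by
    induction N with
    | zero =>
      have : PowerSeries.mk (cN a 0) = 1 := by
        ext n; rw [PowerSeries.coeff_mk, PowerSeries.coeff_one, cN]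
      rw [this, one_mul]
    | succ N ih =>
      have h1 : PowerSeries.mk (cN a (N+1)) = PowerSeries.mk (cN a N) * PowerSeries.mk (fS a N) := by
        ext n; rw [PowerSeries.coeff_mk, PowerSeries.coeff_mul, cN]
        simp only [PowerSeries.coeff_mk]
      have h2 : PowerSeries.mk (p N) = PowerSeries.mk (fS a N) * PowerSeries.mk (p (N+1)) := by
        ext n; rw [PowerSeries.coeff_mk, PowerSeries.coeff_mul, hstep]
        simp only [PowerSeries.coeff_mk]
      rw [ih, h2, h1, mul_assoc]
  have := congrArg (PowerSeries.coeff n) key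
  rw [PowerSeries.coeff_mul] at this
  simpa only [PowerSeries.coeff_mk] using this

include hann hp0 hstep hsmall in
theorem cN_le (N n : ℕ) : cN a N n ≤ p 0 n := by
  rw [p_cN hstep N n]
  have h := Finset.single_le_sum (f := fun x : ℕ × ℕ => cN a N x.1 * p N x.2)
    (s := Finset.HasAntidiagonal.antidiagonal n)
    (fun x _ => mul_nonneg (cN_nonneg hann N x.1) (hp0 N x.2)) (a := (n, 0)) (by simp)
  simpa [hsmall N 0 (Nat.zero_le _)] using h

include hstep hsmall in
theorem cN_eq (N n : ℕ) (h : n ≤ N) : cN a N n = p 0 n := by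
  rw [p_cN hstep N n, Finset.sum_eq_single (n, 0)]
  · simp [hsmall N 0 (Nat.zero_le _)]
  · rintro ⟨x, y⟩ hxy hne
    have := Finset.HasAntidiagonal.mem_antidiagonal.mp hxy
    simp only at this
    rw [hsmall N y (by omega), if_neg, mul_zero]
    rintro rfl
    apply hne
    rw [← this, add_zero]
  · intro h; simp at h

include hq ha0 ha hann hp0 hstep hsmall in
theorem final_ana {u : ℝ} (hu : |u| < 1 / q) :
    Summable (fun n => p 0 n * u ^ n) ∧
    (Multipliable fun il : ℕ × ℕ => (1 - q * ((-1/q)^il.2 * u^(il.1+1)))⁻¹) ∧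
    ∑' n, p 0 n * u ^ n = ∏' il : ℕ × ℕ, (1 - q * ((-1/q)^il.2 * u^(il.1+1)))⁻¹ := by
  have hu' : |(|u|)| < 1/q := by rwa [abs_abs]
  obtain ⟨C, hC⟩ := (prod_lim hq ha0 ha hann hu').bddAbove_range
  have hs : Summable fun n => p 0 n * |u| ^ n := by
    refine summable_of_sum_range_le (c := C) (fun n => mul_nonneg (hp0 0 n) (by positivity)) fun N => ?_
    refine le_trans ?_ (hC ⟨N, rfl⟩)
    have h1 := cN_hasSum hq ha0 ha hann hu' N
    refine le_trans (le_of_eq ?_) (sum_le_hasSum (Finset.range N) (fun n _ => mul_nonneg (cN_nonneg hann N n) (by positivity)) h1)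
    refine Finset.sum_congr rfl fun n hn => ?_
    rw [cN_eq hstep hsmall N n (Finset.mem_range.mp hn).le]
  have hs' : Summable fun n => p 0 n * u ^ n := by
    refine Summable.of_norm_bounded hs fun n => ?_
    rw [norm_mul, norm_pow, Real.norm_eq_abs, Real.norm_eq_abs, abs_of_nonneg (hp0 0 n)]
  refine ⟨hs', (g_multi hq hu).1, ?_⟩
  have h1 : Tendsto (fun N => ∑' n, cN a N n * u^n) atTop (𝓝 (∑' n, p 0 n * u^n)) := by
    refine tendsto_tsum_of_dominated_convergence (bound := fun n => p 0 n * |u|^n) hs ?_ ?_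
    · intro n
      refine tendsto_const_nhds.congr' ?_
      filter_upwards [eventually_ge_atTop n] with N hN
      rw [cN_eq hstep hsmall N n hN]
    · refine Eventually.of_forall fun N n => ?_
      rw [norm_mul, norm_pow, Real.norm_eq_abs, Real.norm_eq_abs, abs_of_nonneg (cN_nonneg hann N n)]
      exact mul_le_mul_of_nonneg_right (cN_le hann hp0 hstep hsmall N n) (by positivity)
  refine tendsto_nhds_unique h1 ?_
  refine (prod_lim hq ha0 ha hann hu).congr fun N => ?_
  exact (cN_hasSum hq ha0 ha hann hu N).tsum_eq.symm

end ana
end FFU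


namespace FFU
section inst

theorem exists_sigma {q : ℕ} (hq : ∃ p m : ℕ, p.Prime ∧ 0 < m ∧ q = p ^ m)
    {K : Type} [Field K] [Fintype K] (hK : Fintype.card K = q ^ 2) :
    ∃ σ : K →+* K, (∀ x, σ x = x ^ q) ∧ (∀ x, σ (σ x) = x) ∧ ∃ x, σ x ≠ x := by
  obtain ⟨p, m, hp, hm, rfl⟩ := hq
  have hpf : Fact p.Prime := ⟨hp⟩
  have hdvd : p ∣ Fintype.card K := by
    rw [hK, ← pow_mul]; exact dvd_pow_self p (by omega)
  have hchar : CharP K p := by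
    obtain ⟨r, hr⟩ := CharP.exists K
    obtain ⟨n, hrp, hn⟩ := FiniteField.card K r
    rw [hn] at hdvd
    have := (Nat.prime_dvd_prime_iff_eq hp hrp).mp (hp.dvd_of_dvd_pow hdvd)
    subst this; exact hr
  have hexp : ExpChar K p := ExpChar.prime hp
  have h1 : ∀ x : K, iterateFrobenius K p m x = x ^ (p^m) := fun x => iterateFrobenius_def p m x
  refine ⟨iterateFrobenius K p m, h1, fun x => ?_, ?_⟩
  · rw [h1, h1, ← pow_mul, ← pow_two, ← hK, FiniteField.pow_card]
  · by_contra! hcon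
    have hq1 : 1 < p ^ m := Nat.one_lt_pow hm.ne' hp.one_lt
    have h0 : (Polynomial.X ^ (p^m) - Polynomial.X : Polynomial K) ≠ 0 :=
      FiniteField.X_pow_card_sub_X_ne_zero K hq1
    have h2 : Fintype.card K ≤ (Polynomial.X ^ (p^m) - Polynomial.X : Polynomial K).natDegree := by
      classical
      refine le_trans ?_ (Polynomial.card_roots' _)
      refine le_trans ?_ (Multiset.toFinset_card_le _)
      refine Finset.card_le_card fun x _ => ?_
      rw [Multiset.mem_toFinset, Polynomial.mem_roots h0]
      simp [← h1, hcon]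
    rw [FiniteField.X_pow_card_sub_X_natDegree_eq K hq1, hK] at h2
    nlinarith

end inst
end FFU

theorem feit_fine_unitary
    (q : ℕ) (hq : ∃ p m : ℕ, p.Prime ∧ 0 < m ∧ q = p ^ m)
    (K : Type) [Field K] [Fintype K] (hK : Fintype.card K = q ^ 2)
    (u : ℝ) (hu : |u| < 1 / q) :
    Summable (fun n : ℕ => (guCommPairs q K n : ℝ) * u ^ n / guOrder q n) ∧
    Multipliable (fun il : ℕ × ℕ =>
      (1 - (-1 : ℝ) ^ il.2 * u ^ (il.1 + 1) * (q : ℝ) ^ ((1 : ℤ) - il.2))⁻¹) ∧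
    ∑' n : ℕ, (guCommPairs q K n : ℝ) * u ^ n / guOrder q n =
      ∏' il : ℕ × ℕ,
        (1 - (-1 : ℝ) ^ il.2 * u ^ (il.1 + 1) * (q : ℝ) ^ ((1 : ℤ) - il.2))⁻¹ := by
  obtain ⟨σ, hσq, hσ, hne⟩ := FFU.exists_sigma hq hK
  have hq1 : 1 < q := by
    obtain ⟨p, m, hp, hm, rfl⟩ := hq
    exact Nat.one_lt_pow hm.ne' hp.one_lt
  have hqR : (1:ℝ) < q := by exact_mod_cast hq1
  let k := RingHom.eqLocusField σ (RingHom.id K)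
  let i : k →+* K := k.subtype
  have hi : ∀ x, σ x = x ↔ ∃ y, i y = x := by
    intro x
    constructor
    · intro h; exact ⟨⟨x, h⟩, rfl⟩
    · rintro ⟨y, rfl⟩; exact y.2
  have hk : Nat.card k = q := by
    have h1 := FFU.card_eq_fix_sq hσ hne
    rw [FFU.card_fix i hi, Nat.card_eq_fintype_card, hK] at h1
    exact (Nat.pow_left_injective (n := 2) (by norm_num) h1).symm
  have hz : |(-1 / (q:ℝ))| < 1 := FFU.abs_z hqR
  have hmain := FFU.final_ana (a := FFU.aM k (-1/(q:ℝ))) (p := FFU.pT k (-1/(q:ℝ))) hqR (FFU.aM_zero _)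
    (fun n => by rw [FFU.aM_step hz n, hk]) (fun n => FFU.aM_nonneg hz n)
    (fun s n => FFU.pT_nonneg hz s n) (fun s n => FFU.pT_step _ s n) (fun s n h => FFU.pT_small _ s n h) hu
  have e1 : (fun n : ℕ => (guCommPairs q K n : ℝ) * u ^ n / guOrder q n) =
      fun n => FFU.pT k (-1/(q:ℝ)) 0 n * u ^ n := by
    funext n
    have hU := FFU.U_formula i hσ hi hne (q := (q:ℝ)) (by rw [hk]) n
    have hc : (guCommPairs q K n : ℝ) = guOrder q n * FFU.pT k (-1/(q:ℝ)) 0 n := by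
      have h2 : (fun a : K => a ^ q) = σ := by funext a; exact (hσq a).symm
      unfold guCommPairs
      rw [h2]
      exact hU
    have h0 : guOrder q n ≠ 0 := by
      unfold guOrder
      refine mul_ne_zero (pow_ne_zero _ (by linarith)) (Finset.prod_ne_zero_iff.mpr fun j _ => ?_)
      have h3 : 1 < (q:ℝ)^(j+1) := one_lt_pow₀ hqR (Nat.succ_ne_zero j)
      have h4 : (-1:ℝ)^(j+1) ≤ 1 := by
        rcases neg_one_pow_eq_or ℝ (j+1) with h | h <;> rw [h] <;> norm_num
      have : 0 < (q:ℝ)^(j+1) - (-1:ℝ)^(j+1) := by linarith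
      exact this.ne'
    rw [hc]
    field_simp
  have e2 : (fun il : ℕ × ℕ => (1 - (-1 : ℝ) ^ il.2 * u ^ (il.1 + 1) * (q : ℝ) ^ ((1 : ℤ) - il.2))⁻¹) =
      fun il : ℕ × ℕ => (1 - (q:ℝ) * ((-1/(q:ℝ))^il.2 * u^(il.1+1)))⁻¹ := by
    funext il
    have hq0 : (q:ℝ) ≠ 0 := by linarith
    rw [zpow_sub₀ hq0, zpow_one, zpow_natCast, div_pow]
    congr 2
    ring
  rw [e1, e2]
  exact hmain
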